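/- There is an absolute constant C such that for every T > 0 and every solution u of the defocusing cubic NLS on [0,T] × ℝ², ∫₀^T ∫_{ℝ²} |u(t,x)|⁴ dx dt ≤ C · T^{1/3} · ( sup_{t ∈ [0,T]} ‖u(t,·)‖_{L²(ℝ²)}³ ‖u(t,·)‖_{Ḣ¹(ℝ²)} + ‖u(0,·)‖_{L²(ℝ²)}⁴ ). -/

import Mathlib

open MeasureTheory Real Complex
open scoped FourierTransform ENNReal ContDiff

noncomputable section

/-- The `j`-th partial derivative of a function on `EuclideanSpace ℝ (Fin n)`. -/
def pd {n : ℕ} {F : Type*} [NormedAddCommGroup F] [NormedSpace ℝ F]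
    (j : Fin n) (f : EuclideanSpace ℝ (Fin n) → F) (x : EuclideanSpace ℝ (Fin n)) : F :=
  fderiv ℝ f x (EuclideanSpace.single j 1)

/-- The Laplacian. -/
def lap {n : ℕ} {F : Type*} [NormedAddCommGroup F] [NormedSpace ℝ F]
    (f : EuclideanSpace ℝ (Fin n) → F) (x : EuclideanSpace ℝ (Fin n)) : F :=
  ∑ j, pd j (pd j f) x

/-- `f` coincides with a (complex-valued) Schwartz function. -/
def IsSchwartz {n : ℕ} (f : EuclideanSpace ℝ (Fin n) → ℂ) : Prop :=
  ∃ g : SchwartzMap (EuclideanSpace ℝ (Fin n)) ℂ, ⇑g = f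

/-- `f` coincides with a (real-valued) Schwartz function. -/
def IsSchwartzR {n : ℕ} (f : EuclideanSpace ℝ (Fin n) → ℝ) : Prop :=
  ∃ g : SchwartzMap (EuclideanSpace ℝ (Fin n)) ℝ, ⇑g = f

/-- A (smooth, spatially Schwartz) solution of the defocusing cubic NLS
`i ∂ₜ u + Δ u = |u|² u` on `[0,T] × ℝⁿ`. -/
def IsNLSSolution (n : ℕ) (T : ℝ) (u : ℝ → EuclideanSpace ℝ (Fin n) → ℂ) : Prop :=
  ContDiff ℝ ∞ (Function.uncurry u) ∧
  (∀ t ∈ Set.Icc (0:ℝ) T, IsSchwartz (u t)) ∧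
  (∀ t ∈ Set.Icc (0:ℝ) T, ∀ x, Complex.I * deriv (fun s => u s x) t + lap (u t) x
      = (‖u t x‖ : ℂ)^2 * u t x)

/-- Inhomogeneous Sobolev norm via the Fourier transform. -/
def HsNorm {n : ℕ} (σ : ℝ) (f : EuclideanSpace ℝ (Fin n) → ℂ) : ℝ :=
  (∫ ξ, (1 + ‖ξ‖) ^ (2 * σ) * ‖𝓕 f ξ‖ ^ 2) ^ ((1:ℝ)/2)

/-- Homogeneous Sobolev norm via the Fourier transform. -/
def HdotNorm {n : ℕ} (σ : ℝ) (f : EuclideanSpace ℝ (Fin n) → ℂ) : ℝ :=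
  (∫ ξ, ‖ξ‖ ^ (2 * σ) * ‖𝓕 f ξ‖ ^ 2) ^ ((1:ℝ)/2)

/-- The Fourier multiplier operator with (real) symbol `m`. -/
def fourierMult {n : ℕ} (m : EuclideanSpace ℝ (Fin n) → ℝ) (f : EuclideanSpace ℝ (Fin n) → ℂ) :
    EuclideanSpace ℝ (Fin n) → ℂ :=
  𝓕⁻ (fun ξ => (m ξ : ℂ) * 𝓕 f ξ)

/-- The standing hypotheses on the radial profile `φ` of the symbol of the smoothing
operator `I = I_N`, with derivative-bound constants `Ck` (independent of `N`). -/
structure IMultiplier (s N : ℝ) (Ck : ℕ → ℝ) (φ : ℝ → ℝ) : Prop where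
  contDiff : ContDiffOn ℝ ∞ φ (Set.Ioi 0)
  pos : ∀ r > (0:ℝ), 0 < φ r
  le_one : ∀ r > (0:ℝ), φ r ≤ 1
  anti : AntitoneOn φ (Set.Ioi 0)
  eq_one : ∀ r : ℝ, 0 < r → r ≤ N → φ r = 1
  eq_pow : ∀ r : ℝ, 2 * N ≤ r → φ r = (r / N) ^ (s - 1)
  mono_mul : MonotoneOn (fun r => r * φ r) (Set.Ioi 0)
  deriv_bound : ∀ k : ℕ, 1 ≤ k → ∀ r > (0:ℝ), |iteratedDeriv k φ r| ≤ Ck k * φ r * r ^ (-(k:ℝ))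

/-- The smoothing operator `I = I_N`, a Fourier multiplier with symbol `φ (|ξ|)`. -/
def Iop {n : ℕ} (φ : ℝ → ℝ) (f : EuclideanSpace ℝ (Fin n) → ℂ) : EuclideanSpace ℝ (Fin n) → ℂ :=
  fourierMult (fun ξ => φ ‖ξ‖) f

/-- The operator `⟨D⟩ I_N`, a Fourier multiplier with symbol `(1 + |ξ|) φ (|ξ|)`. -/
def DIop {n : ℕ} (φ : ℝ → ℝ) (f : EuclideanSpace ℝ (Fin n) → ℂ) : EuclideanSpace ℝ (Fin n) → ℂ :=
  fourierMult (fun ξ => (1 + ‖ξ‖) * φ ‖ξ‖) f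

/-- Mixed space-time norm `‖v‖_{L^q_{[0,T]} L^r_x}` (with values in `ℝ≥0∞`). -/
def mixNorm {α : Type*} [MeasureSpace α] {F : Type*} [NormedAddCommGroup F]
    (T : ℝ) (q r : ℝ≥0∞) (v : ℝ → α → F) : ℝ≥0∞ :=
  eLpNorm (fun t => (eLpNorm (v t) r volume).toReal) q (volume.restrict (Set.Ioc 0 T))

/-- An admissible pair in `ℝ²`: `1/q + 1/r = 1/2` and `2 < q ≤ ∞`. -/
def Admissible (q r : ℝ≥0∞) : Prop := 1/q + 1/r = 1/2 ∧ 2 < q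

/-- The `L²` norm. -/
def L2Norm {n : ℕ} (f : EuclideanSpace ℝ (Fin n) → ℂ) : ℝ :=
  (∫ x, ‖f x‖ ^ 2) ^ ((1:ℝ)/2)

/-- The `L²` norm of the (spatial) gradient. -/
def gradL2Norm {n : ℕ} (f : EuclideanSpace ℝ (Fin n) → ℂ) : ℝ :=
  (∫ x, ∑ j, ‖pd j f x‖ ^ 2) ^ ((1:ℝ)/2)

/-- Space-time `L⁴_{[0,T]} L⁴_x` norm (real-valued). -/
def L4L4Norm {n : ℕ} (T : ℝ) (v : ℝ → EuclideanSpace ℝ (Fin n) → ℂ) : ℝ :=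
  (∫ t in Set.Ioc (0:ℝ) T, ∫ x, ‖v t x‖ ^ 4) ^ ((1:ℝ)/4)

/-- The modified energy `E(v) = ½∫|∇v|² + ¼∫|v|⁴`. -/
def energy {n : ℕ} (v : EuclideanSpace ℝ (Fin n) → ℂ) : ℝ :=
  (1/2) * (∫ x, ∑ j, ‖pd j v x‖ ^ 2) + (1/4) * ∫ x, ‖v x‖ ^ 4

/-- The Morawetz action `M_a(t) = 2 ∫ ∇a · Im (ū ∇u) dx`. -/
def morAction {n : ℕ} (a : EuclideanSpace ℝ (Fin n) → ℝ)
    (u : ℝ → EuclideanSpace ℝ (Fin n) → ℂ) (t : ℝ) : ℝ :=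
  2 * ∫ x, ∑ j, pd j a x * ((starRingEnd ℂ) (u t x) * pd j (u t) x).im

/-- All derivatives of `a` grow at most polynomially. -/
def PolyGrowth {n : ℕ} (a : EuclideanSpace ℝ (Fin n) → ℝ) : Prop :=
  ∀ k : ℕ, ∃ C d : ℝ, ∀ x, ‖iteratedFDeriv ℝ k a x‖ ≤ C * (1 + ‖x‖) ^ d

section Flux

variable {E : Type*} [NormedAddCommGroup E] [NormedSpace ℝ E] [FiniteDimensional ℝ E]
  [MeasurableSpace E] [BorelSpace E] {μ : Measure E} [μ.IsAddHaarMeasure]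

/-- Differentiation in time of an integral against a compactly supported weight. -/
theorem integral_cutoff_sub_eq {χ : E → ℝ} (hχ : Continuous χ) (hχc : HasCompactSupport χ)
    {ρ ρt : ℝ → E → ℝ} {a b : ℝ} (hab : a ≤ b)
    (hρ : Continuous (Function.uncurry ρ)) (hρt : Continuous (Function.uncurry ρt))
    (hd : ∀ t ∈ Set.Icc a b, ∀ x, HasDerivAt (fun s => ρ s x) (ρt t x) t) :
    (∫ x, χ x * ρ b x ∂μ) - ∫ x, χ x * ρ a x ∂μ = ∫ t in a..b, ∫ x, χ x * ρt t x ∂μ := by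
  have hcont : ∀ t, Continuous (ρ t) := fun t => hρ.comp (by fun_prop : Continuous fun x => (t, x))
  have hInt : ∀ t, Integrable (fun x => χ x * ρ t x) μ := fun t =>
    (hχ.mul (hcont t)).integrable_of_hasCompactSupport hχc.mul_right
  rw [← integral_sub (hInt b) (hInt a)]
  have hK : IsCompact (tsupport χ) := hχc
  have h0 : ∀ x ∉ tsupport χ, χ x = 0 := fun x hx => image_eq_zero_of_notMem_tsupport hx
  have h1 : ∀ x, χ x * ρ b x - χ x * ρ a x = ∫ t in a..b, χ x * ρt t x := by
    intro x
    rw [intervalIntegral.integral_const_mul, intervalIntegral.integral_eq_sub_of_hasDerivAt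
      (f := fun t => ρ t x)]
    · ring
    · intro t ht
      rw [Set.uIcc_of_le hab] at ht
      exact hd t ht x
    · exact (hρt.comp (by fun_prop : Continuous fun t => (t, x))).intervalIntegrable _ _
  simp_rw [h1]
  rw [← setIntegral_eq_integral_of_forall_compl_eq_zero (s := tsupport χ)
    (by intro x hx; simp [h0 x hx])]
  have h2 : ∀ t, ∫ x, χ x * ρt t x ∂μ = ∫ x in tsupport χ, χ x * ρt t x ∂μ := fun t =>
    (setIntegral_eq_integral_of_forall_compl_eq_zero (by intro x hx; simp [h0 x hx])).symm
  simp_rw [h2, intervalIntegral.integral_of_le hab]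
  rw [integral_integral_swap]
  have h3 : ContinuousOn (Function.uncurry fun x t => χ x * ρt t x)
      (tsupport χ ×ˢ Set.Icc a b) := by
    apply Continuous.continuousOn
    exact (hχ.comp continuous_fst).mul (hρt.comp continuous_swap)
  have h4 := h3.integrableOn_compact (μ := μ.prod volume) (hK.prod isCompact_Icc)
  rw [Measure.prod_restrict]
  exact h4.mono_set (Set.prod_mono le_rfl Set.Ioc_subset_Icc_self)

theorem continuous_integral_cutoff {χ : E → ℝ} (hχ : Continuous χ) (hχc : HasCompactSupport χ)
    {F : ℝ → E → ℝ} (hF : Continuous (Function.uncurry F)) :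
    Continuous fun t => ∫ x, χ x * F t x ∂μ := by
  have h2 : ∀ t, ∫ x, χ x * F t x ∂μ = ∫ x in tsupport χ, χ x * F t x ∂μ := fun t =>
    (setIntegral_eq_integral_of_forall_compl_eq_zero
      (by intro x hx; simp [image_eq_zero_of_notMem_tsupport hx])).symm
  simp_rw [h2]
  refine continuous_parametric_integral_of_continuous ?_ hχc
  exact (hχ.comp continuous_snd).mul hF

/-- A localized balance law. -/
theorem flux_cutoff {ι : Type*} [Fintype ι] {e : ι → E} {χ : E → ℝ} (hχ : ContDiff ℝ 1 χ)
    (hχc : HasCompactSupport χ) (hχ0 : ∀ x, 0 ≤ χ x) (hχ1 : ∀ x, χ x ≤ 1) {δ : ℝ}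
    (hδ : ∀ i x, |fderiv ℝ χ x (e i)| ≤ δ)
    {ρ ρt P Q : ℝ → E → ℝ} {J dJ : ι → ℝ → E → ℝ} {a b β B : ℝ} (hab : a ≤ b)
    (hρ : Continuous (Function.uncurry ρ)) (hρt : Continuous (Function.uncurry ρt))
    (hP : Continuous (Function.uncurry P)) (hQ : Continuous (Function.uncurry Q))
    (hJc : ∀ i, Continuous (Function.uncurry (J i)))
    (hdJc : ∀ i, Continuous (Function.uncurry (dJ i)))
    (hd : ∀ t ∈ Set.Icc a b, ∀ x, HasDerivAt (fun s => ρ s x) (ρt t x) t)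
    (hJ : ∀ i, ∀ t ∈ Set.Icc a b, ∀ x, HasLineDerivAt ℝ (J i t) (dJ i t x) x (e i))
    (heq : ∀ t ∈ Set.Icc a b, ∀ x, ρt t x + ∑ i, dJ i t x + P t x ≤ Q t x)
    (hQ0 : ∀ t ∈ Set.Icc a b, ∀ x, 0 ≤ Q t x)
    (hQi : ∀ t ∈ Set.Icc a b, Integrable (Q t) μ ∧ ∫ x, Q t x ∂μ ≤ β)
    (hJi : ∀ i, ∀ t ∈ Set.Icc a b, Integrable (J i t) μ ∧ ∫ x, |J i t x| ∂μ ≤ B) :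
    (∫ t in a..b, ∫ x, χ x * P t x ∂μ) + ∫ x, χ x * ρ b x ∂μ
      ≤ (∫ x, χ x * ρ a x ∂μ) + (β + δ * Fintype.card ι * B) * (b - a) := by
  have hχcont : Continuous χ := hχ.continuous
  have slice : ∀ {F : ℝ → E → ℝ}, Continuous (Function.uncurry F) → ∀ t, Continuous (F t) :=
    fun hF t => hF.comp (by fun_prop : Continuous fun x => (t, x))
  have hInt : ∀ {F : ℝ → E → ℝ}, Continuous (Function.uncurry F) → ∀ t,
      Integrable (fun x => χ x * F t x) μ := fun hF t =>
    (hχcont.mul (slice hF t)).integrable_of_hasCompactSupport hχc.mul_right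
  have key := integral_cutoff_sub_eq (μ := μ) hχcont hχc hab hρ hρt hd
  have hcP := continuous_integral_cutoff (μ := μ) hχcont hχc hP
  have hcR := continuous_integral_cutoff (μ := μ) hχcont hχc hρt
  have hpt : ∀ t ∈ Set.Icc a b, ∫ x, χ x * ρt t x ∂μ
      ≤ (β + δ * Fintype.card ι * B) - ∫ x, χ x * P t x ∂μ := by
    intro t ht
    have hQP : Integrable (fun x => χ x * Q t x - χ x * P t x) μ := (hInt hQ t).sub (hInt hP t)
    have h1 : ∫ x, χ x * ρt t x ∂μ ≤ ∫ x, (χ x * Q t x - χ x * P t x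
        - ∑ i, χ x * dJ i t x) ∂μ := by
      refine integral_mono (hInt hρt t) (hQP.sub
        (integrable_finsetSum _ fun i _ => hInt (hdJc i) t)) fun x => ?_
      have := mul_le_mul_of_nonneg_left (heq t ht x) (hχ0 x)
      simp only [mul_add, Finset.mul_sum] at this
      simp only
      linarith
    rw [integral_sub hQP
      (integrable_finsetSum _ fun i _ => hInt (hdJc i) t),
      integral_sub (hInt hQ t) (hInt hP t),
      integral_finsetSum _ fun i _ => hInt (hdJc i) t] at h1
    have h2 : ∫ x, χ x * Q t x ∂μ ≤ β := by
      refine le_trans ?_ (hQi t ht).2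
      refine integral_mono (hInt hQ t) (hQi t ht).1 fun x => ?_
      exact mul_le_of_le_one_left (hQ0 t ht x) (hχ1 x)
    have h3 : ∀ i, -(δ * B) ≤ ∫ x, χ x * dJ i t x ∂μ := by
      intro i
      have hdχ : Continuous fun x => fderiv ℝ χ x (e i) :=
        (hχ.continuous_fderiv one_ne_zero).clm_apply continuous_const
      have hdχc : HasCompactSupport fun x => fderiv ℝ χ x (e i) :=
        hχc.fderiv_apply (𝕜 := ℝ) (e i)
      have hi2 : Integrable (fun x => fderiv ℝ χ x (e i) * J i t x) μ :=
        (hdχ.mul (slice (hJc i) t)).integrable_of_hasCompactSupport hdχc.mul_right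
      have := integral_bilinear_hasLineDerivAt_right_eq_neg_left_of_integrable (μ := μ)
        (f := χ) (f' := fun x => fderiv ℝ χ x (e i)) (g := J i t) (g' := dJ i t) (v := e i)
        (B := ContinuousLinearMap.mul ℝ ℝ) hi2 (hInt (hdJc i) t) (hInt (hJc i) t)
        (fun x _ => ((hχ.differentiable one_ne_zero) x).hasFDerivAt.hasLineDerivAt _)
        (fun x _ => hJ i t ht x)
      simp only [ContinuousLinearMap.mul_apply'] at this
      rw [this, neg_le_neg_iff]
      calc ∫ x, fderiv ℝ χ x (e i) * J i t x ∂μ ≤ ∫ x, δ * |J i t x| ∂μ := by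
            refine integral_mono hi2 ((hJi i t ht).1.abs.const_mul δ) fun x => ?_
            refine (le_abs_self _).trans ?_
            rw [abs_mul]
            exact mul_le_mul_of_nonneg_right (hδ i x) (abs_nonneg _)
        _ = δ * ∫ x, |J i t x| ∂μ := integral_const_mul _ _
        _ ≤ δ * B := mul_le_mul_of_nonneg_left (hJi i t ht).2
            ((abs_nonneg _).trans (hδ i 0))
    have h4 : -(δ * Fintype.card ι * B) ≤ ∑ i, ∫ x, χ x * dJ i t x ∂μ := by
      have := Finset.sum_le_sum fun i (_ : i ∈ Finset.univ) => h3 i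
      simp only [Finset.sum_const, Finset.card_univ, nsmul_eq_mul] at this
      linarith
    linarith
  have := intervalIntegral.integral_mono_on (μ := volume) hab (hcR.intervalIntegrable _ _)
    ((continuous_const.sub hcP).intervalIntegrable _ _) hpt
  simp only [Pi.sub_apply] at this
  rw [intervalIntegral.integral_sub (continuous_const.intervalIntegrable _ _) (hcP.intervalIntegrable _ _),
    intervalIntegral.integral_const, smul_eq_mul, ← key] at this
  linarith

omit [MeasurableSpace E] [BorelSpace E] in
/-- Smooth cutoffs whose derivatives in finitely many directions tend to zero. -/
theorem exists_cutoff {ι : Type*} [Fintype ι] (e : ι → E) :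
    ∃ (χ : ℕ → E → ℝ) (C : ℝ), (∀ n, ContDiff ℝ 1 (χ n)) ∧ (∀ n, HasCompactSupport (χ n)) ∧
      (∀ n x, 0 ≤ χ n x) ∧ (∀ n x, χ n x ≤ 1) ∧
      (∀ n i x, |fderiv ℝ (χ n) x (e i)| ≤ C / (n + 1)) ∧
      ∀ x, Filter.Tendsto (fun n => χ n x) Filter.atTop (nhds 1) := by
  let f : ContDiffBump (0 : E) := ⟨1, 2, by norm_num, by norm_num⟩
  have hf : ContDiff ℝ 1 (f : E → ℝ) := f.contDiff
  have hb : ∀ i, ∃ C, ∀ x, ‖fderiv ℝ f x (e i)‖ ≤ C := fun i =>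
    (f.hasCompactSupport.fderiv_apply (𝕜 := ℝ) (e i)).exists_bound_of_continuous
      ((hf.continuous_fderiv one_ne_zero).clm_apply continuous_const)
  choose C hC using hb
  have hC0 : ∀ i, 0 ≤ C i := fun i => (norm_nonneg _).trans (hC i 0)
  have hpos : ∀ n : ℕ, (0 : ℝ) < (n + 1 : ℝ)⁻¹ := fun n => by positivity
  refine ⟨fun n x => f ((n + 1 : ℝ)⁻¹ • x), ∑ i, C i, fun n => ?_, fun n => ?_, fun n x => f.nonneg,
    fun n x => f.le_one, fun n i x => ?_, fun x => ?_⟩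
  · exact hf.comp (contDiff_const_smul _)
  · exact f.hasCompactSupport.comp_smul (hpos n).ne'
  · have h1 : HasFDerivAt (fun x => f ((n + 1 : ℝ)⁻¹ • x))
        ((fderiv ℝ f ((n + 1 : ℝ)⁻¹ • x)).comp ((n + 1 : ℝ)⁻¹ • ContinuousLinearMap.id ℝ E)) x :=
      ((hf.differentiable one_ne_zero) _).hasFDerivAt.comp x
        ((hasFDerivAt_id x).const_smul ((n + 1 : ℝ)⁻¹))
    rw [h1.fderiv]
    simp only [ContinuousLinearMap.comp_apply, smul_apply,
      ContinuousLinearMap.id_apply, map_smul, smul_eq_mul, abs_mul, abs_of_pos (hpos n)]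
    rw [div_eq_inv_mul]
    refine mul_le_mul_of_nonneg_left ?_ (hpos n).le
    exact (hC i _).trans (Finset.single_le_sum (fun i _ => hC0 i) (Finset.mem_univ i))
  · refine tendsto_const_nhds.congr' ?_
    filter_upwards [Filter.eventually_ge_atTop ⌈‖x‖⌉₊] with n hn
    refine (f.one_of_mem_closedBall ?_).symm
    rw [mem_closedBall_zero_iff, norm_smul, Real.norm_of_nonneg (hpos n).le]
    have h1 : ‖x‖ ≤ n := (Nat.le_ceil _).trans (by exact_mod_cast hn)
    change _ ≤ (1 : ℝ)
    rw [inv_mul_le_iff₀ (by positivity)]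
    linarith

/-- A balance law `∂ₜ ρ + div J + P ≤ Q` with currents bounded in `L¹`, integrated over space. -/
theorem flux_balance {ι : Type*} [Fintype ι] (e : ι → E)
    {ρ ρt P Q : ℝ → E → ℝ} {J dJ : ι → ℝ → E → ℝ} {a b β B : ℝ} (hab : a ≤ b)
    (hρ : Continuous (Function.uncurry ρ)) (hρt : Continuous (Function.uncurry ρt))
    (hP : Continuous (Function.uncurry P)) (hQ : Continuous (Function.uncurry Q))
    (hJc : ∀ i, Continuous (Function.uncurry (J i)))
    (hdJc : ∀ i, Continuous (Function.uncurry (dJ i)))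
    (hd : ∀ t ∈ Set.Icc a b, ∀ x, HasDerivAt (fun s => ρ s x) (ρt t x) t)
    (hJ : ∀ i, ∀ t ∈ Set.Icc a b, ∀ x, HasLineDerivAt ℝ (J i t) (dJ i t x) x (e i))
    (heq : ∀ t ∈ Set.Icc a b, ∀ x, ρt t x + ∑ i, dJ i t x + P t x ≤ Q t x)
    (hP0 : ∀ t ∈ Set.Icc a b, ∀ x, 0 ≤ P t x)
    (hQ0 : ∀ t ∈ Set.Icc a b, ∀ x, 0 ≤ Q t x)
    (hQi : ∀ t ∈ Set.Icc a b, Integrable (Q t) μ ∧ ∫ x, Q t x ∂μ ≤ β)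
    (hJi : ∀ i, ∀ t ∈ Set.Icc a b, Integrable (J i t) μ ∧ ∫ x, |J i t x| ∂μ ≤ B)
    (hρa : Integrable (ρ a) μ) (hρb : Integrable (ρ b) μ) :
    ∫ x, ρ b x ∂μ ≤ (∫ x, ρ a x ∂μ) + β * (b - a) ∧
    ∫⁻ t in Set.Ioc a b, ∫⁻ x, ENNReal.ofReal (P t x) ∂μ
      ≤ ENNReal.ofReal ((∫ x, ρ a x ∂μ) - (∫ x, ρ b x ∂μ) + β * (b - a)) := by
  obtain ⟨χ, C, hχ, hχc, hχ0, hχ1, hχd, hχt⟩ := exists_cutoff e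
  have main := fun n => flux_cutoff (μ := μ) (hχ n) (hχc n) (hχ0 n) (hχ1 n) (hχd n) hab hρ hρt hP
    hQ hJc hdJc hd hJ heq hQ0 hQi hJi
  have hlim : ∀ t, Integrable (ρ t) μ →
      Filter.Tendsto (fun n => ∫ x, χ n x * ρ t x ∂μ) Filter.atTop (nhds (∫ x, ρ t x ∂μ)) := by
    intro t ht
    refine tendsto_integral_of_dominated_convergence (fun x => ‖ρ t x‖) (fun n => ?_) ht.norm
      (fun n => ?_) (Filter.Eventually.of_forall fun x => ?_)
    · exact (hχ n).continuous.aestronglyMeasurable.mul ht.1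
    · refine Filter.Eventually.of_forall fun x => ?_
      rw [norm_mul, Real.norm_of_nonneg (hχ0 n x)]
      exact mul_le_of_le_one_left (norm_nonneg _) (hχ1 n x)
    · simpa using (hχt x).mul_const (ρ t x)
  have hX : Filter.Tendsto (fun n : ℕ => (∫ x, χ n x * ρ a x ∂μ) - (∫ x, χ n x * ρ b x ∂μ)
      + (β + C / (n + 1) * Fintype.card ι * B) * (b - a)) Filter.atTop
      (nhds ((∫ x, ρ a x ∂μ) - (∫ x, ρ b x ∂μ) + β * (b - a))) := by
    have h0 : Filter.Tendsto (fun n : ℕ => C / ((n : ℝ) + 1)) Filter.atTop (nhds 0) := by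
      have := (tendsto_one_div_add_atTop_nhds_zero_nat (𝕜 := ℝ)).const_mul C
      simpa [div_eq_mul_inv] using this
    have := ((h0.mul_const (Fintype.card ι * B)).const_add β).mul_const (b - a)
    simp only [zero_mul, add_zero] at this
    refine ((hlim a hρa).sub (hlim b hρb)).add ?_
    simpa [mul_assoc] using this
  have hp0 : ∀ n, ∀ t ∈ Set.Icc a b, 0 ≤ ∫ x, χ n x * P t x ∂μ := fun n t ht =>
    integral_nonneg fun x => mul_nonneg (hχ0 n x) (hP0 t ht x)
  have hp1 : ∀ n, 0 ≤ ∫ t in a..b, ∫ x, χ n x * P t x ∂μ := fun n =>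
    intervalIntegral.integral_nonneg hab (hp0 n)
  refine ⟨?_, ?_⟩
  · have := ge_of_tendsto' hX fun n => (show (0 : ℝ) ≤ _ by linarith [main n, hp1 n])
    linarith
  · have hslice : ∀ n t, Integrable (fun x => χ n x * P t x) μ := fun n t =>
      ((hχ n).continuous.mul (hP.comp (by fun_prop : Continuous fun x => (t, x)))
        ).integrable_of_hasCompactSupport (hχc n).mul_right
    have hmeas : ∀ n, Continuous fun p : ℝ × E => χ n p.2 * P p.1 p.2 := fun n =>
      ((hχ n).continuous.comp continuous_snd).mul hP
    have hone : ∀ n, ∫⁻ t in Set.Ioc a b, ∫⁻ x, ENNReal.ofReal (χ n x * P t x) ∂μ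
        ≤ ENNReal.ofReal ((∫ x, χ n x * ρ a x ∂μ) - (∫ x, χ n x * ρ b x ∂μ)
      + (β + C / (n + 1) * Fintype.card ι * B) * (b - a)) := by
      intro n
      have hc := continuous_integral_cutoff (μ := μ) (hχ n).continuous (hχc n) hP
      calc ∫⁻ t in Set.Ioc a b, ∫⁻ x, ENNReal.ofReal (χ n x * P t x) ∂μ
          = ∫⁻ t in Set.Ioc a b, ENNReal.ofReal (∫ x, χ n x * P t x ∂μ) := by
            refine setLIntegral_congr_fun measurableSet_Ioc fun t ht => ?_
            rw [ofReal_integral_eq_lintegral_ofReal (hslice n t)]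
            exact Filter.Eventually.of_forall fun x =>
              mul_nonneg (hχ0 n x) (hP0 t (Set.Ioc_subset_Icc_self ht) x)
        _ = ENNReal.ofReal (∫ t in Set.Ioc a b, ∫ x, χ n x * P t x ∂μ) := by
            rw [ofReal_integral_eq_lintegral_ofReal]
            · exact (hc.intervalIntegrable a b).1
            · refine (ae_restrict_mem measurableSet_Ioc).mono fun t ht => ?_
              exact hp0 n t (Set.Ioc_subset_Icc_self ht)
        _ ≤ _ := by
            rw [← intervalIntegral.integral_of_le hab]
            exact ENNReal.ofReal_le_ofReal (by linarith [main n])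
    have hprod : ∀ {F : ℝ × E → ℝ}, Continuous F →
        ∫⁻ t in Set.Ioc a b, ∫⁻ x, ENNReal.ofReal (F (t, x)) ∂μ
          = ∫⁻ p, ENNReal.ofReal (F p) ∂((volume.restrict (Set.Ioc a b)).prod μ) := by
      intro F hF
      rw [lintegral_prod]
      exact (ENNReal.continuous_ofReal.comp hF).measurable.aemeasurable
    rw [hprod (F := fun p => P p.1 p.2) hP]
    have hfat := lintegral_liminf_le (μ := (volume.restrict (Set.Ioc a b)).prod μ)
      (u := Filter.atTop) (f := fun n p => ENNReal.ofReal (χ n p.2 * P p.1 p.2))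
      fun n => (ENNReal.continuous_ofReal.comp (hmeas n)).measurable
    have hl : ∀ p : ℝ × E, Filter.liminf (fun n => ENNReal.ofReal (χ n p.2 * P p.1 p.2))
        Filter.atTop = ENNReal.ofReal (P p.1 p.2) := fun p => by
      have : Filter.Tendsto (fun n => χ n p.2 * P p.1 p.2) Filter.atTop (nhds (P p.1 p.2)) := by
        simpa using (hχt p.2).mul_const (P p.1 p.2)
      exact (ENNReal.tendsto_ofReal this).liminf_eq
    simp_rw [hl] at hfat
    refine hfat.trans ?_
    rw [← (ENNReal.tendsto_ofReal hX).liminf_eq]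
    refine Filter.liminf_le_liminf (Filter.Eventually.of_forall fun n => ?_)
    rw [← hprod (hmeas n)]
    exact hone n

end Flux

/-- The Euclidean plane. -/
abbrev Plane := EuclideanSpace ℝ (Fin 2)

section Calculus

variable {X : Type*} [NormedAddCommGroup X] [NormedSpace ℝ X]

/-- The derivative of `F` in the direction `v`. -/
def dir (v : X) (F : X → ℝ) (p : X) : ℝ := fderiv ℝ F p v

@[fun_prop]
theorem contDiff_dir {v : X} {F : X → ℝ} (hF : ContDiff ℝ ∞ F) : ContDiff ℝ ∞ (dir v F) :=
  (hF.fderiv_right (m := ∞) le_rfl).clm_apply contDiff_const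

@[fun_prop]
theorem ContDiff.differentiable_of_infty {F : X → ℝ} (hF : ContDiff ℝ ∞ F) :
    Differentiable ℝ F :=
  hF.differentiable (by simp)

theorem dir_add {v p : X} {F G : X → ℝ} (hF : ContDiff ℝ ∞ F) (hG : ContDiff ℝ ∞ G) :
    dir v (fun q => F q + G q) p = dir v F p + dir v G p := by
  simp [dir, fderiv_fun_add (hF.differentiable_of_infty p) (hG.differentiable_of_infty p)]

theorem dir_sub {v p : X} {F G : X → ℝ} (hF : ContDiff ℝ ∞ F) (hG : ContDiff ℝ ∞ G) :
    dir v (fun q => F q - G q) p = dir v F p - dir v G p := by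
  simp [dir, fderiv_fun_sub (hF.differentiable_of_infty p) (hG.differentiable_of_infty p)]

theorem dir_neg {v p : X} {F : X → ℝ} : dir v (fun q => -F q) p = -dir v F p := by
  simp [dir, fderiv_fun_neg]

theorem dir_mul {v p : X} {F G : X → ℝ} (hF : ContDiff ℝ ∞ F) (hG : ContDiff ℝ ∞ G) :
    dir v (fun q => F q * G q) p = dir v F p * G p + F p * dir v G p := by
  simp [dir, fderiv_fun_mul (hF.differentiable_of_infty p) (hG.differentiable_of_infty p)]
  ring

theorem dir_const {v p : X} {c : ℝ} : dir v (fun _ => c) p = 0 := by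
  simp [dir]

theorem dir_comm {v w p : X} {F : X → ℝ} (hF : ContDiff ℝ ∞ F) :
    dir v (dir w F) p = dir w (dir v F) p := by
  have h1 : ∀ a b : X, dir a (dir b F) p = fderiv ℝ (fderiv ℝ F) p a b := by
    intro a b
    have hd : DifferentiableAt ℝ (fderiv ℝ F) p :=
      (hF.fderiv_right (m := ∞) le_rfl).differentiable (by simp) p
    have := (hd.hasFDerivAt.clm_apply (hasFDerivAt_const b p)).fderiv
    change fderiv ℝ (fun y => fderiv ℝ F y b) p a = _
    rw [this]
    simp
  rw [h1, h1]
  have := (hF.contDiffAt (x := p)).isSymmSndFDerivAt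
    (by rw [minSmoothness_of_isRCLikeNormedField]; exact WithTop.coe_le_coe.2 (le_top : (2 : ℕ∞) ≤ ⊤))
  exact this v w

end Calculus

/-- The time derivative of a function on space-time. -/
def dt (F : ℝ × Plane → ℝ) : ℝ × Plane → ℝ := dir ((1 : ℝ), (0 : Plane)) F

/-- The spatial partial derivatives of a function on space-time. -/
def dx (j : Fin 2) (F : ℝ × Plane → ℝ) : ℝ × Plane → ℝ :=
  dir ((0 : ℝ), (EuclideanSpace.single j 1 : Plane)) F

/-- The spatial Laplacian of a function on space-time. -/
def lapX (F : ℝ × Plane → ℝ) (p : ℝ × Plane) : ℝ := dx 0 (dx 0 F) p + dx 1 (dx 1 F) p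

variable {F G : ℝ × Plane → ℝ} {p : ℝ × Plane}

@[fun_prop]
theorem contDiff_dt (hF : ContDiff ℝ ∞ F) : ContDiff ℝ ∞ (dt F) := contDiff_dir hF

@[fun_prop]
theorem contDiff_dx {j : Fin 2} (hF : ContDiff ℝ ∞ F) : ContDiff ℝ ∞ (dx j F) := contDiff_dir hF

@[fun_prop]
theorem contDiff_lapX (hF : ContDiff ℝ ∞ F) : ContDiff ℝ ∞ (lapX F) :=
  (contDiff_dx (contDiff_dx hF)).add (contDiff_dx (contDiff_dx hF))

theorem dt_add (hF : ContDiff ℝ ∞ F) (hG : ContDiff ℝ ∞ G) :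
    dt (fun q => F q + G q) p = dt F p + dt G p := dir_add hF hG

theorem dt_sub (hF : ContDiff ℝ ∞ F) (hG : ContDiff ℝ ∞ G) :
    dt (fun q => F q - G q) p = dt F p - dt G p := dir_sub hF hG

theorem dt_mul (hF : ContDiff ℝ ∞ F) (hG : ContDiff ℝ ∞ G) :
    dt (fun q => F q * G q) p = dt F p * G p + F p * dt G p := dir_mul hF hG

theorem dt_const {c : ℝ} : dt (fun _ => c) p = 0 := dir_const

theorem dx_add {j : Fin 2} (hF : ContDiff ℝ ∞ F) (hG : ContDiff ℝ ∞ G) :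
    dx j (fun q => F q + G q) p = dx j F p + dx j G p := dir_add hF hG

theorem dx_sub {j : Fin 2} (hF : ContDiff ℝ ∞ F) (hG : ContDiff ℝ ∞ G) :
    dx j (fun q => F q - G q) p = dx j F p - dx j G p := dir_sub hF hG

theorem dx_mul {j : Fin 2} (hF : ContDiff ℝ ∞ F) (hG : ContDiff ℝ ∞ G) :
    dx j (fun q => F q * G q) p = dx j F p * G p + F p * dx j G p := dir_mul hF hG

theorem dx_neg {j : Fin 2} : dx j (fun q => -F q) p = -dx j F p := dir_neg

theorem dx_const {j : Fin 2} {c : ℝ} : dx j (fun _ => c) p = 0 := dir_const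

theorem dt_dx {j : Fin 2} (hF : ContDiff ℝ ∞ F) : dt (dx j F) p = dx j (dt F) p := dir_comm hF

theorem dx_comm {j k : Fin 2} (hF : ContDiff ℝ ∞ F) : dx j (dx k F) p = dx k (dx j F) p :=
  dir_comm hF

theorem hasDerivAt_dt (hF : ContDiff ℝ ∞ F) (t : ℝ) (x : Plane) :
    HasDerivAt (fun s => F (s, x)) (dt F (t, x)) t := by
  have h := (hF.differentiable_of_infty (t, x)).hasFDerivAt
  exact h.comp_hasDerivAt t ((hasDerivAt_id t).prodMk (hasDerivAt_const t x))

theorem hasLineDerivAt_dx (hF : ContDiff ℝ ∞ F) (j : Fin 2) (t : ℝ) (x : Plane) :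
    HasLineDerivAt ℝ (fun y => F (t, y)) (dx j F (t, x)) x (EuclideanSpace.single j 1) := by
  have h := (hF.differentiable_of_infty (t, x)).hasFDerivAt
  have h2 : HasFDerivAt (fun y : Plane => (t, y)) (ContinuousLinearMap.inr ℝ ℝ Plane) x :=
    hasFDerivAt_prodMk_right t x
  exact (h.comp x h2).hasLineDerivAt _

theorem continuous_slice (hF : Continuous F) (t : ℝ) : Continuous fun x => F (t, x) :=
  hF.comp (by fun_prop)

/-- `F` has spatial integral at most `B` at every time in `s`. -/
def BddOn (F : ℝ × Plane → ℝ) (s : Set ℝ) (B : ℝ) : Prop :=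
  ∀ t ∈ s, Integrable (fun x => F (t, x)) ∧ ∫ x, F (t, x) ≤ B

/-- The mass density of `f + i g`. -/
def mdens (f g : ℝ × Plane → ℝ) (p : ℝ × Plane) : ℝ := f p * f p + g p * g p

/-- The density of the squared gradient of `f + i g`. -/
def gdens (f g : ℝ × Plane → ℝ) (p : ℝ × Plane) : ℝ :=
  mdens (dx 0 f) (dx 0 g) p + mdens (dx 1 f) (dx 1 g) p

@[fun_prop]
theorem contDiff_mdens {f g : ℝ × Plane → ℝ} (hf : ContDiff ℝ ∞ f) (hg : ContDiff ℝ ∞ g) :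
    ContDiff ℝ ∞ (mdens f g) := (hf.mul hf).add (hg.mul hg)

@[fun_prop]
theorem contDiff_gdens {f g : ℝ × Plane → ℝ} (hf : ContDiff ℝ ∞ f) (hg : ContDiff ℝ ∞ g) :
    ContDiff ℝ ∞ (gdens f g) :=
  (contDiff_mdens (contDiff_dx hf) (contDiff_dx hg)).add
    (contDiff_mdens (contDiff_dx hf) (contDiff_dx hg))

theorem mdens_nonneg (f g : ℝ × Plane → ℝ) (p : ℝ × Plane) : 0 ≤ mdens f g p :=
  add_nonneg (mul_self_nonneg _) (mul_self_nonneg _)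

theorem gdens_nonneg (f g : ℝ × Plane → ℝ) (p : ℝ × Plane) : 0 ≤ gdens f g p :=
  add_nonneg (mdens_nonneg _ _ _) (mdens_nonneg _ _ _)

theorem mdens_le_gdens (f g : ℝ × Plane → ℝ) (j : Fin 2) (p : ℝ × Plane) :
    mdens (dx j f) (dx j g) p ≤ gdens f g p := by
  have h0 := mdens_nonneg (dx 0 f) (dx 0 g) p
  have h1 := mdens_nonneg (dx 1 f) (dx 1 g) p
  fin_cases j <;> simp only [gdens, Fin.zero_eta, Fin.mk_one] <;> linarith

theorem integrable_of_abs_le {E : Type*} [TopologicalSpace E] [MeasurableSpace E]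
    [OpensMeasurableSpace E] [SecondCountableTopology E] {μ : Measure E} {h k : E → ℝ}
    (hh : Continuous h) (hk : Integrable k μ) (hle : ∀ x, |h x| ≤ k x) {B : ℝ}
    (hB : ∫ x, k x ∂μ ≤ B) : Integrable h μ ∧ ∫ x, |h x| ∂μ ≤ B := by
  have h1 : Integrable h μ := hk.mono' hh.aestronglyMeasurable (Filter.Eventually.of_forall hle)
  exact ⟨h1, (integral_mono h1.abs hk hle).trans hB⟩

/-- Growth of the mass for an inhomogeneous Schrödinger equation. -/
theorem mass_growth {f g : ℝ × Plane → ℝ} (hf : ContDiff ℝ ∞ f) (hg : ContDiff ℝ ∞ g)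
    {Q : ℝ × Plane → ℝ} (hQ : Continuous Q) {a b B β l : ℝ} (hab : a ≤ b) (hl : 0 ≤ l)
    (hm : BddOn (mdens f g) (Set.Icc a b) B) (hG : BddOn (gdens f g) (Set.Icc a b) B)
    (hQ0 : ∀ p, 0 ≤ Q p) (hQi : BddOn Q (Set.Icc a b) β)
    (heq : ∀ t ∈ Set.Icc a b, ∀ x, 2 * f (t, x) * (dt f (t, x) + lapX g (t, x))
      + 2 * g (t, x) * (dt g (t, x) - lapX f (t, x)) ≤ l * mdens f g (t, x) + Q (t, x)) :
    ∫ x, mdens f g (b, x) ≤ Real.exp (l * (b - a)) * ((∫ x, mdens f g (a, x)) + β * (b - a)) := by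
  have hexp : ContDiff ℝ ∞ fun p : ℝ × Plane => Real.exp (-l * (p.1 - a)) := by fun_prop
  have hexpt : ∀ p : ℝ × Plane, dt (fun p : ℝ × Plane => Real.exp (-l * (p.1 - a))) p
      = -l * Real.exp (-l * (p.1 - a)) := by
    rintro ⟨t, x⟩
    refine (hasDerivAt_dt hexp t x).unique ?_
    have := (((hasDerivAt_id t).sub_const a).const_mul (-l)).exp
    simpa [mul_comm] using this
  have hexpx : ∀ j, ∀ p : ℝ × Plane,
      dx j (fun p : ℝ × Plane => Real.exp (-l * (p.1 - a))) p = 0 := by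
    rintro j ⟨t, x⟩
    refine (hasLineDerivAt_dx hexp j t x).unique ?_
    simpa [HasLineDerivAt] using hasDerivAt_const (0 : ℝ) (Real.exp (-l * (t - a)))
  have hexp1 : ∀ t ∈ Set.Icc a b, Real.exp (-l * (t - a)) ≤ 1 := fun t ht =>
    Real.exp_le_one_iff.2 (by nlinarith [ht.1])
  let ρ : ℝ × Plane → ℝ := fun p => Real.exp (-l * (p.1 - a)) * mdens f g p
  let J : Fin 2 → ℝ × Plane → ℝ := fun j p =>
    Real.exp (-l * (p.1 - a)) * (2 * (f p * dx j g p - g p * dx j f p))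
  have hρs : ContDiff ℝ ∞ ρ := hexp.mul (contDiff_mdens hf hg)
  have hJs : ∀ j, ContDiff ℝ ∞ (J j) := fun j => by
    refine hexp.mul (contDiff_const.mul ?_)
    fun_prop
  have hdρ : ∀ p, dt ρ p = Real.exp (-l * (p.1 - a)) *
      (2 * f p * dt f p + 2 * g p * dt g p - l * mdens f g p) := by
    intro p
    have h1 : dt (mdens f g) p = 2 * f p * dt f p + 2 * g p * dt g p := by
      unfold mdens
      rw [dt_add (hf.mul hf) (hg.mul hg), dt_mul hf hf, dt_mul hg hg]
      ring
    simp only [ρ]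
    rw [dt_mul hexp (contDiff_mdens hf hg), hexpt, h1]
    ring
  have hdJ : ∀ j p, dx j (J j) p = Real.exp (-l * (p.1 - a)) *
      (2 * (f p * dx j (dx j g) p - g p * dx j (dx j f) p)) := by
    intro j p
    simp only [J]
    rw [dx_mul hexp (by fun_prop), hexpx, dx_mul contDiff_const (by fun_prop), dx_const,
      dx_sub (by fun_prop) (by fun_prop), dx_mul hf (by fun_prop), dx_mul hg (by fun_prop)]
    ring
  have hpt : ∀ t ∈ Set.Icc a b, Integrable (fun x => mdens f g (t, x) + gdens f g (t, x)) ∧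
      ∫ x, (mdens f g (t, x) + gdens f g (t, x)) ≤ 2 * B := fun t ht => by
    refine ⟨(hm t ht).1.add (hG t ht).1, ?_⟩
    rw [integral_add (hm t ht).1 (hG t ht).1]
    linarith [(hm t ht).2, (hG t ht).2]
  have hflux := (flux_balance (μ := volume) (fun j : Fin 2 => (EuclideanSpace.single j 1 : Plane))
    (ρ := fun t x => ρ (t, x)) (ρt := fun t x => dt ρ (t, x)) (P := fun _ _ => 0)
    (Q := fun t x => Q (t, x)) (J := fun j t x => J j (t, x)) (dJ := fun j t x => dx j (J j) (t, x))
    (β := β) (B := 2 * B) hab hρs.continuous (contDiff_dt hρs).continuous continuous_const hQ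
    (fun j => (hJs j).continuous) (fun j => (contDiff_dx (hJs j)).continuous)
    (fun t _ x => hasDerivAt_dt hρs t x) (fun j t _ x => hasLineDerivAt_dx (hJs j) j t x)
    (fun t ht x => ?_) (fun _ _ _ => le_rfl) (fun t _ x => hQ0 _) hQi (fun j t ht => ?_)
    ((hm a ⟨le_rfl, hab⟩).1.const_mul (Real.exp (-l * (a - a))))
    ((hm b ⟨hab, le_rfl⟩).1.const_mul (Real.exp (-l * (b - a))))).1
  · simp only [ρ, integral_const_mul, sub_self, mul_zero, Real.exp_zero, one_mul] at hflux
    have h1 := mul_le_mul_of_nonneg_left hflux (Real.exp_pos (l * (b - a))).le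
    rwa [← mul_assoc, ← Real.exp_add, neg_mul, add_neg_cancel, Real.exp_zero, one_mul] at h1
  · rw [Fin.sum_univ_two, hdρ, hdJ, hdJ, add_zero]
    have h1 := heq t ht x
    have h2 : Real.exp (-l * (t - a)) * (2 * f (t, x) * (dt f (t, x) + lapX g (t, x))
      + 2 * g (t, x) * (dt g (t, x) - lapX f (t, x)) - l * mdens f g (t, x)) ≤ Q (t, x) :=
      (mul_le_mul_of_nonneg_left (by linarith) (Real.exp_pos _).le).trans
        (mul_le_of_le_one_left (hQ0 (t, x)) (hexp1 t ht))
    refine le_trans (le_of_eq ?_) h2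
    simp only [lapX]
    ring
  · refine integrable_of_abs_le (continuous_slice (hJs j).continuous t) (hpt t ht).1
      (fun x => ?_) (hpt t ht).2
    simp only [J]
    rw [abs_mul, Real.abs_exp]
    refine (mul_le_of_le_one_left (abs_nonneg _) (hexp1 t ht)).trans ?_
    have h1 := mdens_le_gdens f g j (t, x)
    refine le_trans ?_ (add_le_add_right h1 _)
    simp only [mdens]
    rw [abs_le]
    constructor
    · nlinarith [sq_nonneg (f (t, x) + dx j g (t, x)), sq_nonneg (g (t, x) - dx j f (t, x))]
    · nlinarith [sq_nonneg (f (t, x) - dx j g (t, x)), sq_nonneg (g (t, x) + dx j f (t, x))]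

section Fourier

open SchwartzMap LineDeriv

/-- The `j`-th partial derivative of a Schwartz function on the plane. -/
def sdx (j : Fin 2) (φ : 𝓢(Plane, ℂ)) : 𝓢(Plane, ℂ) :=
  LineDeriv.lineDerivOp (EuclideanSpace.single j 1 : Plane) φ

theorem norm_sq_fourier_sdx (j : Fin 2) (φ : 𝓢(Plane, ℂ)) (ξ : Plane) :
    ‖𝓕 (sdx j φ) ξ‖ ^ 2 = (2 * π) ^ 2 * (ξ j ^ 2 * ‖𝓕 φ ξ‖ ^ 2) := by
  have hg : (fun ξ : Plane => inner ℝ ξ (EuclideanSpace.single j 1 : Plane)).HasTemperateGrowth :=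
    ((innerSL ℝ).flip _).hasTemperateGrowth
  rw [sdx, SchwartzMap.fourier_lineDerivOp_eq, smul_apply,
    SchwartzMap.smulLeftCLM_apply_apply hg]
  simp [EuclideanSpace.inner_single_right, mul_pow, abs_of_pos Real.pi_pos]

theorem integrable_norm_sq (φ : 𝓢(Plane, ℂ)) : Integrable fun x => ‖φ x‖ ^ 2 :=
  (φ.memLp 2).integrable_norm_pow (by norm_num)

theorem norm_sq_fourier_grad (φ : 𝓢(Plane, ℂ)) (ξ : Plane) :
    ‖𝓕 (sdx 0 φ) ξ‖ ^ 2 + ‖𝓕 (sdx 1 φ) ξ‖ ^ 2 = (2 * π) ^ 2 * (‖ξ‖ ^ 2 * ‖𝓕 φ ξ‖ ^ 2) := by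
  rw [norm_sq_fourier_sdx, norm_sq_fourier_sdx, EuclideanSpace.norm_sq_eq ξ, Fin.sum_univ_two]
  simp only [Real.norm_eq_abs, sq_abs]
  ring

theorem integral_norm_sq_grad (φ : 𝓢(Plane, ℂ)) :
    ∫ x, (‖sdx 0 φ x‖ ^ 2 + ‖sdx 1 φ x‖ ^ 2) = (2 * π) ^ 2 * ∫ ξ, ‖ξ‖ ^ 2 * ‖𝓕 φ ξ‖ ^ 2 := by
  rw [integral_add (integrable_norm_sq _) (integrable_norm_sq _),
    ← SchwartzMap.integral_norm_sq_fourier (sdx 0 φ),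
    ← SchwartzMap.integral_norm_sq_fourier (sdx 1 φ), ← integral_add (integrable_norm_sq _) (integrable_norm_sq _), ← integral_const_mul]
  exact integral_congr_ae (Filter.Eventually.of_forall fun ξ => norm_sq_fourier_grad φ ξ)

theorem integrable_fourier_grad (φ : 𝓢(Plane, ℂ)) :
    Integrable fun ξ => ‖ξ‖ ^ 2 * ‖𝓕 φ ξ‖ ^ 2 := by
  have h := ((integrable_norm_sq (𝓕 (sdx 0 φ))).add
    (integrable_norm_sq (𝓕 (sdx 1 φ)))).const_mul (((2 * π) ^ 2)⁻¹)
  refine h.congr (Filter.Eventually.of_forall fun ξ => ?_)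
  simp only [Pi.add_apply]
  rw [norm_sq_fourier_grad]
  field_simp

/-- The Laplacian of a Schwartz function on the plane. -/
def slap (φ : 𝓢(Plane, ℂ)) : 𝓢(Plane, ℂ) := sdx 0 (sdx 0 φ) + sdx 1 (sdx 1 φ)

theorem norm_sq_fourier_slap (φ : 𝓢(Plane, ℂ)) (ξ : Plane) :
    ‖𝓕 (slap φ) ξ‖ ^ 2 = (2 * π) ^ 4 * (‖ξ‖ ^ 4 * ‖𝓕 φ ξ‖ ^ 2) := by
  have hg : ∀ j, (fun ξ : Plane =>
      inner ℝ ξ (EuclideanSpace.single j 1 : Plane)).HasTemperateGrowth := fun j =>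
    ((innerSL ℝ).flip _).hasTemperateGrowth
  have hj : ∀ j, 𝓕 (sdx j (sdx j φ)) ξ = -((2 * π) ^ 2 * (ξ j : ℂ) ^ 2) * 𝓕 φ ξ := by
    intro j
    rw [sdx, SchwartzMap.fourier_lineDerivOp_eq, smul_apply,
      SchwartzMap.smulLeftCLM_apply_apply (hg j), sdx, SchwartzMap.fourier_lineDerivOp_eq,
      smul_apply, SchwartzMap.smulLeftCLM_apply_apply (hg j)]
    simp [EuclideanSpace.inner_single_right]
    ring_nf
    simp
  rw [slap, FourierTransform.fourier_add, add_apply, hj, hj]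
  have h1 : -((2 * π) ^ 2 * (ξ 0 : ℂ) ^ 2) * 𝓕 φ ξ + -((2 * π) ^ 2 * (ξ 1 : ℂ) ^ 2) * 𝓕 φ ξ
      = ((-((2 * π) ^ 2 * ‖ξ‖ ^ 2) : ℝ) : ℂ) * 𝓕 φ ξ := by
    rw [EuclideanSpace.norm_sq_eq ξ, Fin.sum_univ_two]
    simp only [Real.norm_eq_abs, sq_abs]
    push_cast
    ring
  rw [h1, norm_mul, Complex.norm_real, mul_pow, Real.norm_eq_abs, sq_abs]
  ring

theorem integral_norm_sq_slap (φ : 𝓢(Plane, ℂ)) :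
    ∫ x, ‖slap φ x‖ ^ 2 = (2 * π) ^ 4 * ∫ ξ, ‖ξ‖ ^ 4 * ‖𝓕 φ ξ‖ ^ 2 := by
  rw [← SchwartzMap.integral_norm_sq_fourier, ← integral_const_mul]
  exact integral_congr_ae (Filter.Eventually.of_forall fun ξ => norm_sq_fourier_slap φ ξ)

theorem integrable_fourier_slap (φ : 𝓢(Plane, ℂ)) :
    Integrable fun ξ => ‖ξ‖ ^ 4 * ‖𝓕 φ ξ‖ ^ 2 := by
  have h := (integrable_norm_sq (𝓕 (slap φ))).const_mul (((2 * π) ^ 4)⁻¹)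
  refine h.congr (Filter.Eventually.of_forall fun ξ => ?_)
  simp only
  rw [norm_sq_fourier_slap]
  field_simp

theorem norm_le_integral_norm_fourier (φ : 𝓢(Plane, ℂ)) (x : Plane) :
    ‖φ x‖ ≤ ∫ ξ, ‖𝓕 φ ξ‖ := by
  have h : φ x = 𝓕⁻ (𝓕 φ) x := by rw [FourierTransform.fourierInv_fourier_eq]
  rw [h, SchwartzMap.fourierInv_coe, Real.fourierInv_eq]
  refine (norm_integral_le_integral_norm _).trans (le_of_eq ?_)
  simp

/-- The weight used in the logarithmic Sobolev embedding. -/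
def bgw (Λ r : ℝ) : ℝ := (1 + r ^ 2) * (1 + r ^ 2 / Λ)

theorem bgw_pos {Λ : ℝ} (hΛ : 0 < Λ) (r : ℝ) : 0 < bgw Λ r := by
  unfold bgw; positivity

theorem hasDerivAt_bg {Λ : ℝ} (hΛ : 2 ≤ Λ) (r : ℝ) :
    HasDerivAt (fun r => Λ / (2 * (Λ - 1)) * (Real.log (1 + r ^ 2) - Real.log (Λ + r ^ 2)))
      (r * (bgw Λ r)⁻¹) r := by
  have h1 : (1 + r ^ 2) ≠ 0 := by positivity
  have h2 : (Λ + r ^ 2) ≠ 0 := by positivity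
  have h3 : Λ - 1 ≠ 0 := by linarith
  have h4 : Λ ≠ 0 := by linarith
  have hd : HasDerivAt (fun r : ℝ => r ^ 2) (2 * r) r := by simpa using hasDerivAt_pow 2 r
  convert! (((hd.const_add 1).log h1).sub ((hd.const_add Λ).log h2)).const_mul
    (Λ / (2 * (Λ - 1))) using 1
  have h5 : (1 + r ^ 2 / Λ) = (Λ + r ^ 2) / Λ := by field_simp
  rw [bgw, h5]
  field_simp
  ring

theorem tendsto_bg {Λ : ℝ} (hΛ : 2 ≤ Λ) :
    Filter.Tendsto (fun r => Λ / (2 * (Λ - 1)) * (Real.log (1 + r ^ 2) - Real.log (Λ + r ^ 2)))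
      Filter.atTop (nhds 0) := by
  have hinf : Filter.Tendsto (fun r : ℝ => Λ + r ^ 2) Filter.atTop Filter.atTop :=
    Filter.tendsto_atTop_add_const_left _ _ (Filter.tendsto_pow_atTop two_ne_zero)
  have h1 : Filter.Tendsto (fun r : ℝ => 1 - (Λ - 1) * (Λ + r ^ 2)⁻¹) Filter.atTop (nhds 1) := by
    simpa using (hinf.inv_tendsto_atTop.const_mul (Λ - 1)).const_sub 1
  have h2 := (h1.log one_ne_zero).const_mul (Λ / (2 * (Λ - 1)))
  simp only [Real.log_one, mul_zero] at h2
  refine h2.congr fun r => ?_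
  have h3 : (1 + r ^ 2) ≠ 0 := by positivity
  have h4 : (Λ + r ^ 2) ≠ 0 := by positivity
  rw [← Real.log_div h3 h4]
  congr 2
  field_simp
  ring

theorem integral_bgw : ∃ c : ℝ, 0 < c ∧ ∀ Λ : ℝ, 2 ≤ Λ →
    Integrable (fun ξ : Plane => (bgw Λ ‖ξ‖)⁻¹) ∧
      ∫ ξ : Plane, (bgw Λ ‖ξ‖)⁻¹ ≤ c * Real.log Λ := by
  refine ⟨2 * (volume : Measure Plane).real (Metric.ball 0 1), ?_, fun Λ hΛ => ?_⟩
  · have : 0 < (volume : Measure Plane).real (Metric.ball 0 1) :=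
      ENNReal.toReal_pos (Metric.measure_ball_pos _ _ one_pos).ne' measure_ball_lt_top.ne
    positivity
  have hpos : ∀ r ∈ Set.Ioi (0 : ℝ), 0 ≤ r * (bgw Λ r)⁻¹ := fun r hr =>
    mul_nonneg (le_of_lt hr) (inv_nonneg.2 (bgw_pos (by linarith) r).le)
  have h1 := integrableOn_Ioi_deriv_of_nonneg' (fun r _ => hasDerivAt_bg hΛ r) hpos (tendsto_bg hΛ)
  have h2 := integral_Ioi_of_hasDerivAt_of_nonneg' (fun r _ => hasDerivAt_bg hΛ r) hpos
    (tendsto_bg hΛ)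
  have hfr : Module.finrank ℝ Plane = 2 := by simp
  constructor
  · rw [integrable_fun_norm_addHaar volume (f := fun r => (bgw Λ r)⁻¹)]
    simpa [hfr] using h1
  · rw [integral_fun_norm_addHaar volume (fun r => (bgw Λ r)⁻¹), hfr]
    simp only [Nat.add_one_sub_one, pow_one, smul_eq_mul, h2, nsmul_eq_mul]
    have h3 : Λ / (2 * (Λ - 1)) ≤ 1 := by
      rw [div_le_one (by linarith)]; linarith
    have h4 : 0 ≤ Real.log Λ := Real.log_nonneg (by linarith)
    have h5 : 0 ≤ (volume : Measure Plane).real (Metric.ball 0 1) := measureReal_nonneg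
    simp only [ne_eq, OfNat.ofNat_ne_zero, not_false_eq_true, zero_pow, add_zero, Real.log_one]
    push_cast
    have h6 : Λ / (2 * (Λ - 1)) * Real.log Λ ≤ Real.log Λ := mul_le_of_le_one_left h4 h3
    nlinarith

/-- A Brezis-Gallouet type inequality. -/
theorem exists_sup_bound : ∃ c : ℝ, 0 < c ∧ ∀ (φ : 𝓢(Plane, ℂ)) (K X : ℝ), 0 ≤ X →
    (∫ x, ‖φ x‖ ^ 2) + ∫ x, (‖sdx 0 φ x‖ ^ 2 + ‖sdx 1 φ x‖ ^ 2) ≤ K →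
    ∫ x, ‖slap φ x‖ ^ 2 ≤ X → ∀ x, ‖φ x‖ ^ 2 ≤ c * (2 * K + 1) * Real.log (2 + X) := by
  obtain ⟨c, hc, hInt⟩ := integral_bgw
  refine ⟨c, hc, fun φ K X hX hK hφX x => ?_⟩
  have hΛ : (2 : ℝ) ≤ 2 + X := by linarith
  set Λ := 2 + X with hΛdef
  obtain ⟨hi, hb⟩ := hInt Λ hΛ
  have hΛ0 : 0 < Λ := by linarith
  have i0 := integrable_norm_sq (𝓕 φ)
  have i1 := integrable_fourier_grad φ
  have i2 := integrable_fourier_slap φ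
  have hπ : 1 ≤ (2 * π) ^ 2 := by nlinarith [Real.pi_gt_three]
  have hπ4 : 1 ≤ (2 * π) ^ 4 := by nlinarith [Real.pi_gt_three]
  have n1 : 0 ≤ ∫ ξ, ‖ξ‖ ^ 2 * ‖𝓕 φ ξ‖ ^ 2 := integral_nonneg fun _ => by positivity
  have n2 : 0 ≤ ∫ ξ, ‖ξ‖ ^ 4 * ‖𝓕 φ ξ‖ ^ 2 := integral_nonneg fun _ => by positivity
  have n0 : 0 ≤ ∫ ξ, ‖𝓕 φ ξ‖ ^ 2 := integral_nonneg fun _ => by positivity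
  rw [← SchwartzMap.integral_norm_sq_fourier, integral_norm_sq_grad] at hK
  rw [integral_norm_sq_slap] at hφX
  have b1 : ∫ ξ, ‖ξ‖ ^ 2 * ‖𝓕 φ ξ‖ ^ 2 ≤ (2 * π) ^ 2 * ∫ ξ, ‖ξ‖ ^ 2 * ‖𝓕 φ ξ‖ ^ 2 :=
    le_mul_of_one_le_left n1 hπ
  have b2 : ∫ ξ, ‖ξ‖ ^ 4 * ‖𝓕 φ ξ‖ ^ 2 ≤ (2 * π) ^ 4 * ∫ ξ, ‖ξ‖ ^ 4 * ‖𝓕 φ ξ‖ ^ 2 :=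
    le_mul_of_one_le_left n2 hπ4
  have hw : ∀ ξ : Plane, bgw Λ ‖ξ‖ * ‖𝓕 φ ξ‖ ^ 2 = ‖𝓕 φ ξ‖ ^ 2 + (1 + Λ⁻¹) *
      (‖ξ‖ ^ 2 * ‖𝓕 φ ξ‖ ^ 2) + Λ⁻¹ * (‖ξ‖ ^ 4 * ‖𝓕 φ ξ‖ ^ 2) := fun ξ => by
    rw [bgw]; ring
  have iw : Integrable fun ξ : Plane => bgw Λ ‖ξ‖ * ‖𝓕 φ ξ‖ ^ 2 := by
    simp_rw [hw]
    exact (i0.add (i1.const_mul _)).add (i2.const_mul _)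
  have hA : ∫ ξ : Plane, bgw Λ ‖ξ‖ * ‖𝓕 φ ξ‖ ^ 2 ≤ 2 * K + 1 := by
    have i01 : Integrable fun ξ : Plane => ‖𝓕 φ ξ‖ ^ 2 + (1 + Λ⁻¹) * (‖ξ‖ ^ 2 * ‖𝓕 φ ξ‖ ^ 2) :=
      i0.add (i1.const_mul _)
    simp_rw [hw]
    rw [integral_add i01 (i2.const_mul _), integral_add i0 (i1.const_mul _), integral_const_mul, integral_const_mul]
    have h1 : Λ⁻¹ ≤ 1 := inv_le_one_of_one_le₀ (by linarith)
    have h0 : 0 < Λ⁻¹ := inv_pos.2 hΛ0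
    have h2 : Λ⁻¹ * ∫ ξ, ‖ξ‖ ^ 4 * ‖𝓕 φ ξ‖ ^ 2 ≤ 1 := by
      rw [inv_mul_le_iff₀ hΛ0]; linarith
    nlinarith
  set S := ∫ ξ, ‖𝓕 φ ξ‖ with hS
  have hφS : ‖φ x‖ ≤ S := norm_le_integral_norm_fourier φ x
  have hS0 : 0 ≤ S := (norm_nonneg _).trans hφS
  have hK0 : 0 < 2 * K + 1 := by linarith
  have hlog : 0 ≤ Real.log Λ := Real.log_nonneg (by linarith)
  suffices h : S ^ 2 ≤ c * (2 * K + 1) * Real.log Λ from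
    (pow_le_pow_left₀ (norm_nonneg _) hφS 2).trans h
  rcases hS0.eq_or_lt with h0 | h0
  · rw [← h0, zero_pow two_ne_zero]; positivity
  have key : ∀ a : ℝ, 0 < a → 2 * S ≤ a * (2 * K + 1) + a⁻¹ * (c * Real.log Λ) := by
    intro a ha
    have hp : ∀ ξ : Plane, 2 * ‖𝓕 φ ξ‖ ≤ a * (bgw Λ ‖ξ‖ * ‖𝓕 φ ξ‖ ^ 2)
        + a⁻¹ * (bgw Λ ‖ξ‖)⁻¹ := fun ξ => by
      have hwp := mul_pos ha (bgw_pos hΛ0 ‖ξ‖)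
      rw [← mul_inv, ← mul_assoc]
      generalize a * bgw Λ ‖ξ‖ = w at hwp
      have : w * ‖𝓕 φ ξ‖ ^ 2 + w⁻¹ - 2 * ‖𝓕 φ ξ‖ = w⁻¹ * (w * ‖𝓕 φ ξ‖ - 1) ^ 2 := by
        field_simp; ring
      have h2 : 0 ≤ w⁻¹ * (w * ‖𝓕 φ ξ‖ - 1) ^ 2 := by positivity
      linarith
    have h1 := integral_mono (((𝓕 φ).integrable.norm).const_mul 2)
      ((iw.const_mul a).add (hi.const_mul a⁻¹)) hp
    simp only [Pi.add_apply] at h1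
    rw [integral_const_mul, integral_add (iw.const_mul a) (hi.const_mul a⁻¹), integral_const_mul,
      integral_const_mul] at h1
    refine h1.trans (add_le_add (mul_le_mul_of_nonneg_left hA ha.le)
      (mul_le_mul_of_nonneg_left hb (inv_pos.2 ha).le))
  have h1 := key (S / (2 * K + 1)) (by positivity)
  rw [div_mul_cancel₀ _ hK0.ne', inv_div] at h1
  have h2 : S ≤ (2 * K + 1) / S * (c * Real.log Λ) := by linarith
  rw [div_mul_eq_mul_div, le_div_iff₀ h0] at h2
  nlinarith

end Fourier

section Slices

open SchwartzMap

/-- At time `t`, `f + i g` is the Schwartz function `φ`. -/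
def Slice (f g : ℝ × Plane → ℝ) (t : ℝ) (φ : 𝓢(Plane, ℂ)) : Prop :=
  ∀ x, φ x = ⟨f (t, x), g (t, x)⟩

variable {f g : ℝ × Plane → ℝ} {t : ℝ} {φ : 𝓢(Plane, ℂ)}

theorem Slice.mdens_eq (h : Slice f g t φ) (x : Plane) : mdens f g (t, x) = ‖φ x‖ ^ 2 := by
  rw [h x, ← Complex.normSq_eq_norm_sq, Complex.normSq_mk, mdens]

theorem Slice.sdx (h : Slice f g t φ) (hf : ContDiff ℝ ∞ f) (hg : ContDiff ℝ ∞ g) (j : Fin 2) :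
    Slice (dx j f) (dx j g) t (sdx j φ) := by
  intro x
  have h0 : HasLineDerivAt ℝ φ (_root_.sdx j φ x) x (EuclideanSpace.single j 1) := by
    rw [_root_.sdx, SchwartzMap.lineDerivOp_apply]
    exact (φ.differentiableAt.lineDifferentiableAt).hasLineDerivAt
  have h1 : HasDerivAt (fun s : ℝ => (φ (x + s • EuclideanSpace.single j 1)).re)
    (_root_.sdx j φ x).re 0 := Complex.reCLM.hasFDerivAt.comp_hasDerivAt _ h0
  have h2 : HasDerivAt (fun s : ℝ => (φ (x + s • EuclideanSpace.single j 1)).im)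
    (_root_.sdx j φ x).im 0 := Complex.imCLM.hasFDerivAt.comp_hasDerivAt _ h0
  simp_rw [h _] at h1 h2
  apply Complex.ext
  · exact h1.unique (hasLineDerivAt_dx hf j t x)
  · exact h2.unique (hasLineDerivAt_dx hg j t x)

theorem Slice.slap (h : Slice f g t φ) (hf : ContDiff ℝ ∞ f) (hg : ContDiff ℝ ∞ g) :
    Slice (lapX f) (lapX g) t (slap φ) := by
  intro x
  rw [_root_.slap, add_apply,
    (h.sdx hf hg 0).sdx (contDiff_dx hf) (contDiff_dx hg) 0 x,
    (h.sdx hf hg 1).sdx (contDiff_dx hf) (contDiff_dx hg) 1 x]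
  rfl

theorem Slice.integrable_mdens (h : Slice f g t φ) : Integrable fun x => mdens f g (t, x) := by
  simp_rw [h.mdens_eq]
  exact integrable_norm_sq φ

end Slices

/-- The density of the squared Laplacian of `f + i g`. -/
abbrev ldens (f g : ℝ × Plane → ℝ) : ℝ × Plane → ℝ := mdens (lapX f) (lapX g)

/-- `f + i g` is a smooth, spatially Schwartz solution of the defocusing cubic NLS
on the time interval `[a, b]`. -/
structure Sol (f g : ℝ × Plane → ℝ) (a b : ℝ) : Prop where
  smooth_re : ContDiff ℝ ∞ f
  smooth_im : ContDiff ℝ ∞ g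
  eq_re : ∀ t ∈ Set.Icc a b, ∀ x, dt f (t, x) = -lapX g (t, x) + mdens f g (t, x) * g (t, x)
  eq_im : ∀ t ∈ Set.Icc a b, ∀ x, dt g (t, x) = lapX f (t, x) - mdens f g (t, x) * f (t, x)
  slice : ∀ t ∈ Set.Icc a b, ∃ φ, Slice f g t φ

section Rescale

/-- Affine change of the time variable. -/
def tcomp (σ c : ℝ) (F : ℝ × Plane → ℝ) (p : ℝ × Plane) : ℝ := F (σ * p.1 + c, p.2)

variable {F G f g : ℝ × Plane → ℝ} {σ c : ℝ}

@[fun_prop]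
theorem contDiff_tcomp (hF : ContDiff ℝ ∞ F) : ContDiff ℝ ∞ (tcomp σ c F) := by
  unfold tcomp; fun_prop

theorem dt_tcomp (hF : ContDiff ℝ ∞ F) : dt (tcomp σ c F) = fun p => σ * tcomp σ c (dt F) p := by
  ext ⟨t, x⟩
  refine (hasDerivAt_dt (contDiff_tcomp hF) t x).unique ?_
  have h1 : HasDerivAt (fun t : ℝ => σ * t + c) σ t := by
    simpa using ((hasDerivAt_id t).const_mul σ).add_const c
  have h2 := (hasDerivAt_dt hF (σ * t + c) x).comp t h1
  rwa [mul_comm] at h2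

theorem dx_tcomp (hF : ContDiff ℝ ∞ F) (j : Fin 2) : dx j (tcomp σ c F) = tcomp σ c (dx j F) := by
  ext ⟨t, x⟩
  exact (hasLineDerivAt_dx (contDiff_tcomp hF) j t x).unique (hasLineDerivAt_dx hF j (σ * t + c) x)

theorem lapX_tcomp (hF : ContDiff ℝ ∞ F) : lapX (tcomp σ c F) = tcomp σ c (lapX F) := by
  ext p
  simp only [lapX, dx_tcomp hF, dx_tcomp (contDiff_dx hF), tcomp]

theorem mdens_neg_right (f g : ℝ × Plane → ℝ) : mdens f (fun p => -g p) = mdens f g := by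
  ext p; simp [mdens]

theorem dx_fun_neg (j : Fin 2) : dx j (fun p => -F p) = fun p => -dx j F p := by
  ext p; exact dx_neg

theorem lapX_fun_neg : lapX (fun p => -F p) = fun p => -lapX F p := by
  ext p; simp only [lapX, dx_fun_neg]; ring

theorem gdens_neg_right (f g : ℝ × Plane → ℝ) : gdens f (fun p => -g p) = gdens f g := by
  ext p; simp only [gdens, dx_fun_neg, mdens_neg_right]

theorem gdens_tcomp (hf : ContDiff ℝ ∞ f) (hg : ContDiff ℝ ∞ g) :
    gdens (tcomp σ c f) (tcomp σ c g) = tcomp σ c (gdens f g) := by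
  ext p; simp only [gdens, dx_tcomp hf, dx_tcomp hg]; rfl

theorem ldens_tcomp (hf : ContDiff ℝ ∞ f) (hg : ContDiff ℝ ∞ g) :
    ldens (tcomp σ c f) (tcomp σ c g) = tcomp σ c (ldens f g) := by
  ext p; simp only [ldens, lapX_tcomp hf, lapX_tcomp hg]; rfl

/-- The time reflection of a real-valued function on space-time. -/
abbrev timeRefl (F : ℝ × Plane → ℝ) : ℝ × Plane → ℝ := tcomp (-1) 0 F

theorem timeRefl_apply (F : ℝ × Plane → ℝ) (t : ℝ) (x : Plane) : timeRefl F (t, x) = F (-t, x) := by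
  simp [tcomp]

theorem mdens_refl (f g : ℝ × Plane → ℝ) (t : ℝ) (x : Plane) :
    mdens (timeRefl f) (fun p => -timeRefl g p) (t, x) = mdens f g (-t, x) := by
  rw [mdens_neg_right, mdens, timeRefl_apply, timeRefl_apply, mdens]

theorem gdens_refl (hf : ContDiff ℝ ∞ f) (hg : ContDiff ℝ ∞ g) (t : ℝ) (x : Plane) :
    gdens (timeRefl f) (fun p => -timeRefl g p) (t, x) = gdens f g (-t, x) := by
  rw [gdens_neg_right, gdens_tcomp hf hg]
  exact timeRefl_apply _ t x

theorem ldens_refl (hf : ContDiff ℝ ∞ f) (hg : ContDiff ℝ ∞ g) (t : ℝ) (x : Plane) :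
    ldens (timeRefl f) (fun p => -timeRefl g p) (t, x) = ldens f g (-t, x) := by
  rw [ldens, lapX_fun_neg, mdens_neg_right, ← ldens, ldens_tcomp hf hg]
  exact timeRefl_apply _ t x

end Rescale

namespace Sol

variable {f g : ℝ × Plane → ℝ} {a b : ℝ}

theorem mono (h : Sol f g a b) {a' b' : ℝ} (ha : a ≤ a') (hb : b' ≤ b) : Sol f g a' b' :=
  ⟨h.smooth_re, h.smooth_im, fun t ht => h.eq_re t ⟨ha.trans ht.1, ht.2.trans hb⟩,
    fun t ht => h.eq_im t ⟨ha.trans ht.1, ht.2.trans hb⟩,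
    fun t ht => h.slice t ⟨ha.trans ht.1, ht.2.trans hb⟩⟩

/-- The NLS is invariant under time reversal combined with complex conjugation. -/
theorem reflect (h : Sol f g a b) : Sol (timeRefl f) (fun p => -timeRefl g p) (-b) (-a) := by
  have hf := h.smooth_re
  have hg := h.smooth_im
  have hgr : ContDiff ℝ ∞ (timeRefl g) := contDiff_tcomp hg
  refine ⟨contDiff_tcomp hf, hgr.neg, fun t ht x => ?_, fun t ht x => ?_, fun t ht => ?_⟩
  · have h1 := h.eq_re (-t) ⟨by linarith [ht.2], by linarith [ht.1]⟩ x
    rw [mdens_refl, dt_tcomp hf, lapX_fun_neg, lapX_tcomp hg]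
    simp only [tcomp, neg_mul, one_mul, add_zero, h1]
    ring
  · have h1 := h.eq_im (-t) ⟨by linarith [ht.2], by linarith [ht.1]⟩ x
    rw [mdens_refl, lapX_tcomp hf]
    have h2 : dt (fun p => -timeRefl g p) (t, x) = -dt (timeRefl g) (t, x) := dir_neg
    rw [h2, dt_tcomp hg]
    simp only [tcomp, neg_mul, one_mul, add_zero, h1]
    ring
  · obtain ⟨φ, hφ⟩ := h.slice (-t) ⟨by linarith [ht.2], by linarith [ht.1]⟩
    refine ⟨φ.postcompCLM (𝕜 := ℝ) Complex.conjCLE.toContinuousLinearMap, fun x => ?_⟩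
    rw [SchwartzMap.postcompCLM_apply, hφ x]
    simp only [timeRefl_apply]
    rfl

theorem integrable_mdens (h : Sol f g a b) {t : ℝ} (ht : t ∈ Set.Icc a b) :
    Integrable fun x => mdens f g (t, x) := by
  obtain ⟨φ, hφ⟩ := h.slice t ht
  exact hφ.integrable_mdens

theorem integrable_dx (h : Sol f g a b) {t : ℝ} (ht : t ∈ Set.Icc a b) (j : Fin 2) :
    Integrable fun x => mdens (dx j f) (dx j g) (t, x) := by
  obtain ⟨φ, hφ⟩ := h.slice t ht
  exact (hφ.sdx h.smooth_re h.smooth_im j).integrable_mdens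

theorem integrable_gdens (h : Sol f g a b) {t : ℝ} (ht : t ∈ Set.Icc a b) :
    Integrable fun x => gdens f g (t, x) :=
  (h.integrable_dx ht 0).add (h.integrable_dx ht 1)

theorem integrable_ldens (h : Sol f g a b) {t : ℝ} (ht : t ∈ Set.Icc a b) :
    Integrable fun x => ldens f g (t, x) := by
  obtain ⟨φ, hφ⟩ := h.slice t ht
  exact (hφ.slap h.smooth_re h.smooth_im).integrable_mdens

end Sol

/-- The spatial integral of `F` at time `t`. -/
def tint (F : ℝ × Plane → ℝ) (t : ℝ) : ℝ := ∫ x, F (t, x)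

theorem tint_nonneg {F : ℝ × Plane → ℝ} (h : ∀ p, 0 ≤ F p) (t : ℝ) : 0 ≤ tint F t :=
  integral_nonneg fun _ => h _

/-- The logarithmic Sobolev embedding for solutions. -/
theorem Sol.exists_sup_bound : ∃ c : ℝ, 0 < c ∧ ∀ (f g : ℝ × Plane → ℝ) (a b t K X : ℝ),
    Sol f g a b → t ∈ Set.Icc a b → 0 ≤ X → tint (mdens f g) t + tint (gdens f g) t ≤ K →
    tint (ldens f g) t ≤ X → ∀ x, mdens f g (t, x) ≤ c * (2 * K + 1) * Real.log (2 + X) := by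
  obtain ⟨c, hc, h⟩ := _root_.exists_sup_bound
  refine ⟨c, hc, fun f g a b t K X hs ht hX hK hX' x => ?_⟩
  obtain ⟨φ, hφ⟩ := hs.slice t ht
  rw [hφ.mdens_eq]
  refine h φ K X hX ?_ ?_ x
  · simpa only [tint, gdens, hφ.mdens_eq, (hφ.sdx hs.smooth_re hs.smooth_im _).mdens_eq] using hK
  · simpa only [tint, ldens, (hφ.slap hs.smooth_re hs.smooth_im).mdens_eq] using hX'

section Fatou

theorem integral_le_of_tendsto {E : Type*} [MeasurableSpace E] {μ : Measure E} {Fn : ℕ → E → ℝ}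
    {F : E → ℝ} {B : ℝ} (hi : ∀ n, Integrable (Fn n) μ) (h0 : ∀ n x, 0 ≤ Fn n x)
    (hlim : ∀ x, Filter.Tendsto (fun n => Fn n x) Filter.atTop (nhds (F x)))
    (hB : ∀ n, ∫ x, Fn n x ∂μ ≤ B) : Integrable F μ ∧ ∫ x, F x ∂μ ≤ B := by
  have hF0 : ∀ x, 0 ≤ F x := fun x => ge_of_tendsto' (hlim x) fun n => h0 n x
  have hFm : AEStronglyMeasurable F μ := aestronglyMeasurable_of_tendsto_ae Filter.atTop
    (fun n => (hi n).1) (Filter.Eventually.of_forall hlim)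
  have hB0 : 0 ≤ B := (integral_nonneg (h0 0)).trans (hB 0)
  have h1 : ∫⁻ x, ENNReal.ofReal (F x) ∂μ ≤ ENNReal.ofReal B := by
    have h2 : ∀ x, ENNReal.ofReal (F x) =
        Filter.liminf (fun n => ENNReal.ofReal (Fn n x)) Filter.atTop := fun x =>
      ((ENNReal.continuous_ofReal.tendsto _).comp (hlim x)).liminf_eq.symm
    simp_rw [h2]
    refine (lintegral_liminf_le' fun n => (hi n).1.aemeasurable.ennreal_ofReal).trans ?_
    refine (Filter.liminf_le_liminf (Filter.Eventually.of_forall fun n => ?_)).trans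
      (le_of_eq (Filter.liminf_const (f := Filter.atTop (α := ℕ)) (ENNReal.ofReal B)))
    rw [← ofReal_integral_eq_lintegral_ofReal (hi n) (Filter.Eventually.of_forall (h0 n))]
    exact ENNReal.ofReal_le_ofReal (hB n)
  have hFi : Integrable F μ :=
    (lintegral_ofReal_ne_top_iff_integrable hFm (Filter.Eventually.of_forall hF0)).1
      (h1.trans_lt ENNReal.ofReal_lt_top).ne
  refine ⟨hFi, ?_⟩
  rw [← ofReal_integral_eq_lintegral_ofReal hFi (Filter.Eventually.of_forall hF0)] at h1
  exact (ENNReal.ofReal_le_ofReal_iff hB0).1 h1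

theorem tint_le_of_frequently {F : ℝ × Plane → ℝ} (hF : Continuous F) (h0 : ∀ p, 0 ≤ F p)
    {t B : ℝ} (h : ∃ᶠ s in nhds t, Integrable (fun x => F (s, x)) ∧ tint F s ≤ B) :
    Integrable (fun x => F (t, x)) ∧ tint F t ≤ B := by
  obtain ⟨s, hs, hP⟩ := Filter.exists_seq_forall_of_frequently h
  refine integral_le_of_tendsto (fun n => (hP n).1) (fun n x => h0 _) (fun x => ?_)
    (fun n => (hP n).2)
  exact ((hF.comp (by fun_prop : Continuous fun s : ℝ => (s, x))).tendsto t).comp hs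

end Fatou

section Differences

variable {f g f' g' F G : ℝ × Plane → ℝ}

theorem mdens_sub_le (f g f' g' : ℝ × Plane → ℝ) (p : ℝ × Plane) :
    mdens (fun q => f q - f' q) (fun q => g q - g' q) p ≤ 2 * mdens f g p + 2 * mdens f' g' p := by
  simp only [mdens]
  nlinarith [sq_nonneg (f p + f' p), sq_nonneg (g p + g' p)]

theorem dx_fun_sub (hF : ContDiff ℝ ∞ F) (hG : ContDiff ℝ ∞ G) (j : Fin 2) :
    dx j (fun q => F q - G q) = fun q => dx j F q - dx j G q := by
  ext p; exact dx_sub hF hG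

theorem lapX_fun_sub (hF : ContDiff ℝ ∞ F) (hG : ContDiff ℝ ∞ G) :
    lapX (fun q => F q - G q) = fun q => lapX F q - lapX G q := by
  ext p
  simp only [lapX, dx_fun_sub hF hG, dx_fun_sub (contDiff_dx hF) (contDiff_dx hG)]
  ring

theorem gdens_sub_le (hf : ContDiff ℝ ∞ f) (hg : ContDiff ℝ ∞ g) (hf' : ContDiff ℝ ∞ f')
    (hg' : ContDiff ℝ ∞ g') (p : ℝ × Plane) :
    gdens (fun q => f q - f' q) (fun q => g q - g' q) p
      ≤ 2 * gdens f g p + 2 * gdens f' g' p := by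
  simp only [gdens, dx_fun_sub hf hf', dx_fun_sub hg hg']
  have h0 := mdens_sub_le (dx 0 f) (dx 0 g) (dx 0 f') (dx 0 g') p
  have h1 := mdens_sub_le (dx 1 f) (dx 1 g) (dx 1 f') (dx 1 g') p
  linarith

theorem BddOn.of_le {s : Set ℝ} {B B' : ℝ} {H : ℝ × Plane → ℝ} (hF : BddOn F s B)
    (hG : BddOn G s B') (hH : Continuous H) (h0 : ∀ p, 0 ≤ H p)
    (hle : ∀ p, H p ≤ 2 * F p + 2 * G p) : BddOn H s (2 * B + 2 * B') := by
  intro t ht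
  have hi : Integrable fun x => 2 * F (t, x) + 2 * G (t, x) :=
    ((hF t ht).1.const_mul 2).add ((hG t ht).1.const_mul 2)
  have hHi : Integrable fun x => H (t, x) :=
    hi.mono' (continuous_slice hH t).aestronglyMeasurable (Filter.Eventually.of_forall fun x => by
      rw [Real.norm_of_nonneg (h0 _)]; exact hle _)
  refine ⟨hHi, (integral_mono hHi hi fun x => hle _).trans ?_⟩
  rw [integral_add ((hF t ht).1.const_mul 2) ((hG t ht).1.const_mul 2), integral_const_mul,
    integral_const_mul]
  linarith [(hF t ht).2, (hG t ht).2]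

theorem cubic_difference_le {a b c d L : ℝ} (h1 : a * a + b * b ≤ L) (h2 : c * c + d * d ≤ L) :
    2 * (a - c) * ((a * a + b * b) * b - (c * c + d * d) * d)
      - 2 * (b - d) * ((a * a + b * b) * a - (c * c + d * d) * c)
      ≤ 4 * L * ((a - c) * (a - c) + (b - d) * (b - d)) := by
  set W := (a - c) * (a - c) + (b - d) * (b - d) with hW
  have hW0 : 0 ≤ W := add_nonneg (mul_self_nonneg _) (mul_self_nonneg _)
  set X := (a - c) * (a + c) + (b - d) * (b + d) with hX
  set Y := (a - c) * d - (b - d) * c with hY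
  have e1 : X ^ 2 ≤ W * (4 * L) := by
    have : X ^ 2 ≤ W * ((a + c) ^ 2 + (b + d) ^ 2) := by
      nlinarith [sq_nonneg ((a - c) * (b + d) - (b - d) * (a + c))]
    refine this.trans (mul_le_mul_of_nonneg_left ?_ hW0)
    nlinarith [sq_nonneg (a - c), sq_nonneg (b - d)]
  have e2 : Y ^ 2 ≤ W * L := by
    have : Y ^ 2 ≤ W * (c * c + d * d) := by
      nlinarith [sq_nonneg ((a - c) * c + (b - d) * d)]
    exact this.trans (mul_le_mul_of_nonneg_left h2 hW0)
  have e3 : 2 * (a - c) * ((a * a + b * b) * b - (c * c + d * d) * d)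
      - 2 * (b - d) * ((a * a + b * b) * a - (c * c + d * d) * c) = 2 * X * Y := by
    rw [hX, hY]; ring
  rw [e3]
  nlinarith [sq_nonneg (X - 2 * Y)]

end Differences

namespace Sol

variable {f g : ℝ × Plane → ℝ} {a b B L K : ℝ}

theorem bddOn_mdens (h : Sol f g a b) (hB : ∀ t ∈ Set.Icc a b, tint (mdens f g) t ≤ B) :
    BddOn (mdens f g) (Set.Icc a b) B := fun t ht => ⟨h.integrable_mdens ht, hB t ht⟩

theorem bddOn_gdens (h : Sol f g a b) (hB : ∀ t ∈ Set.Icc a b, tint (gdens f g) t ≤ B) :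
    BddOn (gdens f g) (Set.Icc a b) B := fun t ht => ⟨h.integrable_gdens ht, hB t ht⟩

theorem integral_cube_le (h : Sol f g a b) {t : ℝ} (ht : t ∈ Set.Icc a b)
    (hL : ∀ x, mdens f g (t, x) ≤ L) (hK : tint (mdens f g) t ≤ K) :
    Integrable (fun x => mdens f g (t, x) ^ 3) ∧ ∫ x, mdens f g (t, x) ^ 3 ≤ L ^ 2 * K := by
  have hi := (h.integrable_mdens ht).const_mul (L ^ 2)
  have hle : ∀ x, mdens f g (t, x) ^ 3 ≤ L ^ 2 * mdens f g (t, x) := fun x => by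
    have h0 := mdens_nonneg f g (t, x)
    have h1 := pow_le_pow_left₀ h0 (hL x) 2
    nlinarith
  have hi3 : Integrable (fun x => mdens f g (t, x) ^ 3) :=
    hi.mono' (((contDiff_mdens h.smooth_re h.smooth_im).continuous.comp
      (by fun_prop : Continuous fun x : Plane => (t, x))).pow 3).aestronglyMeasurable
      (Filter.Eventually.of_forall fun x => by
        rw [Real.norm_of_nonneg (pow_nonneg (mdens_nonneg _ _ _) 3)]; exact hle x)
  refine ⟨hi3, (integral_mono hi3 hi hle).trans ?_⟩
  rw [integral_const_mul]
  exact mul_le_mul_of_nonneg_left hK (sq_nonneg L)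

theorem mass_le (h : Sol f g a b) (hab : a ≤ b) (hm : ∀ t ∈ Set.Icc a b, tint (mdens f g) t ≤ B)
    (hG : ∀ t ∈ Set.Icc a b, tint (gdens f g) t ≤ B) :
    tint (mdens f g) b ≤ tint (mdens f g) a := by
  have h1 := mass_growth h.smooth_re h.smooth_im (Q := fun _ => 0) continuous_const (β := 0) (l := 0)
    hab le_rfl (h.bddOn_mdens hm) (h.bddOn_gdens hG) (fun _ => le_rfl)
    (fun t _ => ⟨integrable_zero _ _ _, by simp⟩) (fun t ht x => by
      rw [h.eq_re t ht, h.eq_im t ht]; apply le_of_eq; ring)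
  simpa [tint] using h1

theorem tint_mdens_reflect (f g : ℝ × Plane → ℝ) (t : ℝ) :
    tint (mdens (timeRefl f) (fun p => -timeRefl g p)) t = tint (mdens f g) (-t) := by
  simp only [tint, mdens_refl]

theorem tint_gdens_reflect (h : Sol f g a b) (t : ℝ) :
    tint (gdens (timeRefl f) (fun p => -timeRefl g p)) t = tint (gdens f g) (-t) := by
  simp only [tint, gdens_refl h.smooth_re h.smooth_im]

theorem tint_ldens_reflect (h : Sol f g a b) (t : ℝ) :
    tint (ldens (timeRefl f) (fun p => -timeRefl g p)) t = tint (ldens f g) (-t) := by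
  simp only [tint, ldens_refl h.smooth_re h.smooth_im]

/-- Conservation of mass. -/
theorem mass_eq (h : Sol f g a b) (hab : a ≤ b)
    (hm : ∀ t ∈ Set.Icc a b, tint (mdens f g) t ≤ B)
    (hG : ∀ t ∈ Set.Icc a b, tint (gdens f g) t ≤ B) :
    tint (mdens f g) b = tint (mdens f g) a := by
  refine le_antisymm (h.mass_le hab hm hG) ?_
  have h1 := h.reflect.mass_le (neg_le_neg hab) (B := B)
    (fun t ht => by
      rw [tint_mdens_reflect]; exact hm _ ⟨by linarith [ht.2], by linarith [ht.1]⟩)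
    (fun t ht => by
      rw [h.tint_gdens_reflect]; exact hG _ ⟨by linarith [ht.2], by linarith [ht.1]⟩)
  rwa [tint_mdens_reflect, tint_mdens_reflect, neg_neg, neg_neg] at h1

/-- Short-time variation of a solution in mass. -/
theorem increment_le {c h : ℝ} (hs : Sol f g c (c + h)) (hh : 0 < h)
    (hm : ∀ t ∈ Set.Icc c (c + h), tint (mdens f g) t ≤ K)
    (hG : ∀ t ∈ Set.Icc c (c + h), tint (gdens f g) t ≤ K)
    (hL : ∀ t ∈ Set.Icc c (c + h), ∀ x, mdens f g (t, x) ≤ L) :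
    ∫ x, mdens (fun q => tcomp 1 h f q - f q) (fun q => tcomp 1 h g q - g q) (c, x)
      ≤ Real.exp 1 * (h ^ 2 * (2 * (L ^ 2 * K) + 2 * tint (ldens f g) c)) := by
  have hf := hs.smooth_re
  have hg := hs.smooth_im
  have hc : c ∈ Set.Icc c (c + h) := ⟨le_rfl, by linarith⟩
  have hfc : ContDiff ℝ ∞ (tcomp 0 c f) := contDiff_tcomp hf
  have hgc : ContDiff ℝ ∞ (tcomp 0 c g) := contDiff_tcomp hg
  have hldc : ∀ t x, ldens (tcomp 0 c f) (tcomp 0 c g) (t, x) = ldens f g (c, x) := fun t x => by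
    rw [ldens_tcomp hf hg]; simp [tcomp]
  have hmc : ∀ t x, mdens (tcomp 0 c f) (tcomp 0 c g) (t, x) = mdens f g (c, x) := fun t x => by
    simp [tcomp, mdens]
  have hgdc : ∀ t x, gdens (tcomp 0 c f) (tcomp 0 c g) (t, x) = gdens f g (c, x) := fun t x => by
    rw [gdens_tcomp hf hg]; simp [tcomp]
  let Q : ℝ × Plane → ℝ := fun p =>
    h * (2 * mdens f g p ^ 3 + 2 * ldens (tcomp 0 c f) (tcomp 0 c g) p)
  have hQc : Continuous Q := by
    have h1 := (contDiff_mdens hf hg).continuous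
    have h2 := (contDiff_mdens (contDiff_lapX hfc) (contDiff_lapX hgc)).continuous
    exact continuous_const.mul ((continuous_const.mul (h1.pow 3)).add (continuous_const.mul h2))
  have hbm : BddOn (mdens (tcomp 0 c f) (tcomp 0 c g)) (Set.Icc c (c + h)) K := fun t _ => by
    simp only [hmc]; exact ⟨hs.integrable_mdens hc, hm c hc⟩
  have hbg : BddOn (gdens (tcomp 0 c f) (tcomp 0 c g)) (Set.Icc c (c + h)) K := fun t _ => by
    simp only [hgdc]; exact ⟨hs.integrable_gdens hc, hG c hc⟩
  have key := mass_growth (hf.sub hfc) (hg.sub hgc) hQc (a := c) (b := c + h) (l := h⁻¹)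
    (β := h * (2 * (L ^ 2 * K) + 2 * tint (ldens f g) c)) (B := 2 * K + 2 * K)
    (by linarith) (inv_pos.2 hh).le
    ((hs.bddOn_mdens hm).of_le hbm (contDiff_mdens (hf.sub hfc) (hg.sub hgc)).continuous
      (mdens_nonneg _ _) (mdens_sub_le _ _ _ _))
    ((hs.bddOn_gdens hG).of_le hbg (contDiff_gdens (hf.sub hfc) (hg.sub hgc)).continuous
      (gdens_nonneg _ _) (gdens_sub_le hf hg hfc hgc))
    (fun p => by
      have h1 := mdens_nonneg f g p
      have h2 := mdens_nonneg (lapX (tcomp 0 c f)) (lapX (tcomp 0 c g)) p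
      simp only [Q, ldens]; positivity)
    (fun t ht => by
      obtain ⟨i3, b3⟩ := hs.integral_cube_le ht (hL t ht) (hm t ht)
      simp only [Q, hldc]
      refine ⟨((i3.const_mul 2).add ((hs.integrable_ldens hc).const_mul 2)).const_mul h, ?_⟩
      rw [integral_const_mul, integral_add (i3.const_mul 2) ((hs.integrable_ldens hc).const_mul 2),
        integral_const_mul, integral_const_mul]
      refine mul_le_mul_of_nonneg_left ?_ hh.le
      simp only [tint]; linarith)
    (fun t ht x => by
      rw [show dt (fun q => f q - tcomp 0 c f q) (t, x) = dt f (t, x) by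
          rw [dt_sub hf hfc, dt_tcomp hf]; ring,
        show dt (fun q => g q - tcomp 0 c g q) (t, x) = dt g (t, x) by
          rw [dt_sub hg hgc, dt_tcomp hg]; ring,
        lapX_fun_sub hf hfc, lapX_fun_sub hg hgc, hs.eq_re t ht, hs.eq_im t ht]
      simp only [Q, mdens, ldens]
      generalize lapX (tcomp 0 c f) (t, x) = p
      generalize lapX (tcomp 0 c g) (t, x) = q
      generalize hz1 : f (t, x) - tcomp 0 c f (t, x) = z1
      generalize hz2 : g (t, x) - tcomp 0 c g (t, x) = z2
      generalize f (t, x) = a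
      generalize g (t, x) = b
      set r := a * a + b * b with hr
      have y1 : 2 * z1 * (r * b - q) ≤ h⁻¹ * (z1 * z1) + h * (r * b - q) ^ 2 := by
        have : h⁻¹ * (z1 * z1) + h * (r * b - q) ^ 2 - 2 * z1 * (r * b - q)
          = h⁻¹ * (z1 - h * (r * b - q)) ^ 2 := by field_simp; ring
        have : 0 ≤ h⁻¹ * (z1 - h * (r * b - q)) ^ 2 := by positivity
        linarith
      have y2 : 2 * z2 * (p - r * a) ≤ h⁻¹ * (z2 * z2) + h * (p - r * a) ^ 2 := by
        have : h⁻¹ * (z2 * z2) + h * (p - r * a) ^ 2 - 2 * z2 * (p - r * a)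
          = h⁻¹ * (z2 - h * (p - r * a)) ^ 2 := by field_simp; ring
        have : 0 ≤ h⁻¹ * (z2 - h * (p - r * a)) ^ 2 := by positivity
        linarith
      have y3 : h * ((r * b - q) ^ 2 + (p - r * a) ^ 2) ≤ h * (2 * r ^ 3 + 2 * (p * p + q * q)) := by
        refine mul_le_mul_of_nonneg_left ?_ hh.le
        have : r ^ 3 = (r * a) ^ 2 + (r * b) ^ 2 := by rw [hr]; ring
        rw [this]
        nlinarith [sq_nonneg (r * b + q), sq_nonneg (p + r * a)]
      nlinarith)
  rw [add_sub_cancel_left, inv_mul_cancel₀ hh.ne'] at key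
  have e0 : ∀ x, mdens (fun q => f q - tcomp 0 c f q) (fun q => g q - tcomp 0 c g q) (c, x) = 0 :=
    fun x => by simp [mdens, tcomp]
  have e1 : ∀ x, mdens (fun q => f q - tcomp 0 c f q) (fun q => g q - tcomp 0 c g q) (c + h, x)
      = mdens (fun q => tcomp 1 h f q - f q) (fun q => tcomp 1 h g q - g q) (c, x) := fun x => by
    simp [mdens, tcomp]
  simp only [e0, e1, integral_zero, zero_add] at key
  refine key.trans (le_of_eq ?_)
  ring

/-- Propagation of time increments of a solution. -/
theorem increment_growth {c d h : ℝ} (hs : Sol f g c (d + h)) (hcd : c ≤ d) (hh : 0 < h)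
    (hL0 : 0 ≤ L)
    (hm : ∀ t ∈ Set.Icc c (d + h), tint (mdens f g) t ≤ K)
    (hG : ∀ t ∈ Set.Icc c (d + h), tint (gdens f g) t ≤ K)
    (hL : ∀ t ∈ Set.Icc c (d + h), ∀ x, mdens f g (t, x) ≤ L) :
    ∫ x, mdens (fun q => tcomp 1 h f q - f q) (fun q => tcomp 1 h g q - g q) (d, x)
      ≤ Real.exp (4 * L * (d - c)) * ∫ x,
        mdens (fun q => tcomp 1 h f q - f q) (fun q => tcomp 1 h g q - g q) (c, x) := by
  have hf := hs.smooth_re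
  have hg := hs.smooth_im
  have hf' : ContDiff ℝ ∞ (tcomp 1 h f) := contDiff_tcomp hf
  have hg' : ContDiff ℝ ∞ (tcomp 1 h g) := contDiff_tcomp hg
  have m0 : ∀ t ∈ Set.Icc c d, t ∈ Set.Icc c (d + h) := fun t ht => ⟨ht.1, by linarith [ht.2]⟩
  have m1 : ∀ t ∈ Set.Icc c d, 1 * t + h ∈ Set.Icc c (d + h) := fun t ht =>
    ⟨by linarith [ht.1], by linarith [ht.2]⟩
  have hbm : BddOn (mdens (tcomp 1 h f) (tcomp 1 h g)) (Set.Icc c d) K := fun t ht =>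
    ⟨hs.integrable_mdens (m1 t ht), hm _ (m1 t ht)⟩
  have hbg : BddOn (gdens (tcomp 1 h f) (tcomp 1 h g)) (Set.Icc c d) K := fun t ht => by
    rw [gdens_tcomp hf hg]; exact ⟨hs.integrable_gdens (m1 t ht), hG _ (m1 t ht)⟩
  have key := mass_growth (hf'.sub hf) (hg'.sub hg) (Q := fun _ => 0) continuous_const
    (a := c) (b := d) (l := 4 * L) (β := 0) (B := 2 * K + 2 * K) hcd (by linarith)
    (hbm.of_le (fun t ht => hs.bddOn_mdens hm t (m0 t ht))
      (contDiff_mdens (hf'.sub hf) (hg'.sub hg)).continuous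
      (mdens_nonneg _ _) (mdens_sub_le _ _ _ _))
    (hbg.of_le (fun t ht => hs.bddOn_gdens hG t (m0 t ht))
      (contDiff_gdens (hf'.sub hf) (hg'.sub hg)).continuous
      (gdens_nonneg _ _) (gdens_sub_le hf' hg' hf hg))
    (fun _ => le_rfl) (fun t _ => ⟨integrable_zero _ _ _, by simp⟩)
    (fun t ht x => by
      have e1 : dt (fun q => tcomp 1 h f q - f q) (t, x)
          = dt f (1 * t + h, x) - dt f (t, x) := by
        rw [dt_sub hf' hf, dt_tcomp hf]; simp [tcomp]
      have e2 : dt (fun q => tcomp 1 h g q - g q) (t, x)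
          = dt g (1 * t + h, x) - dt g (t, x) := by
        rw [dt_sub hg' hg, dt_tcomp hg]; simp [tcomp]
      rw [e1, e2, lapX_fun_sub hf' hf, lapX_fun_sub hg' hg, lapX_tcomp hf, lapX_tcomp hg,
        hs.eq_re t (m0 t ht), hs.eq_im t (m0 t ht), hs.eq_re _ (m1 t ht), hs.eq_im _ (m1 t ht)]
      have h1 := hL _ (m1 t ht) x
      have h2 := hL t (m0 t ht) x
      have h3 := cubic_difference_le h1 h2
      simp only [mdens, tcomp] at h3 ⊢
      linarith)
  simpa using key

end Sol

/-- The energy density of `f + i g`. -/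
def edens (f g : ℝ × Plane → ℝ) (p : ℝ × Plane) : ℝ := gdens f g p / 2 + mdens f g p ^ 2 / 4

namespace Sol

variable {f g : ℝ × Plane → ℝ} {a b B L K : ℝ}

theorem mdens_dt_le (h : Sol f g a b) {t : ℝ} (ht : t ∈ Set.Icc a b) (x : Plane) :
    mdens (dt f) (dt g) (t, x) ≤ 2 * ldens f g (t, x) + 2 * mdens f g (t, x) ^ 3 := by
  have e : mdens f g (t, x) ^ 3 = (mdens f g (t, x) * g (t, x)) ^ 2
      + (mdens f g (t, x) * f (t, x)) ^ 2 := by rw [mdens]; ring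
  rw [e]
  simp only [ldens]
  rw [mdens, h.eq_re t ht, h.eq_im t ht, mdens.eq_def (lapX f)]
  nlinarith [sq_nonneg (lapX g (t, x) + mdens f g (t, x) * g (t, x)),
    sq_nonneg (lapX f (t, x) + mdens f g (t, x) * f (t, x))]

theorem ldens_le_dt (h : Sol f g a b) {t : ℝ} (ht : t ∈ Set.Icc a b) (x : Plane) :
    ldens f g (t, x) ≤ 2 * mdens (dt f) (dt g) (t, x) + 2 * mdens f g (t, x) ^ 3 := by
  have e : mdens f g (t, x) ^ 3 = (mdens f g (t, x) * g (t, x)) ^ 2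
      + (mdens f g (t, x) * f (t, x)) ^ 2 := by rw [mdens]; ring
  rw [e]
  simp only [ldens]
  rw [mdens.eq_def (dt f), h.eq_re t ht, h.eq_im t ht, mdens.eq_def (lapX f)]
  nlinarith [sq_nonneg (-lapX g (t, x) + 2 * (mdens f g (t, x) * g (t, x))),
    sq_nonneg (lapX f (t, x) - 2 * (mdens f g (t, x) * f (t, x)))]

/-- A solution with bounded `H²` norms is bounded. -/
theorem exists_pointwise_bound (h : Sol f g a b)
    (hm : ∀ t ∈ Set.Icc a b, tint (mdens f g) t ≤ B)
    (hG : ∀ t ∈ Set.Icc a b, tint (gdens f g) t ≤ B)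
    (hl : ∀ t ∈ Set.Icc a b, tint (ldens f g) t ≤ B) :
    ∃ L, 0 ≤ L ∧ ∀ t ∈ Set.Icc a b, ∀ x, mdens f g (t, x) ≤ L := by
  obtain ⟨c, hc, hcb⟩ := Sol.exists_sup_bound
  refine ⟨max 0 (c * (2 * (B + B) + 1) * Real.log (2 + max 0 B)), le_max_left _ _,
    fun t ht x => le_max_of_le_right ?_⟩
  exact hcb f g a b t (B + B) (max 0 B) h ht (le_max_left _ _) (add_le_add (hm t ht) (hG t ht))
    ((hl t ht).trans (le_max_right _ _)) x

theorem integrable_sq (h : Sol f g a b) {t : ℝ} (ht : t ∈ Set.Icc a b)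
    (hL : ∀ x, mdens f g (t, x) ≤ L) :
    Integrable (fun x => mdens f g (t, x) ^ 2) ∧
      ∫ x, mdens f g (t, x) ^ 2 ≤ L * tint (mdens f g) t := by
  have hi := (h.integrable_mdens ht).const_mul L
  have hle : ∀ x, mdens f g (t, x) ^ 2 ≤ L * mdens f g (t, x) := fun x => by
    nlinarith [mdens_nonneg f g (t, x), hL x]
  have hi2 : Integrable (fun x => mdens f g (t, x) ^ 2) :=
    hi.mono' (((contDiff_mdens h.smooth_re h.smooth_im).continuous.comp
      (by fun_prop : Continuous fun x : Plane => (t, x))).pow 2).aestronglyMeasurable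
      (Filter.Eventually.of_forall fun x => by
        rw [Real.norm_of_nonneg (sq_nonneg _)]; exact hle x)
  refine ⟨hi2, (integral_mono hi2 hi hle).trans ?_⟩
  rw [integral_const_mul, tint]

theorem energy_le (h : Sol f g a b) (hab : a ≤ b)
    (hm : ∀ t ∈ Set.Icc a b, tint (mdens f g) t ≤ B)
    (hG : ∀ t ∈ Set.Icc a b, tint (gdens f g) t ≤ B)
    (hl : ∀ t ∈ Set.Icc a b, tint (ldens f g) t ≤ B) :
    tint (edens f g) b ≤ tint (edens f g) a := by
  obtain ⟨L, hL0, hL⟩ := h.exists_pointwise_bound hm hG hl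
  have hf := h.smooth_re
  have hg := h.smooth_im
  have he : ContDiff ℝ ∞ (edens f g) :=
    ((contDiff_gdens hf hg).div_const 2).add (((contDiff_mdens hf hg).pow 2).div_const 4)
  let J : Fin 2 → ℝ × Plane → ℝ := fun j p => -(dt f p * dx j f p + dt g p * dx j g p)
  have hJs : ∀ j, ContDiff ℝ ∞ (J j) := fun j =>
    (((contDiff_dt hf).mul (contDiff_dx hf)).add ((contDiff_dt hg).mul (contDiff_dx hg))).neg
  have hInt : ∀ t ∈ Set.Icc a b, Integrable fun x => edens f g (t, x) := fun t ht =>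
    ((h.integrable_gdens ht).div_const 2).add ((h.integrable_sq ht (hL t ht)).1.div_const 4)
  have hpt : ∀ t ∈ Set.Icc a b,
      Integrable (fun x => ldens f g (t, x) + mdens f g (t, x) ^ 3 + gdens f g (t, x)) ∧
      ∫ x, (ldens f g (t, x) + mdens f g (t, x) ^ 3 + gdens f g (t, x)) ≤ B + L ^ 2 * B + B :=
    fun t ht => by
      obtain ⟨i3, b3⟩ := h.integral_cube_le ht (hL t ht) (hm t ht)
      have il := h.integrable_ldens ht
      have ilc : Integrable fun x => ldens f g (t, x) + mdens f g (t, x) ^ 3 := il.add i3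
      refine ⟨ilc.add (h.integrable_gdens ht), ?_⟩
      rw [integral_add ilc (h.integrable_gdens ht), integral_add il i3]
      exact add_le_add (add_le_add (hl t ht) b3) (hG t ht)
  have hsm : ∀ j, ContDiff ℝ ∞ (fun q => dx j f q * dx j f q + dx j g q * dx j g q) := fun j =>
    ((contDiff_dx hf).mul (contDiff_dx hf)).add ((contDiff_dx hg).mul (contDiff_dx hg))
  have hde : ∀ p, dt (edens f g) p = (dx 0 f p * dx 0 (dt f) p + dx 0 g p * dx 0 (dt g) p
      + (dx 1 f p * dx 1 (dt f) p + dx 1 g p * dx 1 (dt g) p))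
      + mdens f g p * (f p * dt f p + g p * dt g p) := by
    intro p
    have e1 : edens f g = fun p => (1 / 2 : ℝ) * ((dx 0 f p * dx 0 f p + dx 0 g p * dx 0 g p)
        + (dx 1 f p * dx 1 f p + dx 1 g p * dx 1 g p))
        + (1 / 4 : ℝ) * ((f p * f p + g p * g p) * (f p * f p + g p * g p)) := by
      ext q; simp only [edens, gdens, mdens]; ring
    have hmm : ContDiff ℝ ∞ (fun p => f p * f p + g p * g p) := (hf.mul hf).add (hg.mul hg)
    rw [e1, dt_add (contDiff_const.mul ((hsm 0).add (hsm 1)))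
      (contDiff_const.mul (hmm.mul hmm)), dt_mul contDiff_const ((hsm 0).add (hsm 1)),
      dt_mul contDiff_const (hmm.mul hmm), dt_add (hsm 0) (hsm 1), dt_mul hmm hmm,
      dt_add (hf.mul hf) (hg.mul hg), dt_mul hf hf, dt_mul hg hg]
    have hj : ∀ j, dt (fun q => dx j f q * dx j f q + dx j g q * dx j g q) p
        = 2 * (dx j f p * dx j (dt f) p + dx j g p * dx j (dt g) p) := fun j => by
      have h1 : ContDiff ℝ ∞ (dx j f) := contDiff_dx hf
      have h2 : ContDiff ℝ ∞ (dx j g) := contDiff_dx hg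
      rw [dt_add (h1.mul h1) (h2.mul h2), dt_mul h1 h1, dt_mul h2 h2, dt_dx hf, dt_dx hg]
      ring
    rw [hj, hj, dt_const, dt_const]
    simp only [mdens]
    ring
  have hdJ : ∀ j p, dx j (J j) p = -(dx j (dt f) p * dx j f p + dt f p * dx j (dx j f) p
      + (dx j (dt g) p * dx j g p + dt g p * dx j (dx j g) p)) := by
    intro j p
    have h1 : ContDiff ℝ ∞ (dx j f) := contDiff_dx hf
    have h2 : ContDiff ℝ ∞ (dx j g) := contDiff_dx hg
    have h3 := contDiff_dt hf
    have h4 := contDiff_dt hg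
    simp only [J]
    rw [dx_neg, dx_add (h3.mul h1) (h4.mul h2), dx_mul h3 h1, dx_mul h4 h2]
  have hflux := (flux_balance (μ := volume) (fun j : Fin 2 => (EuclideanSpace.single j 1 : Plane))
    (ρ := fun t x => edens f g (t, x)) (ρt := fun t x => dt (edens f g) (t, x))
    (P := fun _ _ => 0) (Q := fun _ _ => 0) (J := fun j t x => J j (t, x))
    (dJ := fun j t x => dx j (J j) (t, x))
    (β := 0) (B := B + L ^ 2 * B + B) hab he.continuous (contDiff_dt he).continuous
    continuous_const continuous_const
    (fun j => (hJs j).continuous) (fun j => (contDiff_dx (hJs j)).continuous)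
    (fun t _ x => hasDerivAt_dt he t x) (fun j t _ x => hasLineDerivAt_dx (hJs j) j t x)
    (fun t ht x => ?_) (fun _ _ _ => le_rfl) (fun _ _ _ => le_rfl)
    (fun t _ => ⟨integrable_zero _ _ _, by simp⟩) (fun j t ht => ?_)
    (hInt a ⟨le_rfl, hab⟩) (hInt b ⟨hab, le_rfl⟩)).1
  · simpa [tint] using hflux
  · rw [Fin.sum_univ_two, hde, hdJ, hdJ, add_zero]
    have h1 := h.eq_re t ht x
    have h2 := h.eq_im t ht x
    simp only [lapX] at h1 h2
    apply le_of_eq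
    linear_combination (-dt g (t, x)) * h1 + dt f (t, x) * h2
  · refine integrable_of_abs_le (continuous_slice (hJs j).continuous t) (hpt t ht).1
      (fun x => ?_) (hpt t ht).2
    have h1 := mdens_le_gdens f g j (t, x)
    have h2 := h.mdens_dt_le ht x
    have h3 := gdens_nonneg f g (t, x)
    simp only [J]
    rw [abs_neg]
    have h4 : |dt f (t, x) * dx j f (t, x) + dt g (t, x) * dx j g (t, x)|
        ≤ (mdens (dt f) (dt g) (t, x) + mdens (dx j f) (dx j g) (t, x)) / 2 := by
      simp only [mdens]
      rw [abs_le]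
      constructor
      · nlinarith [sq_nonneg (dt f (t, x) + dx j f (t, x)), sq_nonneg (dt g (t, x) + dx j g (t, x))]
      · nlinarith [sq_nonneg (dt f (t, x) - dx j f (t, x)), sq_nonneg (dt g (t, x) - dx j g (t, x))]
    linarith

theorem tint_edens_reflect (h : Sol f g a b) (t : ℝ) :
    tint (edens (timeRefl f) (fun p => -timeRefl g p)) t = tint (edens f g) (-t) := by
  simp only [tint, edens, gdens_refl h.smooth_re h.smooth_im, mdens_refl]

/-- Conservation of energy. -/
theorem energy_eq (h : Sol f g a b) (hab : a ≤ b)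
    (hm : ∀ t ∈ Set.Icc a b, tint (mdens f g) t ≤ B)
    (hG : ∀ t ∈ Set.Icc a b, tint (gdens f g) t ≤ B)
    (hl : ∀ t ∈ Set.Icc a b, tint (ldens f g) t ≤ B) :
    tint (edens f g) b = tint (edens f g) a := by
  have hmem : ∀ t ∈ Set.Icc (-b) (-a), -t ∈ Set.Icc a b := fun t ht =>
    ⟨by linarith [ht.2], by linarith [ht.1]⟩
  refine le_antisymm (h.energy_le hab hm hG hl) ?_
  have h1 := h.reflect.energy_le (neg_le_neg hab) (B := B)
    (fun t ht => by rw [tint_mdens_reflect]; exact hm _ (hmem t ht))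
    (fun t ht => by rw [h.tint_gdens_reflect]; exact hG _ (hmem t ht))
    (fun t ht => by rw [h.tint_ldens_reflect]; exact hl _ (hmem t ht))
  rwa [h.tint_edens_reflect, h.tint_edens_reflect, neg_neg, neg_neg] at h1

/-- Mass bound for the time derivative of a solution. -/
theorem time_derivative_le {c d e : ℝ} (hs : Sol f g c e) (hcd : c ≤ d) (hde : d < e)
    (hL0 : 0 ≤ L) (hm : ∀ t ∈ Set.Icc c e, tint (mdens f g) t ≤ K)
    (hG : ∀ t ∈ Set.Icc c e, tint (gdens f g) t ≤ K)
    (hL : ∀ t ∈ Set.Icc c e, ∀ x, mdens f g (t, x) ≤ L) :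
    Integrable (fun x => mdens (dt f) (dt g) (d, x)) ∧
    ∫ x, mdens (dt f) (dt g) (d, x) ≤ Real.exp (4 * L * (d - c)) * (Real.exp 1 *
      (2 * (L ^ 2 * K) + 2 * tint (ldens f g) c)) := by
  let h : ℕ → ℝ := fun n => (e - d) * (1 / ((n : ℝ) + 1))
  have hpos : ∀ n, 0 < h n := fun n => mul_pos (by linarith) Nat.one_div_pos_of_nat
  have hle : ∀ n, d + h n ≤ e := fun n => by
    have : (e - d) * (1 / ((n : ℝ) + 1)) ≤ e - d := by
      refine mul_le_of_le_one_right (by linarith) ?_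
      rw [div_le_one (by positivity)]
      linarith [(Nat.cast_nonneg n : (0 : ℝ) ≤ n)]
    simp only [h]; linarith
  have hlim : Filter.Tendsto h Filter.atTop (nhdsWithin 0 {0}ᶜ) := by
    refine tendsto_nhdsWithin_iff.2 ⟨?_, Filter.Eventually.of_forall fun n => (hpos n).ne'⟩
    simpa [h, div_eq_mul_inv] using (tendsto_one_div_add_atTop_nhds_zero_nat (𝕜 := ℝ)).const_mul (e - d)
  have hq : ∀ F : ℝ × Plane → ℝ, ContDiff ℝ ∞ F → ∀ x, Filter.Tendsto
      (fun n => (h n)⁻¹ * (tcomp 1 (h n) F (d, x) - F (d, x))) Filter.atTop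
      (nhds (dt F (d, x))) := by
    intro F hF x
    have h1 := (hasDerivAt_dt hF d x).tendsto_slope_zero.comp hlim
    refine h1.congr fun n => ?_
    simp [tcomp]
  have hf := hs.smooth_re
  have hg := hs.smooth_im
  refine integral_le_of_tendsto (Fn := fun n x => ((h n) ^ 2)⁻¹ *
    mdens (fun q => tcomp 1 (h n) f q - f q) (fun q => tcomp 1 (h n) g q - g q) (d, x))
    (fun n => ?_) (fun n x => mul_nonneg (by positivity) (mdens_nonneg _ _ _)) (fun x => ?_)
    (fun n => ?_)
  · have hmem : d ∈ Set.Icc c e := ⟨hcd, hde.le⟩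
    have hmem' : 1 * d + h n ∈ Set.Icc c e :=
      ⟨by linarith [hpos n], by rw [one_mul]; exact hle n⟩
    refine Integrable.const_mul ?_ _
    have hi := ((hs.integrable_mdens hmem').const_mul 2).add ((hs.integrable_mdens hmem).const_mul 2)
    refine hi.mono' (continuous_slice (contDiff_mdens ((contDiff_tcomp hf).sub hf)
      ((contDiff_tcomp hg).sub hg)).continuous d).aestronglyMeasurable
      (Filter.Eventually.of_forall fun x => ?_)
    rw [Real.norm_of_nonneg (mdens_nonneg _ _ _)]
    exact mdens_sub_le (tcomp 1 (h n) f) (tcomp 1 (h n) g) f g (d, x)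
  · have h1 := ((hq f hf x).mul (hq f hf x)).add ((hq g hg x).mul (hq g hg x))
    refine h1.congr fun n => ?_
    simp only [mdens]
    rw [← inv_pow]
    ring
  · have hh := hpos n
    have hch : c + h n ≤ e := by linarith [hle n]
    have h1 := (hs.mono le_rfl hch).increment_le hh
      (fun t ht => hm t ⟨ht.1, ht.2.trans hch⟩) (fun t ht => hG t ⟨ht.1, ht.2.trans hch⟩)
      (fun t ht => hL t ⟨ht.1, ht.2.trans hch⟩)
    have h2 := (hs.mono le_rfl (hle n)).increment_growth hcd hh hL0
      (fun t ht => hm t ⟨ht.1, ht.2.trans (hle n)⟩) (fun t ht => hG t ⟨ht.1, ht.2.trans (hle n)⟩)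
      (fun t ht => hL t ⟨ht.1, ht.2.trans (hle n)⟩)
    rw [integral_const_mul, inv_mul_le_iff₀ (by positivity)]
    refine h2.trans ((mul_le_mul_of_nonneg_left h1 (Real.exp_pos _).le).trans (le_of_eq ?_))
    ring

/-- Growth of the `L²` norm of the Laplacian of a bounded solution. -/
theorem laplacian_le {c e : ℝ} (hs : Sol f g c e) (hce : c ≤ e)
    (hL0 : 0 ≤ L) (hm : ∀ t ∈ Set.Icc c e, tint (mdens f g) t ≤ K)
    (hG : ∀ t ∈ Set.Icc c e, tint (gdens f g) t ≤ K)
    (hL : ∀ t ∈ Set.Icc c e, ∀ x, mdens f g (t, x) ≤ L) {d : ℝ} (hd : d ∈ Set.Icc c e) :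
    tint (ldens f g) d ≤ 2 * (Real.exp (4 * L * (e - c)) * (Real.exp 1 *
      (2 * (L ^ 2 * K) + 2 * tint (ldens f g) c))) + 2 * (L ^ 2 * K) := by
  have hD0 : 0 ≤ tint (ldens f g) c := tint_nonneg (mdens_nonneg _ _) c
  have hK0 : 0 ≤ K := (tint_nonneg (mdens_nonneg _ _) c).trans (hm c ⟨le_rfl, hce⟩)
  have hlt : ∀ d ∈ Set.Ico c e, tint (ldens f g) d ≤ 2 * (Real.exp (4 * L * (e - c)) *
      (Real.exp 1 * (2 * (L ^ 2 * K) + 2 * tint (ldens f g) c))) + 2 * (L ^ 2 * K) := by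
    intro d hd
    obtain ⟨hi, hb⟩ := hs.time_derivative_le hd.1 hd.2 hL0 hm hG hL
    have hd' : d ∈ Set.Icc c e := ⟨hd.1, hd.2.le⟩
    obtain ⟨i3, b3⟩ := hs.integral_cube_le hd' (hL d hd') (hm d hd')
    have h1 := integral_mono (hs.integrable_ldens hd')
      ((hi.const_mul 2).add (i3.const_mul 2)) (fun x => hs.ldens_le_dt hd' x)
    simp only [Pi.add_apply] at h1
    rw [integral_add (hi.const_mul 2) (i3.const_mul 2), integral_const_mul,
      integral_const_mul] at h1
    have h2 : Real.exp (4 * L * (d - c)) ≤ Real.exp (4 * L * (e - c)) :=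
      Real.exp_le_exp.2 (mul_le_mul_of_nonneg_left (by linarith [hd.2]) (by linarith))
    have h3 := mul_le_mul_of_nonneg_right h2
      (by positivity : 0 ≤ Real.exp 1 * (2 * (L ^ 2 * K) + 2 * tint (ldens f g) c))
    rw [tint]
    linarith
  rcases hd.2.lt_or_eq with h | rfl
  · exact hlt d ⟨hd.1, h⟩
  rcases hce.lt_or_eq with h | rfl
  · refine (tint_le_of_frequently (contDiff_mdens (contDiff_lapX hs.smooth_re)
      (contDiff_lapX hs.smooth_im)).continuous (mdens_nonneg _ _) ?_).2
    have h1 : ∀ᶠ s in nhdsWithin d (Set.Iio d), s ∈ Set.Ico c d := Ico_mem_nhdsLT h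
    exact (h1.frequently.filter_mono nhdsWithin_le_nhds).mono fun s hs' =>
      ⟨hs.integrable_ldens ⟨hs'.1, hs'.2.le⟩, hlt s hs'⟩
  · have h1 : 1 ≤ Real.exp 1 := Real.one_le_exp zero_le_one
    rw [sub_self, mul_zero, Real.exp_zero, one_mul]
    have h2 : 0 ≤ L ^ 2 * K := by positivity
    nlinarith

end Sol

/-- An inequality with logarithmic losses that bounds its argument. -/
theorem le_sq_of_log_growth {X A K n M τ : ℝ} (hX : 0 ≤ X) (hA : 0 < A) (hK : 0 ≤ K) (hn : 0 ≤ n)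
    (hτ : 16 * (A * τ) ≤ 1)
    (hM : M = 2 * (Real.exp 1 * (128 * A ^ 2 * K + 2 * n)) + 128 * A ^ 2 * K)
    (h : X ≤ 2 * (Real.exp (4 * (A * Real.log (2 + X)) * τ) *
      (Real.exp 1 * (2 * ((A * Real.log (2 + X)) ^ 2 * K) + 2 * n)))
      + 2 * ((A * Real.log (2 + X)) ^ 2 * K)) : X ≤ (M + 2) ^ 2 := by
  have hW : 0 < 2 + X := by linarith
  set l := Real.log (2 + X) with hl
  have hl0 : 0 ≤ l := Real.log_nonneg (by linarith)
  set Z := Real.exp (l / 8) with hZ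
  have hZ1 : 1 ≤ Z := Real.one_le_exp (by positivity)
  have hlZ : l ≤ 8 * Z := by
    have := Real.add_one_le_exp (l / 8)
    linarith
  have hZ8 : Z ^ 8 = 2 + X := by
    rw [hZ, ← Real.exp_nat_mul, ← Real.exp_log hW]
    congr 1
    push_cast
    ring
  have hexp : Real.exp (4 * (A * l) * τ) ≤ Z ^ 2 := by
    rw [hZ, ← Real.exp_nat_mul]
    apply Real.exp_le_exp.2
    push_cast
    nlinarith
  have hl2 : l ^ 2 ≤ 64 * Z ^ 2 := by nlinarith
  set Y := Z ^ 2 with hY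
  have hY1 : 1 ≤ Y := one_le_pow₀ hZ1
  have hY4 : Y ^ 4 = 2 + X := by rw [hY, ← pow_mul]; exact hZ8
  have hAK : 0 ≤ A ^ 2 * K := by positivity
  have h1 : 2 * ((A * l) ^ 2 * K) ≤ 128 * A ^ 2 * K * Y := by
    have := mul_le_mul_of_nonneg_left hl2 hAK
    nlinarith
  have h2 : 2 * ((A * l) ^ 2 * K) + 2 * n ≤ (128 * A ^ 2 * K + 2 * n) * Y := by nlinarith
  have h3 : Real.exp (4 * (A * l) * τ) * (Real.exp 1 * (2 * ((A * l) ^ 2 * K) + 2 * n))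
      ≤ Y * (Real.exp 1 * ((128 * A ^ 2 * K + 2 * n) * Y)) := by gcongr
  have h4 : X ≤ M * Y ^ 2 := by
    have h5 : 128 * A ^ 2 * K * Y ≤ 128 * A ^ 2 * K * Y ^ 2 := by
      apply mul_le_mul_of_nonneg_left _ (by positivity)
      nlinarith
    rw [hM]
    nlinarith
  have h6 : Y ^ 2 * Y ^ 2 ≤ (M + 2) * Y ^ 2 := by nlinarith
  have h7 : Y ^ 2 ≤ M + 2 := le_of_mul_le_mul_right h6 (by positivity)
  have h8 : Y ^ 2 * Y ^ 2 ≤ (M + 2) * (M + 2) :=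
    mul_le_mul h7 h7 (by positivity) (le_trans (by positivity) h7)
  nlinarith

/-- The sum of the squared `L²` norms of a solution, its gradient and its Laplacian. -/
def hnorm (f g : ℝ × Plane → ℝ) (t : ℝ) : ℝ :=
  tint (mdens f g) t + tint (gdens f g) t + tint (ldens f g) t

theorem tint_le_hnorm (f g : ℝ × Plane → ℝ) (t : ℝ) :
    tint (mdens f g) t ≤ hnorm f g t ∧ tint (gdens f g) t ≤ hnorm f g t ∧
    tint (ldens f g) t ≤ hnorm f g t ∧
    tint (mdens f g) t + tint (gdens f g) t ≤ hnorm f g t := by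
  have h1 := tint_nonneg (mdens_nonneg f g) t
  have h2 := tint_nonneg (gdens_nonneg f g) t
  have h3 := tint_nonneg (mdens_nonneg (lapX f) (lapX g)) t
  rw [hnorm]
  refine ⟨?_, ?_, ?_, ?_⟩ <;> linarith

namespace Sol

variable {f g : ℝ × Plane → ℝ} {a b B L K : ℝ}

/-- Short-time propagation of the `H²` norm under an `H¹` bound; the time of propagation depends
only on the `H¹` bound. -/
theorem exists_step (hK : 0 ≤ K) : ∃ τ : ℝ, 0 < τ ∧ ∀ n : ℝ, 0 ≤ n → ∃ Φ : ℝ, 0 ≤ Φ ∧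
    ∀ (f g : ℝ × Plane → ℝ) (c e : ℝ), Sol f g c e → c ≤ e → e - c ≤ τ →
    (∀ t ∈ Set.Icc c e, tint (mdens f g) t + tint (gdens f g) t ≤ K) →
    (∃ B, ∀ t ∈ Set.Icc c e, tint (ldens f g) t ≤ B) → tint (ldens f g) c ≤ n →
    ∀ t ∈ Set.Icc c e, tint (ldens f g) t ≤ Φ := by
  obtain ⟨c₀, hc₀, hsup⟩ := Sol.exists_sup_bound
  set A := c₀ * (2 * K + 1) with hA
  have hA0 : 0 < A := by positivity
  refine ⟨1 / (16 * A), by positivity, fun n hn => ?_⟩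
  set M := 2 * (Real.exp 1 * (128 * A ^ 2 * K + 2 * n)) + 128 * A ^ 2 * K with hM
  refine ⟨(M + 2) ^ 2, by positivity, fun f g c e hs hce hτ hH ⟨B, hB⟩ hc t ht => ?_⟩
  have hD0 : ∀ t, 0 ≤ tint (ldens f g) t := tint_nonneg (mdens_nonneg _ _)
  have hm0 : ∀ t, 0 ≤ tint (mdens f g) t := tint_nonneg (mdens_nonneg _ _)
  have hg0 : ∀ t, 0 ≤ tint (gdens f g) t := tint_nonneg (gdens_nonneg _ _)
  have hbdd : BddAbove (tint (ldens f g) '' Set.Icc c e) :=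
    ⟨B, by rintro _ ⟨s, hs, rfl⟩; exact hB s hs⟩
  set X := sSup (tint (ldens f g) '' Set.Icc c e) with hX
  have hle : ∀ s ∈ Set.Icc c e, tint (ldens f g) s ≤ X := fun s hs =>
    le_csSup hbdd ⟨s, hs, rfl⟩
  have hX0 : 0 ≤ X := (hD0 t).trans (hle t ht)
  refine (hle t ht).trans (le_sq_of_log_growth (τ := e - c) hX0 hA0 hK hn ?_ hM ?_)
  · calc 16 * (A * (e - c)) ≤ 16 * (A * (1 / (16 * A))) := by gcongr
      _ = 1 := by field_simp
  · have hl0 : 0 ≤ Real.log (2 + X) := Real.log_nonneg (by linarith)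
    refine csSup_le ⟨_, ⟨t, ht, rfl⟩⟩ ?_
    rintro _ ⟨d, hd, rfl⟩
    refine (hs.laplacian_le hce (L := A * Real.log (2 + X)) (K := K) (by positivity)
      (fun s hs' => by linarith [hH s hs', hg0 s]) (fun s hs' => by linarith [hH s hs', hm0 s])
      (fun s hs' x => hsup f g c e s K X hs hs' hX0 (hH s hs') (hle s hs') x) hd).trans ?_
    gcongr

theorem hnorm_reflect (h : Sol f g a b) (t : ℝ) :
    hnorm (timeRefl f) (fun p => -timeRefl g p) t = hnorm f g (-t) := by
  rw [hnorm, tint_mdens_reflect, h.tint_gdens_reflect, h.tint_ldens_reflect, hnorm]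

theorem tint_edens_eq (h : Sol f g a b) {t : ℝ} (ht : t ∈ Set.Icc a b)
    (hL : ∀ x, mdens f g (t, x) ≤ L) :
    tint (gdens f g) t ≤ 2 * tint (edens f g) t ∧
    2 * tint (edens f g) t ≤ tint (gdens f g) t + L * tint (mdens f g) t / 2 := by
  obtain ⟨i2, b2⟩ := h.integrable_sq ht hL
  have e : tint (edens f g) t = tint (gdens f g) t / 2 + (∫ x, mdens f g (t, x) ^ 2) / 4 := by
    simp only [tint, edens]
    rw [integral_add ((h.integrable_gdens ht).div_const 2) (i2.div_const 4), integral_div,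
      integral_div]
  have h0 : 0 ≤ ∫ x, mdens f g (t, x) ^ 2 := integral_nonneg fun x => sq_nonneg _
  constructor <;> linarith

/-- The `H²` norm extends boundedly to an endpoint at which it is finite, with an explicit
bound on a short time interval. -/
theorem exists_extension {n : ℝ} (hn : 0 ≤ n) : ∃ τ : ℝ, 0 < τ ∧ ∃ Φ : ℝ,
    ∀ (f g : ℝ × Plane → ℝ) (c t : ℝ), Sol f g c t → c ≤ t → t - c ≤ τ → hnorm f g c ≤ n →
    (∀ s ∈ Set.Ioc c t, ∃ B, ∀ r ∈ Set.Icc s t, hnorm f g r ≤ B) →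
    ∀ r ∈ Set.Icc c t, hnorm f g r ≤ Φ := by
  obtain ⟨c₀, hc₀, hsup⟩ := Sol.exists_sup_bound
  set S := c₀ * (2 * n + 1) * Real.log (2 + n) with hS
  have hS0 : 0 ≤ S := mul_nonneg (by positivity) (Real.log_nonneg (by linarith))
  have hK1 : 0 ≤ 2 * n + S * n / 2 := by positivity
  obtain ⟨τ, hτ, hstep⟩ := exists_step hK1
  obtain ⟨Φ, hΦ, hstep⟩ := hstep n hn
  refine ⟨τ, hτ, 2 * n + S * n / 2 + Φ, fun f g c t hs hct htc hc hloc => ?_⟩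
  have hD0 : ∀ t, 0 ≤ tint (ldens f g) t := tint_nonneg (mdens_nonneg _ _)
  have hm0 : ∀ t, 0 ≤ tint (mdens f g) t := tint_nonneg (mdens_nonneg _ _)
  have hg0 : ∀ t, 0 ≤ tint (gdens f g) t := tint_nonneg (gdens_nonneg _ _)
  have hmc : tint (mdens f g) c ≤ n := (tint_le_hnorm f g c).1.trans hc
  have hgc : tint (mdens f g) c + tint (gdens f g) c ≤ n := (tint_le_hnorm f g c).2.2.2.trans hc
  have hDc : tint (ldens f g) c ≤ n := (tint_le_hnorm f g c).2.2.1.trans hc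
  have hb : ∃ B, ∀ r ∈ Set.Icc c t, hnorm f g r ≤ B := by
    rcases hct.eq_or_lt with rfl | hlt
    · exact ⟨n, fun r hr => by rwa [le_antisymm hr.2 hr.1]⟩
    set K := max n (tint (mdens f g) t + 2 * tint (edens f g) t) with hK
    have hH : ∀ s ∈ Set.Icc c t, tint (mdens f g) s + tint (gdens f g) s ≤ K := by
      intro s hs'
      rcases hs'.1.eq_or_lt with rfl | hcs
      · exact hgc.trans (le_max_left _ _)
      obtain ⟨B, hB⟩ := hloc s ⟨hcs, hs'.2⟩
      have hss := hs.mono hs'.1 le_rfl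
      have b1 : ∀ r ∈ Set.Icc s t, tint (mdens f g) r ≤ B := fun r hr =>
      (tint_le_hnorm f g r).1.trans (hB r hr)
      have b2 : ∀ r ∈ Set.Icc s t, tint (gdens f g) r ≤ B := fun r hr =>
      (tint_le_hnorm f g r).2.1.trans (hB r hr)
      have b3 : ∀ r ∈ Set.Icc s t, tint (ldens f g) r ≤ B := fun r hr =>
      (tint_le_hnorm f g r).2.2.1.trans (hB r hr)
      obtain ⟨L, hL0, hL⟩ := hss.exists_pointwise_bound b1 b2 b3
      have h1 := hss.energy_eq hs'.2 b1 b2 b3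
      have h2 := hss.mass_eq hs'.2 b1 b2
      have h3 := (hss.tint_edens_eq ⟨le_rfl, hs'.2⟩ (hL s ⟨le_rfl, hs'.2⟩)).1
      refine le_trans ?_ (le_max_right _ _)
      linarith
    have hK0 : 0 ≤ K := hn.trans (le_max_left _ _)
    obtain ⟨τ', hτ', hst⟩ := exists_step hK0
    set s := min (c + τ') t with hsdef
    have hcs : c < s := lt_min (by linarith) hlt
    have hst' : s ≤ t := min_le_right _ _
    obtain ⟨Φ', hΦ', hst⟩ := hst (tint (ldens f g) s) (hD0 s)
    obtain ⟨B, hB⟩ := hloc s ⟨hcs, hst'⟩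
    refine ⟨K + max n (max Φ' B), fun r hr => ?_⟩
    have hDr : tint (ldens f g) r ≤ max n (max Φ' B) := by
      rcases hr.1.eq_or_lt with rfl | hcr
      · exact hDc.trans (le_max_left _ _)
      refine le_trans ?_ (le_max_right _ _)
      rcases le_total s r with hsr | hrs
      · refine le_trans ?_ (le_max_right _ _)
        exact (tint_le_hnorm f g r).2.2.1.trans (hB r ⟨hsr, hr.2⟩)
      refine le_trans ?_ (le_max_left _ _)
      have hss := hs.mono hr.1 hst'
      obtain ⟨B', hB'⟩ := hloc r ⟨hcr, hr.2⟩
      have := hst _ _ (-s) (-r) hss.reflect (neg_le_neg hrs)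
        (by linarith [min_le_left (c + τ') t])
        (fun q hq => by
          rw [tint_mdens_reflect, hss.tint_gdens_reflect]
          exact hH _ ⟨by linarith [hq.2], by linarith [hq.1]⟩)
        ⟨B', fun q hq => by
          rw [hss.tint_ldens_reflect]
          exact (tint_le_hnorm f g _).2.2.1.trans
            (hB' (-q) ⟨by linarith [hq.2], by linarith [hq.1]⟩)⟩
        (by rw [hss.tint_ldens_reflect, neg_neg]) (-r) ⟨neg_le_neg hrs, le_rfl⟩
      rwa [hss.tint_ldens_reflect, neg_neg] at this
    rw [hnorm]
    exact add_le_add (hH r hr) hDr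
  obtain ⟨B, hB⟩ := hb
  have b1 : ∀ r ∈ Set.Icc c t, tint (mdens f g) r ≤ B := fun r hr =>
      (tint_le_hnorm f g r).1.trans (hB r hr)
  have b2 : ∀ r ∈ Set.Icc c t, tint (gdens f g) r ≤ B := fun r hr =>
      (tint_le_hnorm f g r).2.1.trans (hB r hr)
  have b3 : ∀ r ∈ Set.Icc c t, tint (ldens f g) r ≤ B := fun r hr =>
      (tint_le_hnorm f g r).2.2.1.trans (hB r hr)
  obtain ⟨L, hL0, hL⟩ := hs.exists_pointwise_bound b1 b2 b3
  have hH : ∀ r ∈ Set.Icc c t, tint (mdens f g) r + tint (gdens f g) r ≤ 2 * n + S * n / 2 := by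
    intro r hr
    have hss := hs.mono le_rfl hr.2
    have hmem : ∀ q ∈ Set.Icc c r, q ∈ Set.Icc c t := fun q hq => ⟨hq.1, hq.2.trans hr.2⟩
    have h1 := hss.energy_eq hr.1 (fun q hq => b1 q (hmem q hq)) (fun q hq => b2 q (hmem q hq))
      (fun q hq => b3 q (hmem q hq))
    have h2 := hss.mass_eq hr.1 (fun q hq => b1 q (hmem q hq)) (fun q hq => b2 q (hmem q hq))
    have h3 := (hs.tint_edens_eq hr (hL r hr)).1
    have h4 := (hs.tint_edens_eq ⟨le_rfl, hct⟩
      (hsup f g c t c n n hs ⟨le_rfl, hct⟩ hn hgc hDc)).2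
    have h5 : S * tint (mdens f g) c ≤ S * n := mul_le_mul_of_nonneg_left hmc hS0
    linarith
  intro r hr
  rw [hnorm]
  exact add_le_add (hH r hr) (hstep f g c t hs hct htc hH ⟨B, b3⟩ hDc r hr)

theorem bounded_of_locally_bounded {N : ℝ → ℝ} {s S : Set ℝ} (hs : IsCompact s) (hsS : s ⊆ S)
    (h : ∀ t ∈ s, ∃ B, ∀ᶠ r in nhds t, r ∈ S → N r ≤ B) : ∃ B, ∀ t ∈ s, N t ≤ B := by
  refine hs.induction_on (p := fun s => ∃ B, ∀ t ∈ s, N t ≤ B) ⟨0, by simp⟩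
    (fun s t hst ⟨B, hB⟩ => ⟨B, fun r hr => hB r (hst hr)⟩) ?_ ?_
  · rintro s t ⟨B, hB⟩ ⟨B', hB'⟩
    refine ⟨max B B', fun r hr => ?_⟩
    rcases hr with hr | hr
    · exact (hB r hr).trans (le_max_left _ _)
    · exact (hB' r hr).trans (le_max_right _ _)
  · intro t ht
    obtain ⟨B, hB⟩ := h t ht
    refine ⟨{r | N r ≤ B}, ?_, B, fun r hr => hr⟩
    refine mem_nhdsWithin_iff_eventually.2 (hB.mono fun r hr hrs => hr (hsS hrs))

/-- The `H²` norm of a solution stays bounded on a compact time interval. -/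
theorem exists_hnorm_le (h : Sol f g a b) : ∃ B, ∀ t ∈ Set.Icc a b, hnorm f g t ≤ B := by
  set G : Set ℝ := {t | ∃ B, ∀ᶠ r in nhds t, r ∈ Set.Icc a b → hnorm f g r ≤ B} with hG
  have hGo : IsOpen G := by
    rw [isOpen_iff_eventually]
    rintro t ⟨B, hB⟩
    filter_upwards [hB.eventually_nhds] with r hr using ⟨B, hr⟩
  set F : Set ℝ := Set.Icc a b \ G with hF
  have hFc : IsCompact F := isCompact_Icc.diff hGo
  by_cases hFe : F = ∅
  · exact bounded_of_locally_bounded isCompact_Icc subset_rfl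
      (fun t ht => Set.sdiff_eq_empty.1 hFe ht)
  exfalso
  have hFne : F.Nonempty := Set.nonempty_iff_ne_empty.2 hFe
  have : Nonempty F := hFne.to_subtype
  have : CompleteSpace F := hFc.isClosed.completeSpace_coe
  have hcont : Continuous (fun p => mdens f g p + gdens f g p + ldens f g p) :=
    ((contDiff_mdens h.smooth_re h.smooth_im).continuous.add
      (contDiff_gdens h.smooth_re h.smooth_im).continuous).add
      (contDiff_mdens (contDiff_lapX h.smooth_re) (contDiff_lapX h.smooth_im)).continuous
  have hInt : ∀ t ∈ Set.Icc a b,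
      Integrable (fun x => mdens f g (t, x) + gdens f g (t, x) + ldens f g (t, x)) ∧
      tint (fun p => mdens f g p + gdens f g p + ldens f g p) t = hnorm f g t := fun t ht => by
    have i1 := h.integrable_mdens ht
    have i2 := h.integrable_gdens ht
    have i3 := h.integrable_ldens ht
    refine ⟨(i1.add i2).add i3, ?_⟩
    simp only [tint, hnorm]
    rw [integral_add (by exact i1.add i2) i3, integral_add i1 i2]
  have hclosed : ∀ n : ℕ, IsClosed {t : F | hnorm f g t ≤ n} := by
    intro n
    rw [isClosed_iff_frequently]
    intro t ht
    have ht' : ∃ᶠ s in nhds (t : ℝ), s ∈ F ∧ hnorm f g s ≤ n := by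
      have := continuous_subtype_val.continuousAt.tendsto.frequently
        (p := fun s : ℝ => s ∈ F ∧ hnorm f g s ≤ n) (ht.mono fun s hs => ⟨s.2, hs⟩)
      exact this
    have := (tint_le_of_frequently (B := (n : ℝ)) hcont (fun p => add_nonneg (add_nonneg
      (mdens_nonneg _ _ _) (gdens_nonneg _ _ _)) (mdens_nonneg _ _ _))
      (ht'.mono fun s hs => ⟨(hInt s hs.1.1).1, (hInt s hs.1.1).2.trans_le hs.2⟩)).2
    exact (hInt t t.2.1).2.symm.trans_le this
  obtain ⟨n, t₀, ht₀⟩ := nonempty_interior_of_iUnion_of_closed hclosed (by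
    ext t
    simp only [Set.mem_iUnion, Set.mem_ofPred_eq, Set.mem_univ, iff_true]
    exact exists_nat_ge _)
  obtain ⟨ε, hε, hball⟩ := Metric.mem_nhds_iff.1 (mem_interior_iff_mem_nhds.1 ht₀)
  have hn : ∀ s ∈ F, |s - t₀| < ε → hnorm f g s ≤ n := fun s hs hd =>
    hball (show (⟨s, hs⟩ : F) ∈ Metric.ball t₀ ε from hd)
  obtain ⟨τ, hτ, Φ, hext⟩ := exists_extension (Nat.cast_nonneg n : (0 : ℝ) ≤ n)
  have hloc : ∀ c d, Set.Icc c d ⊆ G → c ∈ Set.Icc a b → d ∈ Set.Icc a b →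
      ∃ B, ∀ r ∈ Set.Icc c d, hnorm f g r ≤ B := fun c d hcd hc hd =>
    bounded_of_locally_bounded isCompact_Icc (Set.Icc_subset_Icc hc.1 hd.2) fun t ht => hcd ht
  refine t₀.2.2 ⟨max n Φ, ?_⟩
  filter_upwards [Metric.ball_mem_nhds (t₀ : ℝ) (lt_min hε hτ)] with s hs hsI
  rw [Metric.mem_ball, Real.dist_eq] at hs
  have hsε := hs.trans_le (min_le_left _ _)
  have hsτ := hs.trans_le (min_le_right _ _)
  by_cases hsF : s ∈ F
  · exact (hn s hsF hsε).trans (le_max_left _ _)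
  refine le_trans ?_ (le_max_right _ _)
  have hI := t₀.2.1
  rcases le_total (t₀ : ℝ) s with hle | hle
  · obtain ⟨c, ⟨hcF, hc1, hc2⟩, hcmax⟩ := (hFc.inter_right
      (isClosed_Icc (a := (t₀ : ℝ)) (b := s))).exists_isGreatest ⟨t₀, t₀.2, le_rfl, hle⟩
    have hs0 : s - t₀ < τ := (le_abs_self _).trans_lt hsτ
    have hs1 : s - t₀ < ε := (le_abs_self _).trans_lt hsε
    refine hext f g c s (h.mono hcF.1.1 hsI.2) hc2 (by linarith)
      (hn c hcF (by rw [abs_of_nonneg (by linarith)]; linarith)) (fun r hr => ?_) s ⟨hc2, le_rfl⟩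
    refine hloc r s (fun q hq => ?_) ⟨hcF.1.1.trans hr.1.le, hr.2.trans hsI.2⟩ hsI
    by_contra hqG
    have hqF : q ∈ F := ⟨⟨hcF.1.1.trans (hr.1.le.trans hq.1), hq.2.trans hsI.2⟩, hqG⟩
    have := hcmax ⟨hqF, hc1.trans (hr.1.le.trans hq.1), hq.2⟩
    linarith [hr.1, hq.1]
  · obtain ⟨c, ⟨hcF, hc1, hc2⟩, hcmin⟩ := (hFc.inter_right
      (isClosed_Icc (a := s) (b := (t₀ : ℝ)))).exists_isLeast ⟨t₀, t₀.2, hle, le_rfl⟩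
    have hs0 : -(s - t₀) < τ := (neg_le_abs _).trans_lt hsτ
    have hs1 : -(s - t₀) < ε := (neg_le_abs _).trans_lt hsε
    have hsc := h.mono hsI.1 hcF.1.2
    have key := hext _ _ (-c) (-s) hsc.reflect (neg_le_neg hc1) (by linarith)
      (by
        rw [hsc.hnorm_reflect, neg_neg]
        exact hn c hcF (by rw [abs_of_nonpos (by linarith)]; linarith))
      (fun r hr => by
        obtain ⟨B, hB⟩ := hloc s (-r) (fun q hq => by
          by_contra hqG
          have hq2 : q ≤ -r := hq.2
          have hr1 : -c < r := hr.1
          have hqF : q ∈ F := ⟨⟨hsI.1.trans hq.1, by linarith [hcF.1.2]⟩, hqG⟩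
          have := hcmin ⟨hqF, hq.1, by linarith⟩
          linarith) hsI ⟨by linarith [hr.2, hsI.1], by linarith [hr.1, hcF.1.2]⟩
        refine ⟨B, fun q hq => ?_⟩
        rw [hsc.hnorm_reflect]
        exact hB _ ⟨by linarith [hq.2], by linarith [hq.1]⟩)
      (-s) ⟨neg_le_neg hc1, le_rfl⟩
    rwa [hsc.hnorm_reflect, neg_neg] at key

end Sol

section TwoParticle

/-- A one-particle quantity evaluated at the first of two particles. -/
def fst₂ (F : ℝ × Plane → ℝ) (q : ℝ × (Plane × Plane)) : ℝ := F (q.1, q.2.1)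

/-- A one-particle quantity evaluated at the second of two particles. -/
def snd₂ (F : ℝ × Plane → ℝ) (q : ℝ × (Plane × Plane)) : ℝ := F (q.1, q.2.2)

/-- A function of the relative position of two particles. -/
def rel₂ (A : Plane → ℝ) (q : ℝ × (Plane × Plane)) : ℝ := A (q.2.1 - q.2.2)

/-- The spatial partial derivatives of a function on the plane. -/
def dz (j : Fin 2) (A : Plane → ℝ) : Plane → ℝ := dir (EuclideanSpace.single j 1 : Plane) A

/-- The time derivative for two particles. -/
def dt₂ (F : ℝ × (Plane × Plane) → ℝ) : ℝ × (Plane × Plane) → ℝ :=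
  dir ((1 : ℝ), ((0 : Plane), (0 : Plane))) F

/-- The basis directions of the two-particle space. -/
def basis₂ : Fin 2 ⊕ Fin 2 → Plane × Plane :=
  Sum.elim (fun j => (EuclideanSpace.single j 1, 0)) (fun j => (0, EuclideanSpace.single j 1))

/-- The spatial partial derivatives for two particles. -/
def dx₂ (i : Fin 2 ⊕ Fin 2) (F : ℝ × (Plane × Plane) → ℝ) : ℝ × (Plane × Plane) → ℝ :=
  dir ((0 : ℝ), basis₂ i) F

variable {F : ℝ × Plane → ℝ} {A : Plane → ℝ} {G H : ℝ × (Plane × Plane) → ℝ}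
  {q : ℝ × (Plane × Plane)}

@[fun_prop]
theorem contDiff_dz {j : Fin 2} (hA : ContDiff ℝ ∞ A) : ContDiff ℝ ∞ (dz j A) := contDiff_dir hA

@[fun_prop]
theorem contDiff_dt₂ (hG : ContDiff ℝ ∞ G) : ContDiff ℝ ∞ (dt₂ G) := contDiff_dir hG

@[fun_prop]
theorem contDiff_dx₂ {i : Fin 2 ⊕ Fin 2} (hG : ContDiff ℝ ∞ G) : ContDiff ℝ ∞ (dx₂ i G) :=
  contDiff_dir hG

@[fun_prop]
theorem contDiff_fst₂ (hF : ContDiff ℝ ∞ F) : ContDiff ℝ ∞ (fst₂ F) :=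
  hF.comp (contDiff_fst.prodMk (contDiff_fst.comp contDiff_snd))

@[fun_prop]
theorem contDiff_snd₂ (hF : ContDiff ℝ ∞ F) : ContDiff ℝ ∞ (snd₂ F) :=
  hF.comp (contDiff_fst.prodMk (contDiff_snd.comp contDiff_snd))

@[fun_prop]
theorem contDiff_rel₂ (hA : ContDiff ℝ ∞ A) : ContDiff ℝ ∞ (rel₂ A) :=
  hA.comp ((contDiff_fst.comp contDiff_snd).sub (contDiff_snd.comp contDiff_snd))

theorem dir_comp_clm {X Y : Type*} [NormedAddCommGroup X] [NormedSpace ℝ X]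
    [NormedAddCommGroup Y] [NormedSpace ℝ Y] {F : Y → ℝ} (hF : ContDiff ℝ ∞ F) (T : X →L[ℝ] Y)
    (v p : X) : dir v (fun q => F (T q)) p = dir (T v) F (T p) := by
  have := ((hF.differentiable_of_infty (T p)).hasFDerivAt.comp p T.hasFDerivAt).fderiv
  simp only [dir]
  change fderiv ℝ (F ∘ T) p v = _
  rw [this]
  rfl

theorem dir_fst₂ (hF : ContDiff ℝ ∞ F) (v : ℝ × (Plane × Plane)) :
    dir v (fst₂ F) q = dir (v.1, v.2.1) F (q.1, q.2.1) :=
  dir_comp_clm hF ((ContinuousLinearMap.fst ℝ ℝ (Plane × Plane)).prod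
    ((ContinuousLinearMap.fst ℝ Plane Plane).comp (ContinuousLinearMap.snd ℝ ℝ (Plane × Plane)))) v q

theorem dir_snd₂ (hF : ContDiff ℝ ∞ F) (v : ℝ × (Plane × Plane)) :
    dir v (snd₂ F) q = dir (v.1, v.2.2) F (q.1, q.2.2) :=
  dir_comp_clm hF ((ContinuousLinearMap.fst ℝ ℝ (Plane × Plane)).prod
    ((ContinuousLinearMap.snd ℝ Plane Plane).comp (ContinuousLinearMap.snd ℝ ℝ (Plane × Plane)))) v q

theorem dir_rel₂ (hA : ContDiff ℝ ∞ A) (v : ℝ × (Plane × Plane)) :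
    dir v (rel₂ A) q = dir (v.2.1 - v.2.2) A (q.2.1 - q.2.2) :=
  dir_comp_clm hA (((ContinuousLinearMap.fst ℝ Plane Plane) -
    (ContinuousLinearMap.snd ℝ Plane Plane)).comp (ContinuousLinearMap.snd ℝ ℝ (Plane × Plane))) v q

theorem dir_zero_left {X : Type*} [NormedAddCommGroup X] [NormedSpace ℝ X] {F : X → ℝ} {p : X} :
    dir 0 F p = 0 := by simp [dir]

theorem dir_neg_left {X : Type*} [NormedAddCommGroup X] [NormedSpace ℝ X] {F : X → ℝ} {v p : X} :
    dir (-v) F p = -dir v F p := by simp [dir]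

theorem dt₂_fst₂ (hF : ContDiff ℝ ∞ F) : dt₂ (fst₂ F) q = fst₂ (dt F) q := dir_fst₂ hF _

theorem dt₂_snd₂ (hF : ContDiff ℝ ∞ F) : dt₂ (snd₂ F) q = snd₂ (dt F) q := dir_snd₂ hF _

theorem dt₂_rel₂ (hA : ContDiff ℝ ∞ A) : dt₂ (rel₂ A) q = 0 := by
  rw [dt₂, dir_rel₂ hA]
  simp [dir_zero_left]

theorem dx₂_inl_fst₂ (hF : ContDiff ℝ ∞ F) (j : Fin 2) :
    dx₂ (Sum.inl j) (fst₂ F) q = fst₂ (dx j F) q := dir_fst₂ hF _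

theorem dx₂_inr_snd₂ (hF : ContDiff ℝ ∞ F) (j : Fin 2) :
    dx₂ (Sum.inr j) (snd₂ F) q = snd₂ (dx j F) q := dir_snd₂ hF _

theorem dx₂_inl_snd₂ (hF : ContDiff ℝ ∞ F) (j : Fin 2) : dx₂ (Sum.inl j) (snd₂ F) q = 0 := by
  rw [dx₂, dir_snd₂ hF]
  exact dir_zero_left

theorem dx₂_inr_fst₂ (hF : ContDiff ℝ ∞ F) (j : Fin 2) : dx₂ (Sum.inr j) (fst₂ F) q = 0 := by
  rw [dx₂, dir_fst₂ hF]
  exact dir_zero_left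

theorem dx₂_inl_rel₂ (hA : ContDiff ℝ ∞ A) (j : Fin 2) :
    dx₂ (Sum.inl j) (rel₂ A) q = rel₂ (dz j A) q := by
  rw [dx₂, dir_rel₂ hA]
  simp [basis₂, rel₂, dz]

theorem dx₂_inr_rel₂ (hA : ContDiff ℝ ∞ A) (j : Fin 2) :
    dx₂ (Sum.inr j) (rel₂ A) q = -rel₂ (dz j A) q := by
  rw [dx₂, dir_rel₂ hA]
  simp [basis₂, rel₂, dz, dir_neg_left]

theorem dt₂_add (hG : ContDiff ℝ ∞ G) (hH : ContDiff ℝ ∞ H) :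
    dt₂ (fun q => G q + H q) q = dt₂ G q + dt₂ H q := dir_add hG hH

theorem dt₂_sub (hG : ContDiff ℝ ∞ G) (hH : ContDiff ℝ ∞ H) :
    dt₂ (fun q => G q - H q) q = dt₂ G q - dt₂ H q := dir_sub hG hH

theorem dt₂_mul (hG : ContDiff ℝ ∞ G) (hH : ContDiff ℝ ∞ H) :
    dt₂ (fun q => G q * H q) q = dt₂ G q * H q + G q * dt₂ H q := dir_mul hG hH

theorem dx₂_add {i : Fin 2 ⊕ Fin 2} (hG : ContDiff ℝ ∞ G) (hH : ContDiff ℝ ∞ H) :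
    dx₂ i (fun q => G q + H q) q = dx₂ i G q + dx₂ i H q := dir_add hG hH

theorem dx₂_sub {i : Fin 2 ⊕ Fin 2} (hG : ContDiff ℝ ∞ G) (hH : ContDiff ℝ ∞ H) :
    dx₂ i (fun q => G q - H q) q = dx₂ i G q - dx₂ i H q := dir_sub hG hH

theorem dx₂_mul {i : Fin 2 ⊕ Fin 2} (hG : ContDiff ℝ ∞ G) (hH : ContDiff ℝ ∞ H) :
    dx₂ i (fun q => G q * H q) q = dx₂ i G q * H q + G q * dx₂ i H q := dir_mul hG hH

theorem hasDerivAt_dt₂ (hG : ContDiff ℝ ∞ G) (t : ℝ) (x : Plane × Plane) :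
    HasDerivAt (fun s => G (s, x)) (dt₂ G (t, x)) t := by
  have h := (hG.differentiable_of_infty (t, x)).hasFDerivAt
  exact h.comp_hasDerivAt t ((hasDerivAt_id t).prodMk (hasDerivAt_const t x))

theorem hasLineDerivAt_dx₂ (hG : ContDiff ℝ ∞ G) (i : Fin 2 ⊕ Fin 2) (t : ℝ) (x : Plane × Plane) :
    HasLineDerivAt ℝ (fun y => G (t, y)) (dx₂ i G (t, x)) x (basis₂ i) := by
  have h := (hG.differentiable_of_infty (t, x)).hasFDerivAt
  have h2 : HasFDerivAt (fun y : Plane × Plane => (t, y))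
    (ContinuousLinearMap.inr ℝ ℝ (Plane × Plane)) x := hasFDerivAt_prodMk_right t x
  exact (h.comp x h2).hasLineDerivAt _

variable (a : Fin 2 → Plane → ℝ) (l : Plane → ℝ) (R V : ℝ × Plane → ℝ)
  (P : Fin 2 → ℝ × Plane → ℝ) (S : Fin 2 → Fin 2 → ℝ × Plane → ℝ)

/-- The interaction Morawetz density. -/
def morDens (q : ℝ × (Plane × Plane)) : ℝ :=
  rel₂ (a 0) q * (fst₂ (P 0) q * snd₂ R q - fst₂ R q * snd₂ (P 0) q) +
  rel₂ (a 1) q * (fst₂ (P 1) q * snd₂ R q - fst₂ R q * snd₂ (P 1) q)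

/-- The currents in the directions of the first particle. -/
def morCurL (j : Fin 2) (q : ℝ × (Plane × Plane)) : ℝ :=
  rel₂ (a j) q * (fst₂ V q * snd₂ R q) -
  rel₂ (a 0) q * (fst₂ (S j 0) q * snd₂ R q - fst₂ (P j) q * snd₂ (P 0) q) -
  rel₂ (a 1) q * (fst₂ (S j 1) q * snd₂ R q - fst₂ (P j) q * snd₂ (P 1) q) -
  rel₂ l q * (fst₂ (dx j R) q * snd₂ R q) + rel₂ (dz j l) q * (fst₂ R q * snd₂ R q)

/-- The currents in the directions of the second particle. -/
def morCurR (j : Fin 2) (q : ℝ × (Plane × Plane)) : ℝ :=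
  rel₂ (a 0) q * (fst₂ R q * snd₂ (S j 0) q - fst₂ (P 0) q * snd₂ (P j) q) +
  rel₂ (a 1) q * (fst₂ R q * snd₂ (S j 1) q - fst₂ (P 1) q * snd₂ (P j) q) -
  rel₂ (a j) q * (fst₂ R q * snd₂ V q) -
  rel₂ l q * (fst₂ R q * snd₂ (dx j R) q) - rel₂ (dz j l) q * (fst₂ R q * snd₂ R q)

/-- The currents of the interaction Morawetz density. -/
def morCur (i : Fin 2 ⊕ Fin 2) : ℝ × (Plane × Plane) → ℝ :=
  Sum.elim (morCurL a l R V P S) (morCurR a l R V P S) i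

variable {a l R V P S} (ha : ∀ j, ContDiff ℝ ∞ (a j)) (hl : ContDiff ℝ ∞ l)
  (hR : ContDiff ℝ ∞ R) (hV : ContDiff ℝ ∞ V) (hP : ∀ j, ContDiff ℝ ∞ (P j))
  (hS : ∀ j k, ContDiff ℝ ∞ (S j k))

include ha hR hP in
theorem contDiff_morDens : ContDiff ℝ ∞ (morDens a R P) := by
  unfold morDens
  fun_prop

include ha hl hR hV hP hS in
theorem contDiff_morCur (i : Fin 2 ⊕ Fin 2) : ContDiff ℝ ∞ (morCur a l R V P S i) := by
  rcases i with j | j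
  · change ContDiff ℝ ∞ (morCurL a l R V P S j)
    unfold morCurL
    fun_prop
  · change ContDiff ℝ ∞ (morCurR a l R V P S j)
    unfold morCurR
    fun_prop

include ha hl hR hV hP hS in
/-- The local balance law behind the interaction Morawetz estimate. -/
theorem morDens_balance {t : ℝ} (x y : Plane)
    (hal : ∀ z, l z = dz 0 (a 0) z + dz 1 (a 1) z)
    (hRt : ∀ x, dt R (t, x) = -(dx 0 (P 0) (t, x) + dx 1 (P 1) (t, x)))
    (hPt : ∀ k x, dt (P k) (t, x) = dx k V (t, x)
      - (dx 0 (S 0 k) (t, x) + dx 1 (S 1 k) (t, x)))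
    (hVt : ∀ x, V (t, x) = lapX R (t, x) - R (t, x) * R (t, x)) :
    dt₂ (morDens a R P) (t, (x, y)) - ∑ i, dx₂ i (morCur a l R V P S i) (t, (x, y)) =
      ∑ j, ∑ k, dz j (a k) (x - y) * (S j k (t, x) * R (t, y) + S j k (t, y) * R (t, x)
        - P j (t, x) * P k (t, y) - P k (t, x) * P j (t, y))
      + l (x - y) * (R (t, x) ^ 2 * R (t, y) + R (t, y) ^ 2 * R (t, x))
      - 2 * (dz 0 (dz 0 l) (x - y) + dz 1 (dz 1 l) (x - y)) * (R (t, x) * R (t, y)) := by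
  have e1 : dt₂ (morDens a R P) (t, (x, y)) =
      a 0 (x - y) * (dt (P 0) (t, x) * R (t, y) + P 0 (t, x) * dt R (t, y)
        - dt R (t, x) * P 0 (t, y) - R (t, x) * dt (P 0) (t, y)) +
      a 1 (x - y) * (dt (P 1) (t, x) * R (t, y) + P 1 (t, x) * dt R (t, y)
        - dt R (t, x) * P 1 (t, y) - R (t, x) * dt (P 1) (t, y)) := by
    unfold morDens
    simp (disch := fun_prop) only [dt₂_add, dt₂_sub, dt₂_mul, dt₂_fst₂, dt₂_snd₂, dt₂_rel₂]
    simp only [fst₂, snd₂, rel₂]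
    ring
  have e2 : ∀ j, dx₂ (Sum.inl j) (morCurL a l R V P S j) (t, (x, y)) =
      dz j (a j) (x - y) * (V (t, x) * R (t, y)) + a j (x - y) * (dx j V (t, x) * R (t, y)) -
      dz j (a 0) (x - y) * (S j 0 (t, x) * R (t, y) - P j (t, x) * P 0 (t, y)) -
      a 0 (x - y) * (dx j (S j 0) (t, x) * R (t, y) - dx j (P j) (t, x) * P 0 (t, y)) -
      dz j (a 1) (x - y) * (S j 1 (t, x) * R (t, y) - P j (t, x) * P 1 (t, y)) -
      a 1 (x - y) * (dx j (S j 1) (t, x) * R (t, y) - dx j (P j) (t, x) * P 1 (t, y)) -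
      l (x - y) * (dx j (dx j R) (t, x) * R (t, y)) +
      dz j (dz j l) (x - y) * (R (t, x) * R (t, y)) := by
    intro j
    unfold morCurL
    simp (disch := fun_prop) only [dx₂_add, dx₂_sub, dx₂_mul, dx₂_inl_fst₂, dx₂_inl_snd₂,
      dx₂_inl_rel₂]
    simp only [fst₂, snd₂, rel₂]
    ring
  have e3 : ∀ j, dx₂ (Sum.inr j) (morCurR a l R V P S j) (t, (x, y)) =
      dz j (a j) (x - y) * (R (t, x) * V (t, y)) - a j (x - y) * (R (t, x) * dx j V (t, y)) -
      dz j (a 0) (x - y) * (R (t, x) * S j 0 (t, y) - P 0 (t, x) * P j (t, y)) +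
      a 0 (x - y) * (R (t, x) * dx j (S j 0) (t, y) - P 0 (t, x) * dx j (P j) (t, y)) -
      dz j (a 1) (x - y) * (R (t, x) * S j 1 (t, y) - P 1 (t, x) * P j (t, y)) +
      a 1 (x - y) * (R (t, x) * dx j (S j 1) (t, y) - P 1 (t, x) * dx j (P j) (t, y)) -
      l (x - y) * (R (t, x) * dx j (dx j R) (t, y)) +
      dz j (dz j l) (x - y) * (R (t, x) * R (t, y)) := by
    intro j
    unfold morCurR
    simp (disch := fun_prop) only [dx₂_add, dx₂_sub, dx₂_mul, dx₂_inr_fst₂, dx₂_inr_snd₂,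
      dx₂_inr_rel₂]
    simp only [fst₂, snd₂, rel₂]
    ring
  rw [Fintype.sum_sum_type]
  simp only [morCur, Sum.elim_inl, Sum.elim_inr, Fin.sum_univ_two, e1, e2, e3, hRt, hPt, hal,
    hVt, lapX]
  ring

end TwoParticle

section MomentumBalance

variable (f g : ℝ × Plane → ℝ)

/-- The momentum density of `f + i g`. -/
def pdens (k : Fin 2) (p : ℝ × Plane) : ℝ := 2 * (f p * dx k g p - g p * dx k f p)

/-- The stress tensor of `f + i g`. -/
def sdens (j k : Fin 2) (p : ℝ × Plane) : ℝ := 4 * (dx j f p * dx k f p + dx j g p * dx k g p)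

/-- The scalar part of the momentum current of `f + i g`. -/
def vdens (p : ℝ × Plane) : ℝ :=
  2 * (f p * dt g p - g p * dt f p) + 2 * gdens f g p + mdens f g p * mdens f g p

variable {f g}

@[fun_prop]
theorem contDiff_pdens {k : Fin 2} (hf : ContDiff ℝ ∞ f) (hg : ContDiff ℝ ∞ g) :
    ContDiff ℝ ∞ (pdens f g k) := by
  unfold pdens
  fun_prop

@[fun_prop]
theorem contDiff_sdens {j k : Fin 2} (hf : ContDiff ℝ ∞ f) (hg : ContDiff ℝ ∞ g) :
    ContDiff ℝ ∞ (sdens f g j k) := by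
  unfold sdens
  fun_prop

@[fun_prop]
theorem contDiff_vdens (hf : ContDiff ℝ ∞ f) (hg : ContDiff ℝ ∞ g) :
    ContDiff ℝ ∞ (vdens f g) := by
  unfold vdens
  fun_prop

theorem dx_mdens (hf : ContDiff ℝ ∞ f) (hg : ContDiff ℝ ∞ g) (k : Fin 2) (p : ℝ × Plane) :
    dx k (mdens f g) p = 2 * (f p * dx k f p + g p * dx k g p) := by
  rw [show mdens f g = fun p => f p * f p + g p * g p from rfl]
  simp (disch := fun_prop) only [dx_add, dx_mul]
  ring

theorem Sol.vdens_eq {a b : ℝ} (h : Sol f g a b) {t : ℝ} (ht : t ∈ Set.Icc a b) (x : Plane) :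
    vdens f g (t, x) = lapX (mdens f g) (t, x) - mdens f g (t, x) * mdens f g (t, x) := by
  have hf := h.smooth_re
  have hg := h.smooth_im
  have e : ∀ k, dx k (mdens f g) = fun p => 2 * (f p * dx k f p + g p * dx k g p) :=
    fun k => funext fun p => dx_mdens hf hg k p
  simp only [vdens, lapX, e, h.eq_re t ht, h.eq_im t ht]
  simp (disch := fun_prop) only [dx_add, dx_mul, dx_const]
  simp only [mdens, gdens]
  ring

theorem Sol.dt_mdens {a b : ℝ} (h : Sol f g a b) {t : ℝ} (ht : t ∈ Set.Icc a b) (x : Plane) :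
    dt (mdens f g) (t, x) = -(dx 0 (pdens f g 0) (t, x) + dx 1 (pdens f g 1) (t, x)) := by
  have hf := h.smooth_re
  have hg := h.smooth_im
  rw [show mdens f g = fun p => f p * f p + g p * g p from rfl]
  unfold pdens
  simp (disch := fun_prop) only [dx_sub, dx_mul, dx_const, dt_add, dt_mul]
  simp only [h.eq_re t ht, h.eq_im t ht, mdens, lapX]
  ring

theorem Sol.dt_pdens {a b : ℝ} (h : Sol f g a b) {t : ℝ} (ht : t ∈ Set.Icc a b) (k : Fin 2)
    (x : Plane) : dt (pdens f g k) (t, x) = dx k (vdens f g) (t, x)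
      - (dx 0 (sdens f g 0 k) (t, x) + dx 1 (sdens f g 1 k) (t, x)) := by
  have hf := h.smooth_re
  have hg := h.smooth_im
  unfold pdens vdens sdens gdens mdens
  simp (disch := fun_prop) only [dx_add, dx_sub, dx_mul, dx_const, dt_sub, dt_mul,
    dt_const, dt_dx]
  rw [dx_comm (j := k) (k := 0) hf, dx_comm (j := k) (k := 0) hg, dx_comm (j := k) (k := 1) hf,
    dx_comm (j := k) (k := 1) hg]
  have h1 := h.eq_re t ht x
  have h2 := h.eq_im t ht x
  simp only [lapX, mdens] at h1 h2
  linear_combination 4 * dx k g (t, x) * h1 - 4 * dx k f (t, x) * h2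

theorem abs_cross_le {p q r s A B : ℝ} (hA : p * p + q * q ≤ A) (hB : r * r + s * s ≤ B) :
    |p * r + q * s| ≤ (A + B) / 2 := by
  rw [abs_le]
  constructor
  · nlinarith [sq_nonneg (p + r), sq_nonneg (q + s)]
  · nlinarith [sq_nonneg (p - r), sq_nonneg (q - s)]

theorem abs_pdens_le (k : Fin 2) (p : ℝ × Plane) :
    |pdens f g k p| ≤ mdens f g p + gdens f g p := by
  have h := abs_cross_le (p := f p) (q := -g p) (r := dx k g p) (s := dx k f p)
    (A := mdens f g p) (B := gdens f g p) (by simp only [mdens]; linarith)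
    (by have := mdens_le_gdens f g k p; simp only [mdens] at this ⊢; linarith)
  have e : pdens f g k p = 2 * (f p * dx k g p + -g p * dx k f p) := by simp only [pdens]; ring
  rw [e, abs_mul, abs_of_pos (by norm_num : (0 : ℝ) < 2)]
  linarith

theorem abs_dx_mdens_le (hf : ContDiff ℝ ∞ f) (hg : ContDiff ℝ ∞ g) (k : Fin 2) (p : ℝ × Plane) :
    |dx k (mdens f g) p| ≤ mdens f g p + gdens f g p := by
  have h := abs_cross_le (p := f p) (q := g p) (r := dx k f p) (s := dx k g p)
    (A := mdens f g p) (B := gdens f g p) le_rfl (mdens_le_gdens f g k p)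
  rw [dx_mdens hf hg, abs_mul, abs_of_pos (by norm_num : (0 : ℝ) < 2)]
  linarith

theorem abs_sdens_le (j k : Fin 2) (p : ℝ × Plane) : |sdens f g j k p| ≤ 4 * gdens f g p := by
  have h := abs_cross_le (p := dx j f p) (q := dx j g p) (r := dx k f p) (s := dx k g p)
    (mdens_le_gdens f g j p) (mdens_le_gdens f g k p)
  rw [sdens, abs_mul, abs_of_pos (by norm_num : (0 : ℝ) < 4)]
  linarith

theorem Sol.abs_vdens_le {a b L : ℝ} (h : Sol f g a b) {t : ℝ} (ht : t ∈ Set.Icc a b)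
    (hL : ∀ x, mdens f g (t, x) ≤ L) (x : Plane) :
    |vdens f g (t, x)| ≤ (2 + L) * (mdens f g (t, x) + gdens f g (t, x) + ldens f g (t, x)) := by
  have h0 := abs_cross_le (p := f (t, x)) (q := g (t, x)) (r := lapX f (t, x))
    (s := lapX g (t, x)) (A := mdens f g (t, x)) (B := ldens f g (t, x)) le_rfl le_rfl
  have e : vdens f g (t, x) = 2 * (f (t, x) * lapX f (t, x) + g (t, x) * lapX g (t, x))
      + 2 * gdens f g (t, x) - mdens f g (t, x) * mdens f g (t, x) := by
    simp only [vdens, h.eq_re t ht, h.eq_im t ht]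
    simp only [mdens]
    ring
  have hm := mdens_nonneg f g (t, x)
  have hG := gdens_nonneg f g (t, x)
  have hl := mdens_nonneg (lapX f) (lapX g) (t, x)
  have hLm : mdens f g (t, x) * mdens f g (t, x) ≤ L * mdens f g (t, x) :=
    mul_le_mul_of_nonneg_right (hL x) hm
  have hL0 : 0 ≤ L := hm.trans (hL x)
  have hx := mul_nonneg hL0 hG
  have hy := mul_nonneg hL0 hl
  rw [abs_le] at h0
  rw [e, abs_le]
  simp only [ldens] at h0 hl hy ⊢
  constructor <;> nlinarith [mul_self_nonneg (mdens f g (t, x))]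

end MomentumBalance

section Kernel

/-- The squared length of a vector of the plane. -/
def zsq (z : Plane) : ℝ := z 0 * z 0 + z 1 * z 1

/-- The length of a vector, regularised at scale `μ`. -/
def kw (μ : ℝ) (z : Plane) : ℝ := √(μ ^ 2 + zsq z)

/-- The regularised logarithm. -/
def kl (μ : ℝ) (z : Plane) : ℝ := Real.log (μ + kw μ z)

/-- The radial profile of the gradient of the regularised logarithm. -/
def kk (μ : ℝ) (z : Plane) : ℝ := (kw μ z * (μ + kw μ z))⁻¹

/-- The divergence of `z ↦ kl μ z • z`, up to a constant. -/
def kd (μ : ℝ) (z : Plane) : ℝ := 2 * kl μ z - μ * (kw μ z)⁻¹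

/-- The radial profile of the gradient of `kd μ`. -/
def kg (μ : ℝ) (z : Plane) : ℝ := 2 * kk μ z + μ * ((kw μ z)⁻¹) ^ 3

/-- The Laplacian of `kd μ`, an approximation of a multiple of the Dirac mass. -/
def kpsi (μ : ℝ) (z : Plane) : ℝ := μ / kw μ z ^ 3 + 3 * μ ^ 3 / kw μ z ^ 5

theorem dir_scalar_comp {X : Type*} [NormedAddCommGroup X] [NormedSpace ℝ X] {F : X → ℝ}
    {v p : X} {φ : ℝ → ℝ} {φ' : ℝ} (hF : ContDiff ℝ ∞ F) (hφ : HasDerivAt φ φ' (F p)) :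
    dir v (fun q => φ (F q)) p = φ' * dir v F p := by
  have h := (hφ.comp_hasFDerivAt p (hF.differentiable_of_infty p).hasFDerivAt).fderiv
  change fderiv ℝ (φ ∘ F) p v = _
  rw [h]
  simp [dir]

@[fun_prop]
theorem contDiff_coord (j : Fin 2) : ContDiff ℝ ∞ fun z : Plane => z j := by fun_prop

theorem dz_coord (i j : Fin 2) (z : Plane) :
    dz i (fun z : Plane => z j) z = if j = i then 1 else 0 := by
  have h : HasFDerivAt (fun z : Plane => z j)
      (EuclideanSpace.proj j : Plane →L[ℝ] ℝ) z := (EuclideanSpace.proj j : Plane →L[ℝ] ℝ).hasFDerivAt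
  rw [dz, dir, h.fderiv]
  simp

@[fun_prop]
theorem contDiff_zsq : ContDiff ℝ ∞ zsq := by
  unfold zsq
  fun_prop

theorem zsq_nonneg (z : Plane) : 0 ≤ zsq z := add_nonneg (mul_self_nonneg _) (mul_self_nonneg _)

theorem dz_zsq (j : Fin 2) (z : Plane) : dz j zsq z = 2 * z j := by
  have e : dz j zsq z = dz j (fun z : Plane => z 0 * z 0 + z 1 * z 1) z := rfl
  rw [e, dz, dir_add (by fun_prop) (by fun_prop), dir_mul (by fun_prop) (by fun_prop),
    dir_mul (by fun_prop) (by fun_prop)]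
  change dz j (fun z : Plane => z 0) z * z 0 + z 0 * dz j (fun z : Plane => z 0) z +
    (dz j (fun z : Plane => z 1) z * z 1 + z 1 * dz j (fun z : Plane => z 1) z) = _
  rw [dz_coord, dz_coord]
  fin_cases j <;> simp <;> ring

variable {μ : ℝ} (hμ : 0 < μ)

theorem kw_sq (μ : ℝ) (z : Plane) : kw μ z ^ 2 = μ ^ 2 + zsq z :=
  Real.sq_sqrt (add_nonneg (sq_nonneg _) (zsq_nonneg z))

theorem le_kw (μ : ℝ) (z : Plane) : μ ≤ kw μ z :=
  Real.le_sqrt_of_sq_le (by have := zsq_nonneg z; linarith)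

theorem abs_coord_le_kw (j : Fin 2) (z : Plane) : |z j| ≤ kw μ z := by
  apply Real.abs_le_sqrt
  have h0 := mul_self_nonneg (z 0)
  have h1 := mul_self_nonneg (z 1)
  have := sq_nonneg μ
  fin_cases j <;> simp [zsq] <;> nlinarith

include hμ

theorem kw_pos (z : Plane) : 0 < kw μ z := hμ.trans_le (le_kw μ z)

theorem contDiff_kw : ContDiff ℝ ∞ (kw μ) :=
  ContDiff.sqrt (by fun_prop) fun z => by have := zsq_nonneg z; positivity

theorem contDiff_kl : ContDiff ℝ ∞ (kl μ) :=
  (contDiff_const.add (contDiff_kw hμ)).log fun z => (add_pos hμ (kw_pos hμ z)).ne'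

theorem contDiff_kk : ContDiff ℝ ∞ (kk μ) :=
  ((contDiff_kw hμ).mul (contDiff_const.add (contDiff_kw hμ))).inv fun z =>
    (mul_pos (kw_pos hμ z) (add_pos hμ (kw_pos hμ z))).ne'

theorem contDiff_kw_inv : ContDiff ℝ ∞ fun z => (kw μ z)⁻¹ :=
  (contDiff_kw hμ).inv fun z => (kw_pos hμ z).ne'

theorem contDiff_kd : ContDiff ℝ ∞ (kd μ) :=
  (contDiff_const.mul (contDiff_kl hμ)).sub (contDiff_const.mul (contDiff_kw_inv hμ))

theorem contDiff_kg : ContDiff ℝ ∞ (kg μ) :=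
  (contDiff_const.mul (contDiff_kk hμ)).add (contDiff_const.mul ((contDiff_kw_inv hμ).pow 3))

theorem contDiff_kpsi : ContDiff ℝ ∞ (kpsi μ) :=
  (contDiff_const.div ((contDiff_kw hμ).pow 3) fun z => (pow_pos (kw_pos hμ z) 3).ne').add
    (contDiff_const.div ((contDiff_kw hμ).pow 5) fun z => (pow_pos (kw_pos hμ z) 5).ne')

theorem dz_kw (j : Fin 2) (z : Plane) : dz j (kw μ) z = z j * (kw μ z)⁻¹ := by
  have hs : ContDiff ℝ ∞ fun z => μ ^ 2 + zsq z := by fun_prop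
  have hpos : 0 < μ ^ 2 + zsq z := by have := zsq_nonneg z; positivity
  have h := dir_scalar_comp (v := EuclideanSpace.single j 1) (p := z) hs
    (Real.hasDerivAt_sqrt hpos.ne')
  have h2 : dir (EuclideanSpace.single j 1) (fun z => μ ^ 2 + zsq z) z = 2 * z j := by
    rw [dir_add contDiff_const contDiff_zsq, dir_const, zero_add]
    exact dz_zsq j z
  rw [h2] at h
  change dir (EuclideanSpace.single j 1) (fun z => √(μ ^ 2 + zsq z)) z = _
  rw [h]
  change 1 / (2 * kw μ z) * (2 * z j) = _
  have := (kw_pos hμ z).ne'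
  field_simp

theorem dz_kl (j : Fin 2) (z : Plane) : dz j (kl μ) z = z j * kk μ z := by
  have hw := kw_pos hμ z
  have h := dir_scalar_comp (v := EuclideanSpace.single j 1) (p := z) (contDiff_kw hμ)
    (((hasDerivAt_id (kw μ z)).const_add μ).log (add_pos hμ hw).ne')
  change dz j (kl μ) z = _ * dz j (kw μ) z at h
  rw [h, dz_kw hμ, kk]
  simp only [id]
  have := add_pos hμ hw
  field_simp

theorem dz_kw_inv (j : Fin 2) (z : Plane) :
    dz j (fun z => (kw μ z)⁻¹) z = -z j * ((kw μ z)⁻¹) ^ 3 := by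
  have hw := kw_pos hμ z
  have h := dir_scalar_comp (v := EuclideanSpace.single j 1) (p := z) (contDiff_kw hμ)
    (hasDerivAt_inv hw.ne')
  change dz j (fun z => (kw μ z)⁻¹) z = _ * dz j (kw μ) z at h
  rw [h, dz_kw hμ]
  field_simp

theorem dz_kd (j : Fin 2) (z : Plane) : dz j (kd μ) z = z j * kg μ z := by
  have h : dz j (kd μ) z = (0 * kl μ z + 2 * dz j (kl μ) z)
      - (0 * (kw μ z)⁻¹ + μ * dz j (fun z => (kw μ z)⁻¹) z) := by
    rw [dz]
    change dir _ (fun z => 2 * kl μ z - μ * (kw μ z)⁻¹) z = _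
    rw [dir_sub (contDiff_const.mul (contDiff_kl hμ)) (contDiff_const.mul (contDiff_kw_inv hμ)),
      dir_mul contDiff_const (contDiff_kl hμ), dir_mul contDiff_const (contDiff_kw_inv hμ),
      dir_const, dir_const]
    rfl
  rw [h, dz_kl hμ, dz_kw_inv hμ, kg]
  ring

theorem dz_kg (j : Fin 2) (z : Plane) : dz j (kg μ) z =
    z j * (-2 * (μ + 2 * kw μ z) / (kw μ z ^ 3 * (μ + kw μ z) ^ 2) - 3 * μ / kw μ z ^ 5) := by
  have hw := kw_pos hμ z
  have hd : HasDerivAt (fun w : ℝ => 2 * (w * (μ + w))⁻¹ + μ * (w⁻¹) ^ 3)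
      (2 * (-(1 * (μ + kw μ z) + kw μ z * 1) / (kw μ z * (μ + kw μ z)) ^ 2)
        + μ * (3 * (kw μ z)⁻¹ ^ 2 * (-(kw μ z ^ 2)⁻¹))) (kw μ z) := by
    have h1 : HasDerivAt (fun w : ℝ => w * (μ + w)) (1 * (μ + kw μ z) + kw μ z * 1) (kw μ z) :=
      (hasDerivAt_id (kw μ z)).mul ((hasDerivAt_id (kw μ z)).const_add μ)
    have h2 := ((h1.fun_inv (mul_pos hw (add_pos hμ hw)).ne').const_mul 2).add
      (((hasDerivAt_inv hw.ne').pow 3).const_mul μ)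
    refine h2.congr_deriv ?_
    simp
  have h := dir_scalar_comp (v := EuclideanSpace.single j 1) (p := z) (contDiff_kw hμ) hd
  change dz j (kg μ) z = _ * dz j (kw μ) z at h
  rw [h, dz_kw hμ]
  have := add_pos hμ hw
  field_simp
  ring

theorem laplacian_kd (z : Plane) :
    dz 0 (dz 0 (kd μ)) z + dz 1 (dz 1 (kd μ)) z = kpsi μ z := by
  have e : ∀ j, dz j (dz j (kd μ)) z = 1 * kg μ z + z j * dz j (kg μ) z := fun j => by
    have e1 : dz j (kd μ) = fun z => z j * kg μ z := funext fun z => dz_kd hμ j z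
    rw [e1]
    change dir _ _ _ = _
    rw [dir_mul (by fun_prop) (contDiff_kg hμ)]
    have := dz_coord j j z
    rw [dz] at this
    rw [this, if_pos rfl]
    rfl
  rw [e, e, dz_kg hμ, dz_kg hμ, kg, kk, kpsi]
  have hw := kw_pos hμ z
  have hs := add_pos hμ hw
  have hz : z 0 * z 0 = kw μ z ^ 2 - μ ^ 2 - z 1 * z 1 := by
    rw [kw_sq, zsq]; ring
  have hA : z 0 * (z 0 * (-2 * (μ + 2 * kw μ z) / (kw μ z ^ 3 * (μ + kw μ z) ^ 2)
      - 3 * μ / kw μ z ^ 5)) = (kw μ z ^ 2 - μ ^ 2 - z 1 * z 1) *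
      (-2 * (μ + 2 * kw μ z) / (kw μ z ^ 3 * (μ + kw μ z) ^ 2) - 3 * μ / kw μ z ^ 5) := by
    rw [← hz]; ring
  rw [hA]
  field_simp
  ring

theorem zsq_mul_kk (z : Plane) : zsq z * kk μ z = 1 - μ * (kw μ z)⁻¹ := by
  have hw := kw_pos hμ z
  have hs := add_pos hμ hw
  have hz : zsq z = (kw μ z - μ) * (μ + kw μ z) := by
    have := kw_sq μ z; linear_combination -this
  rw [kk, hz]
  field_simp

theorem kpsi_nonneg (z : Plane) : 0 ≤ kpsi μ z := by
  have hw := kw_pos hμ z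
  rw [kpsi]
  positivity

theorem kpsi_le (z : Plane) : kpsi μ z ≤ 4 / μ ^ 2 := by
  have h := le_kw μ z
  have h1 : μ / kw μ z ^ 3 ≤ μ / μ ^ 3 := by gcongr
  have h2 : 3 * μ ^ 3 / kw μ z ^ 5 ≤ 3 * μ ^ 3 / μ ^ 5 := by gcongr
  have e : μ / μ ^ 3 + 3 * μ ^ 3 / μ ^ 5 = 4 / μ ^ 2 := by field_simp; ring
  rw [kpsi]
  linarith

theorem le_kpsi {z : Plane} (hz : zsq z ≤ μ ^ 2) : 1 / (8 * μ ^ 2) ≤ kpsi μ z := by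
  have hw := kw_pos hμ z
  have h : kw μ z ≤ 2 * μ := by
    have := kw_sq μ z
    nlinarith
  have h1 : μ / (2 * μ) ^ 3 ≤ μ / kw μ z ^ 3 := by gcongr
  have h2 : 0 ≤ 3 * μ ^ 3 / kw μ z ^ 5 := by positivity
  have e : μ / (2 * μ) ^ 3 = 1 / (8 * μ ^ 2) := by field_simp; ring
  rw [kpsi]
  linarith

theorem abs_dz_kd_le (j : Fin 2) (z : Plane) : |dz j (kd μ) z| ≤ 3 / μ := by
  have hw := kw_pos hμ z
  have h := le_kw μ z
  have hz := abs_coord_le_kw (μ := μ) j z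
  have h1 : kk μ z ≤ (kw μ z ^ 2)⁻¹ := by
    rw [kk]
    apply inv_anti₀ (by positivity)
    nlinarith
  have h2 : μ * (kw μ z)⁻¹ ^ 3 ≤ (kw μ z ^ 2)⁻¹ := by
    have : μ * (kw μ z)⁻¹ ^ 3 ≤ kw μ z * (kw μ z)⁻¹ ^ 3 := by gcongr
    refine this.trans (le_of_eq ?_)
    field_simp
  have h3 : 0 ≤ kg μ z := by rw [kg, kk]; positivity
  rw [dz_kd hμ, abs_mul, abs_of_nonneg h3]
  calc |z j| * kg μ z ≤ kw μ z * (3 * (kw μ z ^ 2)⁻¹) := by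
        gcongr
        rw [kg]; linarith
    _ = 3 / kw μ z := by field_simp
    _ ≤ 3 / μ := by gcongr

omit hμ

variable {ε M : ℝ} (hε : 0 < ε) (hM : ε < M)

include hε hM

theorem kw_mono (z : Plane) : kw ε z ≤ kw M z :=
  Real.sqrt_le_sqrt (by nlinarith)

theorem kl_sub_nonneg (z : Plane) : 0 ≤ kl M z - kl ε z := by
  have hw := kw_pos hε z
  have := kw_mono hε hM z
  exact sub_nonneg.2 (Real.log_le_log (by positivity) (by linarith))

theorem kl_sub_le (z : Plane) : kl M z - kl ε z ≤ 2 * M / kw ε z := by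
  have hw := kw_pos hε z
  have hM0 : 0 < M := hε.trans hM
  have hwM := kw_pos hM0 z
  have h1 : kw M z - kw ε z ≤ M - ε := by
    have e1 := kw_sq M z
    have e2 := kw_sq ε z
    have e3 := le_kw ε z
    have e4 := le_kw M z
    by_contra! hc
    nlinarith
  rw [kl, kl, ← Real.log_div (by positivity) (by positivity)]
  refine (Real.log_le_sub_one_of_pos (by positivity)).trans ?_
  rw [div_sub_one (by positivity), div_le_div_iff₀ (by positivity) hw]
  nlinarith

theorem abs_coord_mul_le (j : Fin 2) (z : Plane) : |z j * (kl M z - kl ε z)| ≤ 2 * M := by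
  have hw := kw_pos hε z
  rw [abs_mul, abs_of_nonneg (kl_sub_nonneg hε hM z)]
  calc |z j| * (kl M z - kl ε z) ≤ kw ε z * (2 * M / kw ε z) :=
        mul_le_mul (abs_coord_le_kw j z) (kl_sub_le hε hM z) (kl_sub_nonneg hε hM z) hw.le
    _ = 2 * M := by field_simp

theorem kk_mono (z : Plane) : kk M z ≤ kk ε z := by
  have hw := kw_pos hε z
  have := kw_mono hε hM z
  have hwM := kw_pos (hε.trans hM) z
  rw [kk, kk]
  apply inv_anti₀ (by positivity)
  gcongr

theorem kl_sub_ge (z : Plane) :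
    M * (kw M z)⁻¹ - ε * (kw ε z)⁻¹ ≤ kl M z - kl ε z := by
  have hd : ∀ m ∈ Set.Ioi (0 : ℝ), HasDerivAt (fun m => kl m z - m * (kw m z)⁻¹)
      (m ^ 2 / kw m z ^ 3) m := by
    intro m hm
    have hm : 0 < m := hm
    have hw := kw_pos hm z
    have hs := add_pos hm hw
    have hq : m ^ 2 + zsq z ≠ 0 := by rw [← kw_sq]; positivity
    have h1 : HasDerivAt (fun m => kw m z) (m / kw m z) m := by
      have h := (((hasDerivAt_id m).fun_pow 2).add_const (zsq z)).sqrt hq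
      refine h.congr_deriv ?_
      change (2 : ℕ) * m ^ (2 - 1) * 1 / (2 * kw m z) = m / kw m z
      simp
      field_simp
    have h2 := (((hasDerivAt_id m).add h1).log hs.ne').sub
      ((hasDerivAt_id m).mul (h1.fun_inv hw.ne'))
    refine h2.congr_deriv ?_
    rw [show ((id : ℝ → ℝ) + fun m => kw m z) m = m + kw m z from rfl]
    simp only [id]
    field_simp
    ring
  have hmono : MonotoneOn (fun m => kl m z - m * (kw m z)⁻¹) (Set.Ioi 0) := by
    apply monotoneOn_of_deriv_nonneg (convex_Ioi 0)
      (fun m hm => (hd m hm).continuousAt.continuousWithinAt)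
    · rw [interior_Ioi]
      exact fun m hm => (hd m hm).differentiableAt.differentiableWithinAt
    · rw [interior_Ioi]
      intro m hm
      rw [(hd m hm).deriv]
      have := kw_pos hm z
      positivity
  have := hmono (Set.mem_Ioi.2 hε) (Set.mem_Ioi.2 (hε.trans hM)) hM.le
  simp only at this
  linarith

theorem kd_sub_nonneg (z : Plane) : 0 ≤ kd M z - kd ε z := by
  have h1 := kl_sub_ge hε hM z
  have h2 := kl_sub_nonneg hε hM z
  simp only [kd]
  linarith

theorem abs_kd_sub_le (z : Plane) : |kd M z - kd ε z| ≤ 4 * M / ε + 1 := by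
  have hw := kw_pos hε z
  have hM0 : 0 < M := hε.trans hM
  have hwM := kw_pos hM0 z
  have h1 := kl_sub_le hε hM z
  have h2 : 2 * M / kw ε z ≤ 2 * M / ε := by
    have := le_kw ε z
    gcongr
  have h3 : ε * (kw ε z)⁻¹ ≤ 1 := by
    rw [← div_eq_mul_inv, div_le_one hw]
    exact le_kw ε z
  have h4 : 0 ≤ M * (kw M z)⁻¹ := by positivity
  rw [abs_of_nonneg (kd_sub_nonneg hε hM z), mul_div_assoc]
  rw [mul_div_assoc] at h1 h2
  rw [mul_div_assoc] at h2
  simp only [kd]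
  linarith

end Kernel

section Weight

variable {ε M : ℝ} (hε : 0 < ε) (hM : ε < M)

/-- The gradient of the interaction Morawetz weight. -/
def ka (ε M : ℝ) (j : Fin 2) (z : Plane) : ℝ := z j * (kl M z - kl ε z)

/-- The Laplacian of the interaction Morawetz weight. -/
def kdiv (ε M : ℝ) (z : Plane) : ℝ := kd M z - kd ε z

include hε hM

theorem contDiff_ka (j : Fin 2) : ContDiff ℝ ∞ (ka ε M j) :=
  (contDiff_coord j).mul ((contDiff_kl (hε.trans hM)).sub (contDiff_kl hε))

theorem contDiff_kdiv : ContDiff ℝ ∞ (kdiv ε M) := (contDiff_kd (hε.trans hM)).sub (contDiff_kd hε)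

theorem dz_ka (i j : Fin 2) (z : Plane) : dz i (ka ε M j) z =
    (if j = i then 1 else 0) * (kl M z - kl ε z) + z j * z i * (kk M z - kk ε z) := by
  have hM0 := hε.trans hM
  have h1 := contDiff_kl hM0
  have h2 := contDiff_kl hε
  have e : dz i (ka ε M j) z = dz i (fun z : Plane => z j) z * (kl M z - kl ε z)
      + z j * (dz i (kl M) z - dz i (kl ε) z) := by
    rw [dz]
    change dir _ (fun z : Plane => z j * (kl M z - kl ε z)) z = _
    rw [dir_mul (contDiff_coord j) (h1.sub h2), dir_sub h1 h2]
    rfl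
  rw [e, dz_coord, dz_kl hM0, dz_kl hε]
  ring

theorem kdiv_eq (z : Plane) : kdiv ε M z = dz 0 (ka ε M 0) z + dz 1 (ka ε M 1) z := by
  rw [dz_ka hε hM, dz_ka hε hM, kdiv, kd, kd, if_pos rfl, if_pos rfl]
  have h1 := zsq_mul_kk (hε.trans hM) z
  have h2 := zsq_mul_kk hε z
  simp only [zsq] at h1 h2
  linear_combination h2 - h1

theorem dz_kdiv (j : Fin 2) : dz j (kdiv ε M) = fun z => dz j (kd M) z - dz j (kd ε) z :=
  funext fun _ => dir_sub (contDiff_kd (hε.trans hM)) (contDiff_kd hε)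

theorem laplacian_kdiv (z : Plane) :
    dz 0 (dz 0 (kdiv ε M)) z + dz 1 (dz 1 (kdiv ε M)) z = kpsi M z - kpsi ε z := by
  have hM0 := hε.trans hM
  have e : ∀ j, dz j (fun z => dz j (kd M) z - dz j (kd ε) z) z =
      dz j (dz j (kd M)) z - dz j (dz j (kd ε)) z := fun j =>
    dir_sub (contDiff_dz (contDiff_kd hM0)) (contDiff_dz (contDiff_kd hε))
  rw [dz_kdiv hε hM, dz_kdiv hε hM, e, e, ← laplacian_kd hM0, ← laplacian_kd hε]
  ring

theorem abs_dz_kdiv_le (j : Fin 2) (z : Plane) : |dz j (kdiv ε M) z| ≤ 3 / M + 3 / ε := by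
  rw [dz_kdiv hε hM]
  exact (abs_sub _ _).trans (add_le_add (abs_dz_kd_le (hε.trans hM) j z) (abs_dz_kd_le hε j z))

/-- The Hessian of the weight is non-negative. -/
theorem sum_dz_ka_mul_nonneg (z : Plane) {X : Fin 2 → Fin 2 → ℝ}
    (hX : ∀ v w : ℝ, 0 ≤ v * v * X 0 0 + v * w * X 0 1 + w * v * X 1 0 + w * w * X 1 1) :
    0 ≤ ∑ j, ∑ k, dz j (ka ε M k) z * X j k := by
  have h0 := hX 1 0
  have h1 := hX 0 1
  have h2 := hX (-z 1) (z 0)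
  have hc := kl_sub_ge hε hM z
  have hd := kk_mono hε hM z
  have e1 := zsq_mul_kk (hε.trans hM) z
  have e2 := zsq_mul_kk hε z
  simp only [Fin.sum_univ_two, dz_ka hε hM]
  simp only [zsq] at e1 e2
  have e : ∀ G kM kε : ℝ, (1 * G + z 0 * z 0 * (kM - kε)) * X 0 0 +
      (0 * G + z 1 * z 0 * (kM - kε)) * X 0 1 + ((0 * G + z 0 * z 1 * (kM - kε)) * X 1 0 +
      (1 * G + z 1 * z 1 * (kM - kε)) * X 1 1) =
      (G - ((z 0 * z 0 + z 1 * z 1) * kε - (z 0 * z 0 + z 1 * z 1) * kM)) * (X 0 0 + X 1 1)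
      + (kε - kM) * (-z 1 * -z 1 * X 0 0 + -z 1 * z 0 * X 0 1 + z 0 * -z 1 * X 1 0
        + z 0 * z 0 * X 1 1) := by
    intro G kM kε
    ring
  simp only [if_pos, if_neg (by decide : ¬ (1 : Fin 2) = 0), if_neg (by decide : ¬ (0 : Fin 2) = 1)]
  rw [e, e1, e2]
  exact add_nonneg (mul_nonneg (by linarith) (by linarith)) (mul_nonneg (by linarith) h2)

end Weight

section Interaction

variable {f g : ℝ × Plane → ℝ}

theorem interaction_square_nonneg (a b c d a' b' c' d' : ℝ) :
    2 * ((a * d - b * c) * (a' * d' - b' * c')) ≤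
      (c * c + d * d) * (a' * a' + b' * b') + (c' * c' + d' * d') * (a * a + b * b) := by
  nlinarith [sq_nonneg (c * a' - d * b' - a * c' + b * d'), sq_nonneg (c * b' + d * a' - a * d' - b * c'),
    sq_nonneg (c * a' + d * b' + a * c' + b * d'), sq_nonneg (d * a' - c * b' + b * c' - a * d')]

theorem stress_form_nonneg (p q : ℝ × Plane) (v w : ℝ)
    {X : Fin 2 → Fin 2 → ℝ} (hX : ∀ j k, X j k = sdens f g j k p * mdens f g q
      + sdens f g j k q * mdens f g p - pdens f g j p * pdens f g k q
      - pdens f g k p * pdens f g j q) :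
    0 ≤ v * v * X 0 0 + v * w * X 0 1 + w * v * X 1 0 + w * w * X 1 1 := by
  have h := interaction_square_nonneg (f p) (g p) (v * dx 0 f p + w * dx 1 f p)
    (v * dx 0 g p + w * dx 1 g p) (f q) (g q) (v * dx 0 f q + w * dx 1 f q)
    (v * dx 0 g q + w * dx 1 g q)
  simp only [hX, sdens, pdens, mdens]
  linarith

/-- The interaction Morawetz density of a solution. -/
def mor (f g : ℝ × Plane → ℝ) (ε M : ℝ) : ℝ × (Plane × Plane) → ℝ :=
  morDens (ka ε M) (mdens f g) (pdens f g)

/-- The interaction Morawetz currents of a solution. -/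
def morJ (f g : ℝ × Plane → ℝ) (ε M : ℝ) : Fin 2 ⊕ Fin 2 → ℝ × (Plane × Plane) → ℝ :=
  morCur (ka ε M) (kdiv ε M) (mdens f g) (vdens f g) (pdens f g) (sdens f g)

variable {a b ε M : ℝ} (hε : 0 < ε) (hM : ε < M)

include hε hM in
theorem Sol.mor_monotone (h : Sol f g a b) {t : ℝ} (ht : t ∈ Set.Icc a b) (x y : Plane) :
    -dt₂ (mor f g ε M) (t, (x, y)) + ∑ i, dx₂ i (morJ f g ε M i) (t, (x, y))
      + 2 * kpsi ε (x - y) * (mdens f g (t, x) * mdens f g (t, y))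
      ≤ 8 / M ^ 2 * (mdens f g (t, x) * mdens f g (t, y)) := by
  have hf := h.smooth_re
  have hg := h.smooth_im
  have ha := fun k => contDiff_ka hε hM k
  have hPd := fun k => contDiff_pdens hf hg (k := k)
  have hSd := fun j k => contDiff_sdens hf hg (j := j) (k := k)
  have hal : ∀ z, kdiv ε M z = dz 0 (ka ε M 0) z + dz 1 (ka ε M 1) z := kdiv_eq hε hM
  have hRt := h.dt_mdens ht
  have hPt := h.dt_pdens ht
  have hVt := h.vdens_eq ht
  have hb := morDens_balance (a := ka ε M) (l := kdiv ε M) (R := mdens f g) (V := vdens f g)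
    (P := pdens f g) (S := sdens f g) (t := t) ha (contDiff_kdiv hε hM) (contDiff_mdens hf hg)
    (contDiff_vdens hf hg) hPd hSd x y hal hRt hPt hVt
  have hQ : 0 ≤ ∑ j, ∑ k, dz j (ka ε M k) (x - y) *
      (sdens f g j k (t, x) * mdens f g (t, y) + sdens f g j k (t, y) * mdens f g (t, x)
        - pdens f g j (t, x) * pdens f g k (t, y) - pdens f g k (t, x) * pdens f g j (t, y)) :=
    sum_dz_ka_mul_nonneg hε hM (x - y) (X := fun j k => sdens f g j k (t, x) * mdens f g (t, y)
      + sdens f g j k (t, y) * mdens f g (t, x) - pdens f g j (t, x) * pdens f g k (t, y)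
      - pdens f g k (t, x) * pdens f g j (t, y)) fun v w =>
        stress_form_nonneg (f := f) (g := g) (t, x) (t, y) v w fun _ _ => rfl
  have hx := mdens_nonneg f g (t, x)
  have hy := mdens_nonneg f g (t, y)
  have hl : 0 ≤ kdiv ε M (x - y) * (mdens f g (t, x) ^ 2 * mdens f g (t, y)
      + mdens f g (t, y) ^ 2 * mdens f g (t, x)) :=
    mul_nonneg (kd_sub_nonneg hε hM _) (by positivity)
  have hψ := mul_le_mul_of_nonneg_right (kpsi_le (hε.trans hM) (x - y)) (mul_nonneg hx hy)
  rw [laplacian_kdiv hε hM] at hb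
  have e : 8 / M ^ 2 = 2 * (4 / M ^ 2) := by ring
  rw [e]
  change dt₂ (mor f g ε M) (t, (x, y)) - ∑ i, dx₂ i (morJ f g ε M i) (t, (x, y)) = _ at hb
  generalize dt₂ (mor f g ε M) (t, (x, y)) = A at hb ⊢
  generalize ∑ i, dx₂ i (morJ f g ε M i) (t, (x, y)) = A' at hb ⊢
  linarith

theorem abs_mul_fst₂_snd₂_le {F G D : ℝ × Plane → ℝ} {α A c c' t : ℝ} {x y : Plane}
    (hA : |α| ≤ A) (hF : |F (t, x)| ≤ c * D (t, x)) (hG : |G (t, y)| ≤ c' * D (t, y)) :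
    |α * (F (t, x) * G (t, y))| ≤ A * c * c' * (D (t, x) * D (t, y)) := by
  rw [abs_mul, abs_mul]
  have h1 := mul_le_mul hF hG (abs_nonneg _) ((abs_nonneg _).trans hF)
  have h2 := mul_le_mul hA h1 (mul_nonneg (abs_nonneg _) (abs_nonneg _)) ((abs_nonneg _).trans hA)
  linarith

/-- The density controlling all one-particle quantities. -/
def hdens (f g : ℝ × Plane → ℝ) (p : ℝ × Plane) : ℝ := mdens f g p + gdens f g p + ldens f g p

include hε hM in
theorem Sol.abs_morJ_le (h : Sol f g a b) {L : ℝ} {t : ℝ} (ht : t ∈ Set.Icc a b)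
    (hL : ∀ x, mdens f g (t, x) ≤ L) (i : Fin 2 ⊕ Fin 2) (x y : Plane) :
    |morJ f g ε M i (t, (x, y))| ≤ (2 * M * (12 + L) + (4 * M / ε + 1) + (3 / M + 3 / ε)) *
      (hdens f g (t, x) * hdens f g (t, y)) := by
  have hf := h.smooth_re
  have hg := h.smooth_im
  have hm := mdens_nonneg f g
  have hG := gdens_nonneg f g
  have hl := mdens_nonneg (lapX f) (lapX g)
  have bR : ∀ p, |mdens f g p| ≤ 1 * hdens f g p := fun p => by
    rw [abs_of_nonneg (hm p), hdens]; have := hG p; have := hl p; linarith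
  have bP : ∀ k p, |pdens f g k p| ≤ 1 * hdens f g p := fun k p => by
    have := abs_pdens_le (f := f) (g := g) k p; have := hl p; rw [hdens]; linarith
  have bD : ∀ k p, |dx k (mdens f g) p| ≤ 1 * hdens f g p := fun k p => by
    have := abs_dx_mdens_le hf hg k p; have := hl p; rw [hdens]; linarith
  have bS : ∀ j k p, |sdens f g j k p| ≤ 4 * hdens f g p := fun j k p => by
    have := abs_sdens_le (f := f) (g := g) j k p
    have := hl p; have := hm p; have := hG p; rw [hdens]; linarith
  have bV : ∀ x, |vdens f g (t, x)| ≤ (2 + L) * hdens f g (t, x) := h.abs_vdens_le ht hL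
  have ba : ∀ j, |ka ε M j (x - y)| ≤ 2 * M := fun j => abs_coord_mul_le hε hM j _
  have bl : |kdiv ε M (x - y)| ≤ 4 * M / ε + 1 := abs_kd_sub_le hε hM _
  have bg : ∀ j, |dz j (kdiv ε M) (x - y)| ≤ 3 / M + 3 / ε := fun j => abs_dz_kdiv_le hε hM j _
  rcases i with j | j
  · have e : morJ f g ε M (Sum.inl j) (t, (x, y)) =
        ka ε M j (x - y) * (vdens f g (t, x) * mdens f g (t, y))
        - ka ε M 0 (x - y) * (sdens f g j 0 (t, x) * mdens f g (t, y))
        + ka ε M 0 (x - y) * (pdens f g j (t, x) * pdens f g 0 (t, y))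
        - ka ε M 1 (x - y) * (sdens f g j 1 (t, x) * mdens f g (t, y))
        + ka ε M 1 (x - y) * (pdens f g j (t, x) * pdens f g 1 (t, y))
        - kdiv ε M (x - y) * (dx j (mdens f g) (t, x) * mdens f g (t, y))
        + dz j (kdiv ε M) (x - y) * (mdens f g (t, x) * mdens f g (t, y)) := by
      simp only [morJ, morCur, Sum.elim_inl, morCurL, rel₂, fst₂, snd₂]
      ring
    rw [e]
    have h1 := abs_le.1 (abs_mul_fst₂_snd₂_le (ba j) (bV x) (bR (t, y)))
    have h2 := abs_le.1 (abs_mul_fst₂_snd₂_le (ba 0) (bS j 0 (t, x)) (bR (t, y)))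
    have h3 := abs_le.1 (abs_mul_fst₂_snd₂_le (ba 0) (bP j (t, x)) (bP 0 (t, y)))
    have h4 := abs_le.1 (abs_mul_fst₂_snd₂_le (ba 1) (bS j 1 (t, x)) (bR (t, y)))
    have h5 := abs_le.1 (abs_mul_fst₂_snd₂_le (ba 1) (bP j (t, x)) (bP 1 (t, y)))
    have h6 := abs_le.1 (abs_mul_fst₂_snd₂_le bl (bD j (t, x)) (bR (t, y)))
    have h7 := abs_le.1 (abs_mul_fst₂_snd₂_le (bg j) (bR (t, x)) (bR (t, y)))
    rw [abs_le]
    constructor <;> linarith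
  · have e : morJ f g ε M (Sum.inr j) (t, (x, y)) =
        ka ε M 0 (x - y) * (mdens f g (t, x) * sdens f g j 0 (t, y))
        - ka ε M 0 (x - y) * (pdens f g 0 (t, x) * pdens f g j (t, y))
        + ka ε M 1 (x - y) * (mdens f g (t, x) * sdens f g j 1 (t, y))
        - ka ε M 1 (x - y) * (pdens f g 1 (t, x) * pdens f g j (t, y))
        - ka ε M j (x - y) * (mdens f g (t, x) * vdens f g (t, y))
        - kdiv ε M (x - y) * (mdens f g (t, x) * dx j (mdens f g) (t, y))
        - dz j (kdiv ε M) (x - y) * (mdens f g (t, x) * mdens f g (t, y)) := by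
      simp only [morJ, morCur, Sum.elim_inr, morCurR, rel₂, fst₂, snd₂]
      ring
    rw [e]
    have h1 := abs_le.1 (abs_mul_fst₂_snd₂_le (ba j) (bR (t, x)) (bV y))
    have h2 := abs_le.1 (abs_mul_fst₂_snd₂_le (ba 0) (bR (t, x)) (bS j 0 (t, y)))
    have h3 := abs_le.1 (abs_mul_fst₂_snd₂_le (ba 0) (bP 0 (t, x)) (bP j (t, y)))
    have h4 := abs_le.1 (abs_mul_fst₂_snd₂_le (ba 1) (bR (t, x)) (bS j 1 (t, y)))
    have h5 := abs_le.1 (abs_mul_fst₂_snd₂_le (ba 1) (bP 1 (t, x)) (bP j (t, y)))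
    have h6 := abs_le.1 (abs_mul_fst₂_snd₂_le bl (bR (t, x)) (bD j (t, y)))
    have h7 := abs_le.1 (abs_mul_fst₂_snd₂_le (bg j) (bR (t, x)) (bR (t, y)))
    rw [abs_le]
    constructor <;> linarith

/-- The Cauchy–Schwarz bound for the momentum. -/
theorem Sol.integral_abs_pdens_le (h : Sol f g a b) {t : ℝ} (ht : t ∈ Set.Icc a b) (k : Fin 2) :
    Integrable (fun x => pdens f g k (t, x)) ∧
      ∫ x, |pdens f g k (t, x)| ≤ 2 * √(tint (mdens f g) t) * √(tint (gdens f g) t) := by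
  have hf := h.smooth_re
  have hg := h.smooth_im
  have im := h.integrable_mdens ht
  have ig := h.integrable_gdens ht
  have hm := mdens_nonneg f g
  have hG := gdens_nonneg f g
  have hP : Integrable fun x => pdens f g k (t, x) :=
    (integrable_of_abs_le (continuous_slice (contDiff_pdens hf hg).continuous t) (im.add ig)
      (fun x => abs_pdens_le k (t, x)) le_rfl).1
  refine ⟨hP, ?_⟩
  have cm : Continuous fun x => √(mdens f g (t, x)) :=
    (continuous_slice (contDiff_mdens hf hg).continuous t).sqrt
  have cg : Continuous fun x => √(gdens f g (t, x)) :=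
    (continuous_slice (contDiff_gdens hf hg).continuous t).sqrt
  have mm : MemLp (fun x => √(mdens f g (t, x))) (ENNReal.ofReal 2) volume := by
    rw [ENNReal.ofReal_ofNat, memLp_two_iff_integrable_sq cm.aestronglyMeasurable]
    simpa only [Real.sq_sqrt (hm _)] using im
  have mg : MemLp (fun x => √(gdens f g (t, x))) (ENNReal.ofReal 2) volume := by
    rw [ENNReal.ofReal_ofNat, memLp_two_iff_integrable_sq cg.aestronglyMeasurable]
    simpa only [Real.sq_sqrt (hG _)] using ig
  have hH := integral_mul_le_Lp_mul_Lq_of_nonneg Real.HolderConjugate.two_two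
    (Filter.Eventually.of_forall fun _ => Real.sqrt_nonneg _)
    (Filter.Eventually.of_forall fun _ => Real.sqrt_nonneg _) mm mg
  simp only [Real.rpow_two, Real.sq_sqrt (hm _), Real.sq_sqrt (hG _), ← Real.sqrt_eq_rpow] at hH
  have hi : Integrable fun x => √(mdens f g (t, x)) * √(gdens f g (t, x)) := by
    rw [ENNReal.ofReal_ofNat] at mm mg
    exact mm.integrable_mul mg
  have hle : ∀ x, |pdens f g k (t, x)| ≤ 2 * (√(mdens f g (t, x)) * √(gdens f g (t, x))) := by
    intro x
    rw [← Real.sqrt_mul (hm _)]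
    have e : pdens f g k (t, x) = 2 * (f (t, x) * dx k g (t, x) - g (t, x) * dx k f (t, x)) := rfl
    rw [e, abs_mul, abs_of_pos (by norm_num : (0 : ℝ) < 2)]
    refine mul_le_mul_of_nonneg_left (Real.abs_le_sqrt ?_) (by norm_num)
    have h1 := mul_le_mul_of_nonneg_left (mdens_le_gdens f g k (t, x)) (hm (t, x))
    refine le_trans ?_ h1
    simp only [mdens]
    nlinarith [sq_nonneg (f (t, x) * dx k f (t, x) + g (t, x) * dx k g (t, x))]
  refine (integral_mono hP.abs (hi.const_mul 2) hle).trans ?_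
  rw [integral_const_mul, mul_assoc]
  exact mul_le_mul_of_nonneg_left hH (by norm_num)

include hε hM in
theorem Sol.integral_abs_mor_le (h : Sol f g a b) {t : ℝ} (ht : t ∈ Set.Icc a b) :
    Integrable (fun q => mor f g ε M (t, q)) (volume.prod volume) ∧
      |∫ q, mor f g ε M (t, q) ∂(volume.prod volume)| ≤
        16 * M * (tint (mdens f g) t * (√(tint (mdens f g) t) * √(tint (gdens f g) t))) := by
  have hf := h.smooth_re
  have hg := h.smooth_im
  have hM0 := hε.trans hM
  have im := h.integrable_mdens ht
  have hm := mdens_nonneg f g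
  have iP := fun k => (h.integral_abs_pdens_le ht k).1.abs
  have hq : ∀ k, Integrable (fun q : Plane × Plane => |pdens f g k (t, q.1)| * mdens f g (t, q.2)
      + mdens f g (t, q.1) * |pdens f g k (t, q.2)|) (volume.prod volume) := fun k =>
    ((iP k).mul_prod im).add (im.mul_prod (iP k))
  have hqv : ∀ k, ∫ q : Plane × Plane, (|pdens f g k (t, q.1)| * mdens f g (t, q.2)
      + mdens f g (t, q.1) * |pdens f g k (t, q.2)|) ∂(volume.prod volume) ≤
      4 * (tint (mdens f g) t * (√(tint (mdens f g) t) * √(tint (gdens f g) t))) := fun k => by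
    rw [integral_add ((iP k).mul_prod im) (im.mul_prod (iP k)),
      integral_prod_mul (fun x => |pdens f g k (t, x)|) fun x => mdens f g (t, x),
      integral_prod_mul (fun x => mdens f g (t, x)) fun x => |pdens f g k (t, x)|]
    have h1 := mul_le_mul_of_nonneg_left (h.integral_abs_pdens_le ht k).2
      (tint_nonneg hm (t := t))
    simp only [tint] at h1 ⊢
    linarith
  have hInt := ((hq 0).add (hq 1)).const_mul (2 * M)
  have hb := integrable_of_abs_le (h := fun q => mor f g ε M (t, q))
    ((contDiff_morDens (contDiff_ka hε hM) (contDiff_mdens hf hg)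
      fun _ => contDiff_pdens hf hg).continuous.comp (by fun_prop)) hInt (fun q => ?_) le_rfl
  · refine ⟨hb.1, (abs_integral_le_integral_abs).trans (hb.2.trans ?_)⟩
    rw [integral_const_mul]
    simp only [Pi.add_apply]
    rw [integral_add (hq 0) (hq 1)]
    have := mul_le_mul_of_nonneg_left (add_le_add (hqv 0) (hqv 1)) (by positivity : 0 ≤ 2 * M)
    linarith
  · have hk : ∀ k, |ka ε M k (q.1 - q.2) * (pdens f g k (t, q.1) * mdens f g (t, q.2)
        - mdens f g (t, q.1) * pdens f g k (t, q.2))| ≤ 2 * M * (|pdens f g k (t, q.1)| *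
          mdens f g (t, q.2) + mdens f g (t, q.1) * |pdens f g k (t, q.2)|) := fun k => by
      rw [abs_mul]
      refine mul_le_mul (abs_coord_mul_le hε hM k _) ((abs_sub _ _).trans ?_) (abs_nonneg _)
        (by positivity)
      rw [abs_mul, abs_mul, abs_of_nonneg (hm (t, q.1)), abs_of_nonneg (hm (t, q.2))]
    refine (abs_add_le _ _).trans ?_
    refine (add_le_add (hk 0) (hk 1)).trans (le_of_eq ?_)
    simp only [Pi.add_apply]
    ring

include hε hM in
/-- The interaction Morawetz inequality with a regularised Dirac mass. -/
theorem Sol.lintegral_kpsi_le (h : Sol f g a b) (hab : a ≤ b) {m H : ℝ}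
    (hmass : ∀ t ∈ Set.Icc a b, tint (mdens f g) t ≤ m)
    (hH : ∀ t ∈ Set.Icc a b,
      tint (mdens f g) t * (√(tint (mdens f g) t) * √(tint (gdens f g) t)) ≤ H) :
    ∫⁻ t in Set.Ioc a b, ∫⁻ q : Plane × Plane, ENNReal.ofReal
      (2 * kpsi ε (q.1 - q.2) * (mdens f g (t, q.1) * mdens f g (t, q.2))) ∂(volume.prod volume)
      ≤ ENNReal.ofReal (32 * M * H + 8 / M ^ 2 * m ^ 2 * (b - a)) := by
  have hf := h.smooth_re
  have hg := h.smooth_im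
  have hM0 := hε.trans hM
  have hm := mdens_nonneg f g
  obtain ⟨B, hB⟩ := h.exists_hnorm_le
  obtain ⟨L, hL0, hL⟩ := h.exists_pointwise_bound (B := B)
    (fun t ht => (tint_le_hnorm f g t).1.trans (hB t ht))
    (fun t ht => (tint_le_hnorm f g t).2.1.trans (hB t ht))
    (fun t ht => (tint_le_hnorm f g t).2.2.1.trans (hB t ht))
  have hmor : ContDiff ℝ ∞ (mor f g ε M) := contDiff_morDens (contDiff_ka hε hM)
    (contDiff_mdens hf hg) fun _ => contDiff_pdens hf hg
  have hJ : ∀ i, ContDiff ℝ ∞ (morJ f g ε M i) := contDiff_morCur (contDiff_ka hε hM)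
    (contDiff_kdiv hε hM) (contDiff_mdens hf hg) (contDiff_vdens hf hg)
    (fun _ => contDiff_pdens hf hg) (fun _ _ => contDiff_sdens hf hg)
  have hψ : Continuous (kpsi ε) := (contDiff_kpsi hε).continuous
  have hmc : Continuous (mdens f g) := (contDiff_mdens hf hg).continuous
  set K := 2 * M * (12 + L) + (4 * M / ε + 1) + (3 / M + 3 / ε) with hK
  have hK0 : 0 ≤ K := by positivity
  have hflux := (flux_balance (μ := (volume : Measure Plane).prod volume) basis₂
    (ρ := fun t q => -mor f g ε M (t, q)) (ρt := fun t q => -dt₂ (mor f g ε M) (t, q))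
    (P := fun t q => 2 * kpsi ε (q.1 - q.2) * (mdens f g (t, q.1) * mdens f g (t, q.2)))
    (Q := fun t q => 8 / M ^ 2 * (mdens f g (t, q.1) * mdens f g (t, q.2)))
    (J := fun i t q => morJ f g ε M i (t, q))
    (dJ := fun i t q => dx₂ i (morJ f g ε M i) (t, q))
    (β := 8 / M ^ 2 * m ^ 2) (B := K * B ^ 2) hab hmor.continuous.neg
    (contDiff_dt₂ hmor).continuous.neg
    (by simp only [Function.uncurry_def]; fun_prop) (by simp only [Function.uncurry_def]; fun_prop)
    (fun i => (hJ i).continuous) (fun i => (contDiff_dx₂ (hJ i)).continuous)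
    (fun t _ x => (hasDerivAt_dt₂ hmor t x).fun_neg)
    (fun i t _ x => hasLineDerivAt_dx₂ (hJ i) i t x)
    (fun t ht x => h.mor_monotone hε hM ht x.1 x.2)
    (fun t _ x => ?_) (fun t _ x => ?_) (fun t ht => ?_) (fun i t ht => ?_)
    (h.integral_abs_mor_le hε hM ⟨le_rfl, hab⟩).1.neg
    (h.integral_abs_mor_le hε hM ⟨hab, le_rfl⟩).1.neg).2
  · refine hflux.trans (ENNReal.ofReal_le_ofReal ?_)
    rw [integral_neg, integral_neg]
    have ha := (h.integral_abs_mor_le hε hM ⟨le_rfl, hab⟩).2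
    have hb := (h.integral_abs_mor_le hε hM ⟨hab, le_rfl⟩).2
    have h1 := mul_le_mul_of_nonneg_left (hH a ⟨le_rfl, hab⟩) (by positivity : 0 ≤ 16 * M)
    have h2 := mul_le_mul_of_nonneg_left (hH b ⟨hab, le_rfl⟩) (by positivity : 0 ≤ 16 * M)
    rw [abs_le] at ha hb
    linarith
  · have h1 := hm (t, x.1)
    have h2 := hm (t, x.2)
    have h3 := kpsi_nonneg hε (x.1 - x.2)
    positivity
  · have h1 := hm (t, x.1)
    have h2 := hm (t, x.2)
    positivity
  · have im := h.integrable_mdens ht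
    refine ⟨(im.mul_prod im).const_mul _, ?_⟩
    rw [integral_const_mul, integral_prod_mul (fun x => mdens f g (t, x)) fun x => mdens f g (t, x),
      sq]
    have h1 := hmass t ht
    have h0 := tint_nonneg hm (t := t)
    rw [tint] at h0 h1
    have := mul_self_le_mul_self h0 h1
    rw [← sq m] at this
    gcongr
  · have iD : Integrable fun x => hdens f g (t, x) :=
      ((h.integrable_mdens ht).add (h.integrable_gdens ht)).add (h.integrable_ldens ht)
    refine integrable_of_abs_le ((hJ i).continuous.comp (by fun_prop)) ((iD.mul_prod iD).const_mul K)
      (fun q => h.abs_morJ_le hε hM ht (hL t ht) i q.1 q.2) ?_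
    rw [integral_const_mul,
      integral_prod_mul (fun x => hdens f g (t, x)) fun x => hdens f g (t, x)]
    have e : ∫ x, hdens f g (t, x) = hnorm f g t := by
      simp only [hdens, hnorm, tint]
      have i2 : Integrable fun x => mdens f g (t, x) + gdens f g (t, x) :=
        (h.integrable_mdens ht).add (h.integrable_gdens ht)
      rw [integral_add i2 (h.integrable_ldens ht), integral_add (h.integrable_mdens ht) (h.integrable_gdens ht)]
    have h0 : 0 ≤ hnorm f g t := (tint_nonneg hm t).trans (tint_le_hnorm f g t).1
    rw [e, sq]
    exact mul_le_mul_of_nonneg_left (mul_self_le_mul_self h0 (hB t ht)) hK0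

end Interaction

section Collision

variable {f g : ℝ × Plane → ℝ} {a b : ℝ}

/-- The interaction of a continuous density with itself at small distances bounds its square. -/
theorem sq_le_lintegral_kpsi {ρ : Plane → ℝ} (hρ : Continuous ρ) (h0 : ∀ x, 0 ≤ ρ x) (y : Plane) :
    ∃ δ > 0, ∀ ε, 0 < ε → ε ≤ δ → ENNReal.ofReal (π / 8 * ρ y ^ 2) ≤
      ∫⁻ x, ENNReal.ofReal (2 * kpsi ε (x - y) * (ρ x * ρ y)) := by
  rcases (h0 y).eq_or_lt with h | h
  · exact ⟨1, one_pos, fun ε _ _ => by simp [← h]⟩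
  have hev : ∀ᶠ x in nhds y, ρ y / 2 < ρ x :=
    hρ.continuousAt.eventually (lt_mem_nhds (by linarith))
  obtain ⟨δ, hδ, hball⟩ := Metric.eventually_nhds_iff_ball.1 hev
  refine ⟨δ, hδ, fun ε hε hεδ => ?_⟩
  have key : ∀ x ∈ Metric.ball y ε, ρ y ^ 2 / (8 * ε ^ 2) ≤ 2 * kpsi ε (x - y) * (ρ x * ρ y) := by
    intro x hx
    have h1 := hball x (Metric.ball_subset_ball hεδ hx)
    have hz : zsq (x - y) ≤ ε ^ 2 := by
      have h2 : ‖x - y‖ ^ 2 ≤ ε ^ 2 := by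
        rw [Metric.mem_ball, dist_eq_norm] at hx
        gcongr
      rw [EuclideanSpace.norm_sq_eq, Fin.sum_univ_two] at h2
      simp only [Real.norm_eq_abs, sq_abs] at h2
      rw [zsq]
      linarith
    have h3 := le_kpsi hε hz
    calc ρ y ^ 2 / (8 * ε ^ 2) = 2 * (1 / (8 * ε ^ 2)) * (ρ y / 2 * ρ y) := by ring
      _ ≤ 2 * kpsi ε (x - y) * (ρ x * ρ y) := by
        have := kpsi_nonneg hε (x - y)
        gcongr
  calc ENNReal.ofReal (π / 8 * ρ y ^ 2)
      = ∫⁻ _ in Metric.ball y ε, ENNReal.ofReal (ρ y ^ 2 / (8 * ε ^ 2)) := by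
        rw [setLIntegral_const, EuclideanSpace.volume_ball_fin_two, ← ENNReal.ofReal_pow hε.le,
          ← ENNReal.ofReal_mul (by positivity), ← ENNReal.ofReal_mul (by positivity)]
        congr 1
        field_simp
    _ ≤ ∫⁻ x in Metric.ball y ε, ENNReal.ofReal (2 * kpsi ε (x - y) * (ρ x * ρ y)) :=
        setLIntegral_mono' Metric.isOpen_ball.measurableSet fun x hx =>
          ENNReal.ofReal_le_ofReal (key x hx)
    _ ≤ _ := setLIntegral_le_lintegral _ _

theorem Sol.lintegral_sq_le (h : Sol f g a b) (hab : a ≤ b) {m H M : ℝ} (hM : 0 < M)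
    (hmass : ∀ t ∈ Set.Icc a b, tint (mdens f g) t ≤ m)
    (hH : ∀ t ∈ Set.Icc a b,
      tint (mdens f g) t * (√(tint (mdens f g) t) * √(tint (gdens f g) t)) ≤ H) :
    ∫⁻ t in Set.Ioc a b, ∫⁻ y, ENNReal.ofReal (π / 8 * mdens f g (t, y) ^ 2)
      ≤ ENNReal.ofReal (32 * M * H + 8 / M ^ 2 * m ^ 2 * (b - a)) := by
  have hc : Continuous (mdens f g) := (contDiff_mdens h.smooth_re h.smooth_im).continuous
  have hM2 : ∀ n : ℕ, 0 < M / (n + 2) ∧ M / (n + 2) < M := fun n => by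
    refine ⟨by positivity, ?_⟩
    rw [div_lt_iff₀ (by positivity)]
    nlinarith [(n.cast_nonneg : (0 : ℝ) ≤ n)]
  have hlim : Filter.Tendsto (fun n : ℕ => M / ((n : ℝ) + 2)) Filter.atTop (nhds 0) :=
    tendsto_const_nhds.div_atTop
      (Filter.tendsto_atTop_add_const_right _ _ tendsto_natCast_atTop_atTop)
  set Q : ℕ → (ℝ × Plane) × Plane → ℝ≥0∞ := fun n p => ENNReal.ofReal
    (2 * kpsi (M / (n + 2)) (p.2 - p.1.2) * (mdens f g (p.1.1, p.2) * mdens f g p.1)) with hQ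
  have hQm : ∀ n, Measurable (Q n) := fun n => by
    have := (contDiff_kpsi (hM2 n).1).continuous
    exact (ENNReal.continuous_ofReal.comp (by fun_prop)).measurable
  have hGm : ∀ n, Measurable fun p => ∫⁻ x, Q n (p, x) := fun n => (hQm n).lintegral_prod_right'
  have hSm : Measurable fun p => ENNReal.ofReal (π / 8 * mdens f g p ^ 2) :=
    (ENNReal.continuous_ofReal.comp (by fun_prop)).measurable
  have hle : ∀ p, ENNReal.ofReal (π / 8 * mdens f g p ^ 2) ≤
      Filter.liminf (fun n => ∫⁻ x, Q n (p, x)) Filter.atTop := by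
    rintro ⟨t, y⟩
    obtain ⟨δ, hδ, hk⟩ := sq_le_lintegral_kpsi (continuous_slice hc t)
      (fun x => mdens_nonneg f g (t, x)) y
    refine Filter.le_liminf_of_le (by isBoundedDefault) ?_
    filter_upwards [hlim.eventually (gt_mem_nhds hδ)] with n hn
    have := hk _ (hM2 n).1 hn.le
    simpa only [hQ] using this
  have hn : ∀ n, ∫⁻ p, (∫⁻ x, Q n (p, x)) ∂((volume.restrict (Set.Ioc a b)).prod volume) ≤
      ENNReal.ofReal (32 * M * H + 8 / M ^ 2 * m ^ 2 * (b - a)) := fun n => by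
    have hk := h.lintegral_kpsi_le (hM2 n).1 (hM2 n).2 hab hmass hH
    have hcont := (contDiff_kpsi (hM2 n).1).continuous
    have e : ∀ t, ∫⁻ q : Plane × Plane, ENNReal.ofReal (2 * kpsi (M / (n + 2)) (q.1 - q.2) *
        (mdens f g (t, q.1) * mdens f g (t, q.2))) ∂(volume.prod volume) =
        ∫⁻ y, ∫⁻ x, Q n ((t, y), x) := fun t => by
      rw [lintegral_prod_symm]
      exact (ENNReal.continuous_ofReal.comp (by fun_prop)).measurable.aemeasurable
    rw [lintegral_prod _ (hGm n).aemeasurable]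
    simpa only [e] using hk
  have h1 := lintegral_mono (μ := (volume.restrict (Set.Ioc a b)).prod volume) hle
  have h2 := lintegral_liminf_le (μ := (volume.restrict (Set.Ioc a b)).prod volume)
    (u := Filter.atTop) hGm
  have h3 : Filter.liminf (fun n => ∫⁻ p, (∫⁻ x, Q n (p, x))
      ∂((volume.restrict (Set.Ioc a b)).prod volume)) Filter.atTop ≤
      ENNReal.ofReal (32 * M * H + 8 / M ^ 2 * m ^ 2 * (b - a)) :=
    Filter.liminf_le_of_frequently_le' (Filter.Frequently.of_forall hn)
  rw [← lintegral_prod _ hSm.aemeasurable]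
  exact h1.trans (h2.trans h3)

end Collision

theorem integral_integral_le_of_lintegral {F : ℝ × Plane → ℝ} (hF : Continuous F)
    (h0 : ∀ p, 0 ≤ F p) {s : Set ℝ} {B : ℝ} (hB : 0 ≤ B)
    (h : ∫⁻ t in s, ∫⁻ x, ENNReal.ofReal (F (t, x)) ≤ ENNReal.ofReal B) :
    ∫ t in s, ∫ x, F (t, x) ≤ B := by
  have hm : StronglyMeasurable fun t => ∫ x, F (t, x) :=
    hF.stronglyMeasurable.integral_prod_right'
  rw [integral_eq_lintegral_of_nonneg_ae
    (Filter.Eventually.of_forall fun t => integral_nonneg fun x => h0 _) hm.aestronglyMeasurable]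
  refine ENNReal.toReal_le_of_le_ofReal hB (le_trans (lintegral_mono fun t => ?_) h)
  rw [integral_eq_lintegral_of_nonneg_ae (Filter.Eventually.of_forall fun x => h0 _)
    (continuous_slice hF t).aestronglyMeasurable]
  exact ENNReal.ofReal_toReal_le

section Complex

open SchwartzMap

variable {u : ℝ → Plane → ℂ} {T : ℝ}

/-- The real part of a function on space-time. -/
def reX (u : ℝ → Plane → ℂ) (p : ℝ × Plane) : ℝ := (u p.1 p.2).re

/-- The imaginary part of a function on space-time. -/
def imX (u : ℝ → Plane → ℂ) (p : ℝ × Plane) : ℝ := (u p.1 p.2).im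

theorem mdens_reX_imX (p : ℝ × Plane) : mdens (reX u) (imX u) p = ‖u p.1 p.2‖ ^ 2 := by
  rw [← Complex.normSq_eq_norm_sq, Complex.normSq_apply, mdens, reX, imX]

theorem slice_reX_imX {t : ℝ} {φ : 𝓢(Plane, ℂ)} (hφ : ⇑φ = u t) :
    Slice (reX u) (imX u) t φ := fun x => by
  rw [hφ]; rfl

theorem pd_schwartz (φ : 𝓢(Plane, ℂ)) (j : Fin 2) : pd j ⇑φ = ⇑(sdx j φ) := by
  ext x
  rw [sdx, SchwartzMap.lineDerivOp_apply, φ.differentiableAt.lineDeriv_eq_fderiv]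
  rfl

theorem lap_schwartz (φ : 𝓢(Plane, ℂ)) (x : Plane) : lap ⇑φ x = slap φ x := by
  simp only [lap, pd_schwartz, Fin.sum_univ_two]
  rfl

theorem IsNLSSolution.sol (h : IsNLSSolution 2 T u) : Sol (reX u) (imX u) 0 T := by
  obtain ⟨hs, hS, he⟩ := h
  have hf : ContDiff ℝ ∞ (reX u) := Complex.reCLM.contDiff.comp hs
  have hg : ContDiff ℝ ∞ (imX u) := Complex.imCLM.contDiff.comp hs
  have key : ∀ t ∈ Set.Icc 0 T, ∀ x,
      dt (reX u) (t, x) = -lapX (imX u) (t, x)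
        + mdens (reX u) (imX u) (t, x) * imX u (t, x) ∧
      dt (imX u) (t, x) = lapX (reX u) (t, x)
        - mdens (reX u) (imX u) (t, x) * reX u (t, x) := by
    intro t ht x
    obtain ⟨φ, hφ⟩ := hS t ht
    have h1 := (slice_reX_imX hφ).slap hf hg x
    have h2 := he t ht x
    have hd : HasDerivAt (fun s => u s x) (deriv (fun s => u s x) t) t := by
      have : Differentiable ℝ (Function.uncurry u) := hs.differentiable (by simp)
      have h3 : Differentiable ℝ fun s => u s x :=
        this.comp (differentiable_id.prodMk (differentiable_const x))
      exact (h3 t).hasDerivAt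
    have hr := (Complex.reCLM.hasFDerivAt.comp_hasDerivAt t hd).unique (hasDerivAt_dt hf t x)
    have hi := (Complex.imCLM.hasFDerivAt.comp_hasDerivAt t hd).unique (hasDerivAt_dt hg t x)
    rw [Complex.reCLM_apply] at hr
    rw [Complex.imCLM_apply] at hi
    rw [← hφ, lap_schwartz, h1, hφ, ← Complex.ofReal_pow, ← mdens_reX_imX (t, x)] at h2
    have e1 := congrArg Complex.re h2
    have e2 := congrArg Complex.im h2
    simp only [Complex.add_re, Complex.add_im, Complex.mul_re, Complex.mul_im, Complex.I_re,
      Complex.I_im, Complex.ofReal_re, Complex.ofReal_im, hr, hi] at e1 e2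
    constructor
    · change _ = _ + _ * (u t x).im
      linarith
    · change _ = _ - _ * (u t x).re
      linarith
  exact ⟨hf, hg, fun t ht x => (key t ht x).1, fun t ht x => (key t ht x).2, fun t ht =>
    (hS t ht).imp fun φ hφ => slice_reX_imX hφ⟩

theorem L2Norm_eq_sqrt (t : ℝ) : L2Norm (u t) = √(tint (mdens (reX u) (imX u)) t) := by
  rw [L2Norm, ← Real.sqrt_eq_rpow, tint]
  simp only [mdens_reX_imX]

theorem IsNLSSolution.sqrt_tint_gdens (h : IsNLSSolution 2 T u) {t : ℝ} (ht : t ∈ Set.Icc 0 T) :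
    √(tint (gdens (reX u) (imX u)) t) = 2 * π * HdotNorm 1 (u t) := by
  have hs := h.sol
  obtain ⟨φ, hφ⟩ := h.2.1 t ht
  have hsl := slice_reX_imX hφ
  have e : tint (gdens (reX u) (imX u)) t = (2 * π) ^ 2 * ∫ ξ, ‖ξ‖ ^ 2 * ‖𝓕 φ ξ‖ ^ 2 := by
    rw [← integral_norm_sq_grad]
    simp only [tint, gdens, (hsl.sdx hs.smooth_re hs.smooth_im _).mdens_eq]
  rw [e, Real.sqrt_mul (by positivity), Real.sqrt_sq (by positivity), HdotNorm,
    ← Real.sqrt_eq_rpow, ← hφ, SchwartzMap.fourier_coe]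
  have e2 : ∀ ξ : Plane, ‖ξ‖ ^ (2 * (1 : ℝ)) = ‖ξ‖ ^ 2 := fun ξ => by
    rw [mul_one, Real.rpow_two]
  simp only [e2]

end Complex

/-- The improved two-dimensional interaction Morawetz estimate with a
`T^{1/3}` factor. -/
theorem interaction_morawetz_2d :
    ∃ C > (0:ℝ), ∀ T > (0:ℝ), ∀ u : ℝ → EuclideanSpace ℝ (Fin 2) → ℂ,
      IsNLSSolution 2 T u →
      (∫ t in Set.Ioc (0:ℝ) T, ∫ x, ‖u t x‖ ^ 4)
        ≤ C * T ^ ((1:ℝ)/3) *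
          ((⨆ t ∈ Set.Icc (0:ℝ) T, (L2Norm (u t)) ^ 3 * HdotNorm 1 (u t))
            + (L2Norm (u 0)) ^ 4) := by
  refine ⟨512, by norm_num, fun T hT u h => ?_⟩
  have hs := h.sol
  set f := reX u
  set g := imX u
  have hm0 := tint_nonneg (mdens_nonneg f g)
  have hg0 := tint_nonneg (gdens_nonneg f g)
  obtain ⟨B, hB⟩ := hs.exists_hnorm_le
  have hmB : ∀ t ∈ Set.Icc 0 T, tint (mdens f g) t ≤ B := fun t ht =>
    (tint_le_hnorm f g t).1.trans (hB t ht)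
  have hgB : ∀ t ∈ Set.Icc 0 T, tint (gdens f g) t ≤ B := fun t ht =>
    (tint_le_hnorm f g t).2.1.trans (hB t ht)
  have hmass : ∀ t ∈ Set.Icc 0 T, tint (mdens f g) t ≤ tint (mdens f g) 0 := by
    intro t ht
    have hsub : Set.Icc 0 t ⊆ Set.Icc 0 T := Set.Icc_subset_Icc_right ht.2
    exact ((hs.mono le_rfl ht.2).mass_eq ht.1 (fun r hr => hmB r (hsub hr))
      fun r hr => hgB r (hsub hr)).le
  have hB0 : 0 ≤ B := (hm0 0).trans (hmB 0 ⟨le_rfl, hT.le⟩)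
  have hprod : ∀ t ∈ Set.Icc 0 T, 2 * π * (L2Norm (u t) ^ 3 * HdotNorm 1 (u t)) =
      tint (mdens f g) t * (√(tint (mdens f g) t) * √(tint (gdens f g) t)) := by
    intro t ht
    rw [h.sqrt_tint_gdens ht, L2Norm_eq_sqrt]
    nth_rewrite 2 [← Real.sq_sqrt (hm0 t)]
    ring
  set S := ⨆ t ∈ Set.Icc (0:ℝ) T, (L2Norm (u t)) ^ 3 * HdotNorm 1 (u t) with hS
  have hpi : 0 < 2 * π := by positivity
  have hvB : ∀ t ∈ Set.Icc 0 T, L2Norm (u t) ^ 3 * HdotNorm 1 (u t) ≤ B * (√B * √B) / (2 * π) := by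
    intro t ht
    rw [le_div_iff₀' hpi, hprod t ht]
    have h1 := hmB t ht
    have h2 := hgB t ht
    gcongr
  have hSle : ∀ t ∈ Set.Icc 0 T, L2Norm (u t) ^ 3 * HdotNorm 1 (u t) ≤ S := by
    intro t ht
    have hb : BddAbove (Set.range fun t =>
        ⨆ _ : t ∈ Set.Icc (0:ℝ) T, L2Norm (u t) ^ 3 * HdotNorm 1 (u t)) := by
      refine ⟨B * (√B * √B) / (2 * π), ?_⟩
      rintro _ ⟨r, rfl⟩
      exact Real.iSup_le (hvB r) (by positivity)
    refine le_trans (le_of_eq ?_) (le_ciSup hb t)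
    have : Nonempty (t ∈ Set.Icc (0:ℝ) T) := ⟨ht⟩
    exact (ciSup_const).symm
  have hS0 : 0 ≤ S := by
    refine le_trans ?_ (hSle 0 ⟨le_rfl, hT.le⟩)
    rw [L2Norm, HdotNorm]
    positivity
  have hH : ∀ t ∈ Set.Icc 0 T,
      tint (mdens f g) t * (√(tint (mdens f g) t) * √(tint (gdens f g) t)) ≤ 2 * π * S :=
    fun t ht => by
      rw [← hprod t ht]
      exact mul_le_mul_of_nonneg_left (hSle t ht) hpi.le
  set M := T ^ ((1:ℝ)/3) with hMd
  have hM : 0 < M := Real.rpow_pos_of_pos hT _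
  have hM3 : M ^ 3 = T := by
    rw [hMd, ← Real.rpow_natCast, ← Real.rpow_mul hT.le]
    norm_num
  have hL4 : L2Norm (u 0) ^ 4 = tint (mdens f g) 0 ^ 2 := by
    rw [L2Norm_eq_sqrt, show 4 = 2 * 2 from rfl, pow_mul, Real.sq_sqrt (hm0 0)]
  have hmain := hs.lintegral_sq_le hT.le hM hmass hH
  have hB' : 32 * M * (2 * π * S) + 8 / M ^ 2 * tint (mdens f g) 0 ^ 2 * (T - 0) =
      M * (64 * π * S + 8 * L2Norm (u 0) ^ 4) := by
    rw [hL4, ← hM3]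
    field_simp
    ring
  rw [hB'] at hmain
  have hL0 : 0 ≤ L2Norm (u 0) ^ 4 := by rw [hL4]; positivity
  have hI := integral_integral_le_of_lintegral (F := fun p => π / 8 * mdens f g p ^ 2)
    (by have := (contDiff_mdens hs.smooth_re hs.smooth_im).continuous; fun_prop)
    (fun p => by positivity) (by positivity) hmain
  have e : ∀ t x, π / 8 * mdens f g (t, x) ^ 2 = π / 8 * ‖u t x‖ ^ 4 := fun t x => by
    rw [mdens_reX_imX]; ring
  simp only [e, integral_const_mul] at hI
  have hpi3 := Real.pi_gt_three
  rw [← mul_le_mul_iff_right₀ (by positivity : 0 < π / 8)]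
  refine hI.trans ?_
  have h1 : 0 ≤ (π - 3) * (L2Norm (u 0) ^ 4) := mul_nonneg (by linarith) hL0
  calc M * (64 * π * S + 8 * L2Norm (u 0) ^ 4) ≤ M * (64 * π * (S + L2Norm (u 0) ^ 4)) := by
        gcongr
        nlinarith
    _ = _ := by ring

end
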